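/- arXiv:1808.09358 — 2 statements merged into one kernel-verified Lean document; each statement's English description precedes it below -/
import Mathlib

section
/- Suppose d ≥ 3 is odd and let Φ ∈ 𝒮(ℝ^d). Then there is a unique smooth function f : ℝ∖{0} → ℂ such that ∫_{ℝ^d} g(q_d(x)) Φ(x) dx = ∫_ℝ g(ξ) f(ξ) dξ for every continuous compactly supported g : ℝ → ℂ whose support does not contain 0. Moreover f, together with all its derivatives, decays rapidly at infinity, and there exist smooth functions C₀, C₁, C₂ : ℝ → ℂ such that for all ξ ≠ 0: f(ξ) = C₀(ξ) + (C₁(ξ) + C₂(ξ)·sgn(ξ))·|ξ|^{(d−2)/2}. -/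
open MeasureTheory Filter
noncomputable section

/-- Extension of a vector in `ℝ^d` by zeros, for convenient indexing. -/
def padR {d : ℕ} (x : Fin d → ℝ) (n : ℕ) : ℝ :=
  if h : n < d then x ⟨n, h⟩ else 0

/-- The split quadratic form `q_d` on `ℝ^d`. -/
def splitQR (d : ℕ) (x : Fin d → ℝ) : ℝ :=
  if Even d then ∑ i ∈ Finset.range (d / 2), padR x (2 * i) * padR x (2 * i + 1)
  else padR x 0 ^ 2 + ∑ i ∈ Finset.range (d / 2), padR x (2 * i + 1) * padR x (2 * i + 2)
/-- oscillatory integral -/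
def osc {X : Type*} [MeasurableSpace X] (μ : Measure X) (q : X → ℝ) (φ : X → ℂ) (t : ℝ) : ℂ :=
  ∫ x, Complex.exp (2 * Real.pi * Complex.I * t * q x) * φ x ∂μ

lemma norm_osc_exp (t q : ℝ) : ‖Complex.exp (2 * Real.pi * Complex.I * t * q)‖ = 1 := by
  have : (2 * Real.pi * Complex.I * t * q : ℂ) = ((2 * Real.pi * t * q : ℝ) : ℂ) * Complex.I := by
    push_cast; ring
  rw [this, Complex.norm_exp_ofReal_mul_I]

lemma osc_norm_le {X : Type*} [MeasurableSpace X] (μ : Measure X) (q : X → ℝ) (φ : X → ℂ) (t : ℝ) :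
    ‖osc μ q φ t‖ ≤ ∫ x, ‖φ x‖ ∂μ := by
  unfold osc
  refine (norm_integral_le_integral_norm _).trans (le_of_eq ?_)
  congr 1; ext x
  rw [norm_mul, norm_osc_exp, one_mul]

lemma osc_integrable {X : Type*} [MeasurableSpace X] (μ : Measure X) (q : X → ℝ)
    (hq : Measurable q) (φ : X → ℂ) (hφ : Integrable φ μ) (t : ℝ) :
    Integrable (fun x => Complex.exp (2 * Real.pi * Complex.I * t * q x) * φ x) μ := by
  refine hφ.bdd_mul (c := 1) (by fun_prop) ?_
  exact Eventually.of_forall fun x => (norm_osc_exp t (q x)).le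

lemma osc_continuous {X : Type*} [MeasurableSpace X] (μ : Measure X) (q : X → ℝ)
    (hq : Measurable q) (φ : X → ℂ) (hφ : Integrable φ μ) : Continuous (osc μ q φ) := by
  unfold osc
  refine continuous_of_dominated (bound := fun x => ‖φ x‖) ?_ ?_ hφ.norm ?_
  · intro t; exact (osc_integrable μ q hq φ hφ t).aestronglyMeasurable
  · intro t; refine Eventually.of_forall fun x => ?_
    rw [norm_mul, norm_osc_exp, one_mul]
  · refine Eventually.of_forall fun x => ?_
    fun_prop

lemma osc_hasDerivAt {X : Type*} [MeasurableSpace X] (μ : Measure X) (q : X → ℝ)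
    (hq : Measurable q) (φ : X → ℂ) (hφ : Integrable φ μ)
    (hφ' : Integrable (fun x => (q x : ℂ) * φ x) μ) (t : ℝ) :
    HasDerivAt (osc μ q φ) (2 * Real.pi * Complex.I * osc μ q (fun x => q x * φ x) t) t := by
  unfold osc
  rw [← integral_const_mul]
  refine (hasDerivAt_integral_of_dominated_loc_of_deriv_le (μ := μ) (s := Set.univ) (x₀ := t)
    (F := fun (t : ℝ) x => Complex.exp (2 * Real.pi * Complex.I * t * q x) * φ x)
    (F' := fun (t : ℝ) x => 2 * Real.pi * Complex.I *
      (Complex.exp (2 * Real.pi * Complex.I * t * q x) * (q x * φ x)))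
    (bound := fun x => 2 * Real.pi * ‖(q x : ℂ) * φ x‖) Filter.univ_mem ?_ ?_ ?_ ?_ ?_ ?_).2
  · exact Eventually.of_forall fun t => (osc_integrable μ q hq φ hφ t).aestronglyMeasurable
  · exact osc_integrable μ q hq φ hφ t
  · exact ((osc_integrable μ q hq _ hφ' t).const_mul _).aestronglyMeasurable
  · refine Eventually.of_forall fun x s _ => ?_
    rw [norm_mul, norm_mul (Complex.exp _), norm_osc_exp, one_mul]
    simp [abs_of_pos Real.pi_pos]
  · exact hφ'.norm.const_mul _
  · refine Eventually.of_forall fun x s _ => ?_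
    have h1 : HasDerivAt (fun s : ℝ => (2 * Real.pi * Complex.I * s * q x : ℂ))
        (2 * Real.pi * Complex.I * q x) s := by
      have h2 : HasDerivAt (fun s : ℝ => (s : ℂ)) 1 s := Complex.ofRealCLM.hasDerivAt
      have := ((h2.const_mul (2 * Real.pi * Complex.I : ℂ)).mul_const (q x : ℂ))
      simpa using this
    have := (h1.cexp).mul_const (φ x)
    have e : 2 * Real.pi * Complex.I *
      (Complex.exp (2 * Real.pi * Complex.I * s * q x) * (q x * φ x)) =
      Complex.exp (2 * Real.pi * Complex.I * s * q x) * (2 * Real.pi * Complex.I * q x) * φ x := by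
      ring
    rw [e]; exact this

lemma osc_deriv {X : Type*} [MeasurableSpace X] (μ : Measure X) (q : X → ℝ)
    (hq : Measurable q) (φ : X → ℂ) (hφ : Integrable φ μ)
    (hφ' : Integrable (fun x => (q x : ℂ) * φ x) μ) :
    deriv (osc μ q φ) = fun t => 2 * Real.pi * Complex.I * osc μ q (fun x => q x * φ x) t :=
  funext fun t => (osc_hasDerivAt μ q hq φ hφ hφ' t).deriv

lemma osc_contDiff {X : Type*} [MeasurableSpace X] (μ : Measure X) (q : X → ℝ)
    (hq : Measurable q) (n : ℕ) : ∀ (φ : X → ℂ)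
    (_ : ∀ j ≤ n, Integrable (fun x => (q x : ℂ) ^ j * φ x) μ), ContDiff ℝ n (osc μ q φ) := by
  induction n with
  | zero =>
    intro φ h
    have := h 0 le_rfl
    simp only [pow_zero, one_mul] at this
    exact contDiff_zero.2 (osc_continuous μ q hq φ this)
  | succ n ih =>
    intro φ h
    have h0 := h 0 (by omega)
    have h1 := h 1 (by omega)
    simp only [pow_zero, one_mul, pow_one] at h0 h1
    have : ((n + 1 : ℕ) : WithTop ℕ∞) = (n : WithTop ℕ∞) + 1 := by push_cast; rfl
    rw [this, contDiff_succ_iff_deriv]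
    refine ⟨fun t => (osc_hasDerivAt μ q hq φ h0 h1 t).differentiableAt, by simp, ?_⟩
    rw [osc_deriv μ q hq φ h0 h1]
    refine contDiff_const.mul (ih _ fun j hj => ?_)
    have := h (j + 1) (by omega)
    refine this.congr (Eventually.of_forall fun x => ?_)
    simp only [pow_succ]; ring

lemma osc_iteratedDeriv {X : Type*} [MeasurableSpace X] (μ : Measure X) (q : X → ℝ)
    (hq : Measurable q) (n : ℕ) : ∀ (φ : X → ℂ)
    (_ : ∀ j ≤ n, Integrable (fun x => (q x : ℂ) ^ j * φ x) μ),
    iteratedDeriv n (osc μ q φ) =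
      fun t => (2 * Real.pi * Complex.I) ^ n * osc μ q (fun x => (q x : ℂ) ^ n * φ x) t := by
  induction n with
  | zero => intro φ h; ext t; simp
  | succ n ih =>
    intro φ h
    rw [iteratedDeriv_succ, ih φ fun j hj => h j (by omega)]
    ext t
    rw [deriv_const_mul_field, osc_deriv μ q hq _ (h n (by omega))]
    · simp only [pow_succ]
      have : (fun x => (q x : ℂ) * ((q x : ℂ) ^ n * φ x)) =
        fun x => (q x : ℂ) ^ n * (q x : ℂ) * φ x := by ext x; ring
      rw [this]; ring
    · refine (h (n + 1) le_rfl).congr (Eventually.of_forall fun x => ?_)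
      simp only [pow_succ]; ring

lemma osc_iteratedDeriv_bdd {X : Type*} [MeasurableSpace X] (μ : Measure X) (q : X → ℝ)
    (hq : Measurable q) (n : ℕ) (φ : X → ℂ)
    (h : ∀ j ≤ n, Integrable (fun x => (q x : ℂ) ^ j * φ x) μ) :
    ∃ C : ℝ, ∀ t, ‖iteratedDeriv n (osc μ q φ) t‖ ≤ C := by
  rw [osc_iteratedDeriv μ q hq n φ h]
  refine ⟨‖(2 * Real.pi * Complex.I : ℂ) ^ n‖ * ∫ x, ‖(q x : ℂ) ^ n * φ x‖ ∂μ, fun t => ?_⟩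
  rw [norm_mul]
  exact mul_le_mul_of_nonneg_left (osc_norm_le _ _ _ _) (norm_nonneg _)

/-- the basic singular function -/
def sg (a b : ℂ) (x : ℝ) : ℂ := (a + b * ((Real.sign x : ℝ) : ℂ)) * ((Real.sqrt |x| : ℝ) : ℂ)

lemma sg_zero (a b : ℂ) : sg a b 0 = 0 := by simp [sg]

lemma sg_norm_le (a b : ℂ) (x : ℝ) : ‖sg a b x‖ ≤ (‖a‖ + ‖b‖) * Real.sqrt |x| := by
  unfold sg
  rw [norm_mul, Complex.norm_real, Real.norm_of_nonneg (Real.sqrt_nonneg _)]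
  refine mul_le_mul_of_nonneg_right ((norm_add_le _ _).trans ?_) (Real.sqrt_nonneg _)
  gcongr
  rw [norm_mul, Complex.norm_real]
  have : ‖Real.sign x‖ ≤ 1 := by
    rcases Real.sign_apply_eq x with h | h | h <;> rw [h] <;> simp
  nlinarith [norm_nonneg b]

lemma sg_tendsto_zero (a b : ℂ) : Tendsto (sg a b) (nhds 0) (nhds 0) := by
  refine squeeze_zero_norm (sg_norm_le a b) ?_
  have : Continuous fun x : ℝ => (‖a‖ + ‖b‖) * Real.sqrt |x| := by fun_prop
  simpa using this.tendsto 0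

lemma sg_hasDerivAt (a b : ℂ) {x : ℝ} (hx : x ≠ 0) :
    HasDerivAt (sg a b) (sg a b x / (2 * x)) x := by
  have hsq : HasDerivAt (fun y : ℝ => ((Real.sqrt |y| : ℝ) : ℂ))
      (((Real.sqrt |x| : ℝ) : ℂ) / (2 * x)) x := by
    have h1 : HasDerivAt (fun y : ℝ => Real.sqrt |y|) (Real.sqrt |x| / (2 * x)) x := by
      have h0 := (hasDerivAt_abs hx).sqrt (abs_ne_zero.2 hx)
      convert h0 using 1
      have hpos : 0 < Real.sqrt |x| := Real.sqrt_pos.2 (abs_pos.2 hx)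
      rw [div_eq_div_iff (by simpa using hx) (by positivity)]
      have := Real.mul_self_sqrt (abs_nonneg x)
      have h3 : (SignType.sign x : ℝ) * x = |x| := by
        exact sign_mul_self x
      nlinarith
    have := h1.ofReal_comp
    simpa using this
  have hs : (fun y : ℝ => a + b * ((Real.sign y : ℝ) : ℂ)) =ᶠ[nhds x]
      fun _ => a + b * ((Real.sign x : ℝ) : ℂ) := by
    rcases lt_or_gt_of_ne hx with h | h
    · filter_upwards [eventually_lt_nhds h] with y hy
      rw [Real.sign_of_neg hy, Real.sign_of_neg h]
    · filter_upwards [eventually_gt_nhds h] with y hy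
      rw [Real.sign_of_pos hy, Real.sign_of_pos h]
  have h := hsq.const_mul (a + b * ((Real.sign x : ℝ) : ℂ))
  have h' := h.congr_of_eventuallyEq (f₁ := sg a b) (by
    filter_upwards [hs] with y hy
    simp only [sg, hy])
  have e : sg a b x / (2 * x) = (a + b * ((Real.sign x : ℝ) : ℂ)) *
      (((Real.sqrt |x| : ℝ) : ℂ) / (2 * x)) := by
    simp only [sg]; ring
  rw [e]; exact h'

lemma sg_contDiff (a b : ℂ) (K : ℕ) : ContDiff ℝ K (fun x : ℝ => (x : ℂ) ^ K * sg a b x) := by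
  induction K with
  | zero =>
    refine contDiff_zero.2 (continuous_iff_continuousAt.2 fun x => ?_)
    simp only [pow_zero, one_mul]
    by_cases hx : x = 0
    · subst hx
      rw [ContinuousAt, sg_zero]; exact sg_tendsto_zero a b
    · exact (sg_hasDerivAt a b hx).continuousAt
  | succ K ih =>
    have key : ∀ x : ℝ, HasDerivAt (fun x : ℝ => (x : ℂ) ^ (K + 1) * sg a b x)
        ((K + 3 / 2) * ((x : ℂ) ^ K * sg a b x)) x := by
      intro x
      by_cases hx : x = 0
      · subst hx
        rw [sg_zero, mul_zero, mul_zero, hasDerivAt_iff_tendsto_slope]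
        have h1 : Tendsto (fun x : ℝ => (x : ℂ) ^ K * sg a b x) (nhdsWithin 0 {0}ᶜ) (nhds 0) := by
          have := ih.continuous.tendsto 0
          simp only [sg_zero, mul_zero] at this
          exact this.mono_left nhdsWithin_le_nhds
        refine h1.congr' ?_
        filter_upwards [self_mem_nhdsWithin] with y hy
        have hy' : (y : ℂ) ≠ 0 := by exact_mod_cast hy
        rw [slope_def_module]
        simp only [sg_zero, mul_zero, sub_zero, Complex.real_smul, pow_succ]
        push_cast
        field_simp
      · have h2 : HasDerivAt (fun s : ℝ => (s : ℂ)) 1 x := Complex.ofRealCLM.hasDerivAt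
        have := (h2.pow (K + 1)).mul (sg_hasDerivAt a b hx)
        have hx' : (x : ℂ) ≠ 0 := by exact_mod_cast hx
        have e : ((K + 3 / 2) * ((x : ℂ) ^ K * sg a b x)) =
            ((K + 1 : ℕ) : ℂ) * (x : ℂ) ^ (K + 1 - 1) * 1 * sg a b x +
              (x : ℂ) ^ (K + 1) * (sg a b x / (2 * x)) := by
          simp only [Nat.add_sub_cancel]
          push_cast
          field_simp
          ring
        rw [e]; exact this
    have : ((K + 1 : ℕ) : WithTop ℕ∞) = (K : WithTop ℕ∞) + 1 := by push_cast; rfl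
    rw [this, contDiff_succ_iff_deriv]
    refine ⟨fun t => (key t).differentiableAt, by simp, ?_⟩
    rw [show deriv (fun x : ℝ => (x : ℂ) ^ (K + 1) * sg a b x) = _ from
      funext fun t => (key t).deriv]
    exact contDiff_const.mul ih

lemma div_pow_contDiff (g : ℝ → ℂ) (n K : ℕ) (hg : ContDiff ℝ n g)
    (h0 : g =ᶠ[nhds 0] 0) : ContDiff ℝ n (fun x : ℝ => g x / (x : ℂ) ^ K) := by
  refine contDiff_iff_contDiffAt.2 fun x => ?_
  by_cases hx : x = 0
  · subst hx
    refine (contDiffAt_const (c := (0 : ℂ))).congr_of_eventuallyEq ?_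
    filter_upwards [h0] with y hy
    simp [hy]
  · simp only [div_eq_mul_inv]
    refine hg.contDiffAt.mul (ContDiffAt.inv ?_ ?_)
    · exact (Complex.ofRealCLM.contDiff.contDiffAt).pow K
    · exact pow_ne_zero _ (by exact_mod_cast hx)

lemma borel_aux : ∃ χ : ℝ → ℝ, (∀ n : ℕ, ContDiff ℝ n χ) ∧ HasCompactSupport χ ∧
    χ =ᶠ[nhds 0] 1 := by
  let b : ContDiffBump (0 : ℝ) := ⟨1, 2, by norm_num, by norm_num⟩
  exact ⟨b, fun n => b.contDiff, b.hasCompactSupport, b.eventuallyEq_one⟩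

lemma borel_lemma (a : ℕ → ℂ) : ∃ C : ℝ → ℂ, (∀ n : ℕ, ContDiff ℝ n C) ∧
    ∀ K : ℕ, ∃ D : ℝ → ℂ, (∀ n : ℕ, ContDiff ℝ n D) ∧
      ∀ x : ℝ, C x = (∑ k ∈ Finset.range K, a k * (x : ℂ) ^ k) + (x : ℂ) ^ K * D x := by
  obtain ⟨χ, hχ, hχc, hχ1⟩ := borel_aux
  let ψ : ℕ → ℝ → ℂ := fun k x => (x : ℂ) ^ k * (χ x : ℂ)
  have hψ : ∀ k n : ℕ, ContDiff ℝ n (ψ k) := fun k n =>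
    (Complex.ofRealCLM.contDiff.pow k).mul (Complex.ofRealCLM.contDiff.comp (hχ n))
  have hψc : ∀ k, HasCompactSupport (ψ k) := fun k => by
    refine hχc.mono' ?_
    intro x hx
    refine subset_tsupport _ ?_
    intro h; apply hx; simp [ψ, h]
  have hM : ∀ k j : ℕ, ∃ M : ℝ, ∀ x, ‖iteratedDeriv j (ψ k) x‖ ≤ M := by
    intro k j
    have hc : Continuous (iteratedDeriv j (ψ k)) :=
      (hψ k j).continuous_iteratedDeriv j le_rfl
    have hcs : HasCompactSupport (iteratedDeriv j (ψ k)) := by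
      refine ((hψc k).iteratedFDeriv (𝕜 := ℝ) j).mono ?_
      intro x hx h
      apply hx
      rw [iteratedDeriv_eq_iteratedFDeriv, h]; rfl
    exact hc.bounded_above_of_compact_support hcs
  choose M hM using hM
  have hM0 : ∀ k j, 0 ≤ M k j := fun k j => (norm_nonneg _).trans (hM k j 0)
  let lam : ℕ → ℝ := fun n => 1 + ‖a n‖ * 2 ^ n *
    ∑ k ∈ Finset.range (n + 1), ∑ j ∈ Finset.range (n + 1), M k j
  have hlam1 : ∀ n, 1 ≤ lam n := fun n => by
    have : 0 ≤ ‖a n‖ * 2 ^ n *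
      ∑ k ∈ Finset.range (n + 1), ∑ j ∈ Finset.range (n + 1), M k j :=
      mul_nonneg (by positivity) (Finset.sum_nonneg fun k _ => Finset.sum_nonneg fun j _ => hM0 k j)
    simp only [lam]; linarith
  have hlamM : ∀ n k j, k ≤ n → j ≤ n → ‖a n‖ * M k j ≤ lam n * (1 / 2) ^ n := by
    intro n k j hk hj
    have h1 : M k j ≤ ∑ k ∈ Finset.range (n + 1), ∑ j ∈ Finset.range (n + 1), M k j := by
      refine le_trans ?_ (Finset.single_le_sum (f := fun k => ∑ j ∈ Finset.range (n + 1), M k j)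
        (fun k _ => Finset.sum_nonneg fun j _ => hM0 k j) (Finset.mem_range.2 (Nat.lt_succ_of_le hk)))
      exact Finset.single_le_sum (f := fun j => M k j)
        (fun j _ => hM0 k j) (Finset.mem_range.2 (Nat.lt_succ_of_le hj))
    have h2 : ‖a n‖ * M k j * 2 ^ n ≤ lam n := by
      simp only [lam]
      nlinarith [mul_le_mul_of_nonneg_left h1 (by positivity : 0 ≤ ‖a n‖ * 2 ^ n)]
    rw [one_div, inv_pow, ← div_eq_mul_inv, le_div_iff₀ (by positivity)]
    exact h2
  -- terms
  let T : ℕ → ℕ → ℝ → ℂ := fun K k x => a (k + K) * ((x : ℂ) ^ k * (χ (lam (k + K) * x) : ℂ))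
  have hT : ∀ K k, T K k = fun x => (a (k + K) * ((lam (k + K) : ℂ) ^ k)⁻¹) *
      ψ k (lam (k + K) * x) := by
    intro K k
    ext x
    have : (lam (k + K) : ℂ) ≠ 0 := by
      exact_mod_cast (zero_lt_one.trans_le (hlam1 _)).ne'
    simp only [T, ψ]
    push_cast
    rw [mul_pow]
    field_simp
  have hTc : ∀ K k (n : ℕ), ContDiff ℝ n (T K k) := by
    intro K k n
    rw [hT]
    exact contDiff_const.mul ((hψ k n).comp (contDiff_const.mul contDiff_id))
  have hTb : ∀ K k j, j < k → ∀ x, ‖iteratedFDeriv ℝ j (T K k) x‖ ≤ (1 / 2) ^ k := by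
    intro K k j hj x
    rw [norm_iteratedFDeriv_eq_norm_iteratedDeriv, hT, iteratedDeriv_const_mul_field]
    have h3 := iteratedDeriv_comp_const_smul (n := j) (hψ k j) (lam (k + K))
    rw [h3, norm_mul, norm_mul, norm_inv, norm_pow, norm_smul, norm_pow, Complex.norm_real]
    have hl := hlam1 (k + K)
    rw [Real.norm_of_nonneg (by linarith)]
    set l := lam (k + K)
    have hl0 : 0 < l := by linarith
    obtain ⟨i, rfl⟩ := Nat.exists_eq_add_of_lt hj
    have h4 := hM (j + i + 1) j (l * x)
    have h5 := hlamM (j + i + 1 + K) (j + i + 1) j (by omega) (by omega)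
    calc ‖a (j + i + 1 + K)‖ * (l ^ (j + i + 1))⁻¹ *
          (l ^ j * ‖iteratedDeriv j (ψ (j + i + 1)) (l * x)‖)
        ≤ ‖a (j + i + 1 + K)‖ * (l ^ (j + i + 1))⁻¹ * (l ^ j * M (j + i + 1) j) := by gcongr
      _ = (‖a (j + i + 1 + K)‖ * M (j + i + 1) j) * (l ^ (i + 1))⁻¹ := by
          field_simp
          ring
      _ ≤ (l * (1 / 2) ^ (j + i + 1 + K)) * (l ^ (i + 1))⁻¹ := by gcongr
      _ = (1 / 2) ^ (j + i + 1 + K) * (l ^ i)⁻¹ := by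
          field_simp
          ring
      _ ≤ (1 / 2) ^ (j + i + 1 + K) * 1 := by
          gcongr
          exact inv_le_one_of_one_le₀ (one_le_pow₀ hl)
      _ ≤ (1 / 2) ^ (j + i + 1) := by
          rw [mul_one]
          exact pow_le_pow_of_le_one (by norm_num) (by norm_num) (by omega)
  have hS : Summable fun k : ℕ => (1 / 2 : ℝ) ^ k := summable_geometric_two
  let C : ℕ → ℝ → ℂ := fun K x => ∑' k, T K k x
  have hC : ∀ K (n : ℕ), ContDiff ℝ n (C K) := by
    intro K n
    refine contDiff_tsum_of_eventually (N := (n : ℕ∞)) (v := fun _ k => (1 / 2 : ℝ) ^ k)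
      (fun k => hTc K k n) (fun _ _ => hS) ?_
    intro j _
    rw [Nat.cofinite_eq_atTop]
    filter_upwards [eventually_gt_atTop j] with k hk x
    exact hTb K k j hk x
  have hsum : ∀ K x, Summable fun k => T K k x := by
    intro K x
    refine .of_norm_bounded_eventually hS ?_
    rw [Nat.cofinite_eq_atTop]
    filter_upwards [eventually_gt_atTop 0] with k hk
    simpa using hTb K k 0 hk x
  refine ⟨C 0, hC 0, fun K => ?_⟩
  let E : ℝ → ℂ := fun x => ∑ k ∈ Finset.range K, a k * (x : ℂ) ^ k * ((χ (lam k * x) : ℂ) - 1)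
  have hE : ∀ n : ℕ, ContDiff ℝ n E := by
    intro n
    refine ContDiff.sum fun k _ => ?_
    refine (contDiff_const.mul (Complex.ofRealCLM.contDiff.pow k)).mul ?_
    exact (Complex.ofRealCLM.contDiff.comp
      ((hχ n).comp (contDiff_const.mul contDiff_id))).sub contDiff_const
  have hE0 : E =ᶠ[nhds 0] 0 := by
    have : ∀ k ∈ Finset.range K, ∀ᶠ x : ℝ in nhds 0, χ (lam k * x) = 1 := by
      intro k _
      have ht : Tendsto (fun x : ℝ => lam k * x) (nhds 0) (nhds 0) := by
        have : Continuous fun x : ℝ => lam k * x := by fun_prop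
        simpa using this.tendsto 0
      exact ht.eventually hχ1
    rw [← eventually_all_finset] at this
    filter_upwards [this] with x hx
    exact Finset.sum_eq_zero fun k hk => by simp [hx k hk]
  refine ⟨fun x => E x / (x : ℂ) ^ K + C K x, fun n => (div_pow_contDiff E n K (hE n) hE0).add
    (hC K n), fun x => ?_⟩
  have h6 : C 0 x = ∑ k ∈ Finset.range K, T 0 k x + (x : ℂ) ^ K * C K x := by
    simp only [C]
    rw [← (hsum 0 x).sum_add_tsum_nat_add K, ← tsum_mul_left]
    congr 1
    refine tsum_congr fun k => ?_
    simp only [T, add_zero, pow_add]; ring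
  have h7 : (x : ℂ) ^ K * (E x / (x : ℂ) ^ K) = E x := by
    by_cases hx : x = 0
    · subst hx
      have : E 0 = 0 := hE0.self_of_nhds
      simp [this]
    · have : (x : ℂ) ≠ 0 := by exact_mod_cast hx
      field_simp
  rw [h6, mul_add, h7, ← add_assoc]
  congr 1
  simp only [E, T, ← Finset.sum_add_distrib]
  refine Finset.sum_congr rfl fun k _ => ?_
  simp only [add_zero]; ring

lemma sg_smul (c a b : ℂ) (x : ℝ) : c * sg a b x = sg (c * a) (c * b) x := by
  simp only [sg]; ring

/-- weight -/
def wt (j : ℕ) (t : ℝ) : ℂ := ((t ^ (-(3 / 2 : ℝ) - j) : ℝ) : ℂ)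

lemma wt_integrable (j : ℕ) : Integrable (wt j) (volume.restrict (Set.Ioi 1)) := by
  have := integrableOn_Ioi_rpow_of_lt (a := -(3 / 2 : ℝ) - j) (c := 1)
    (by have : (0 : ℝ) ≤ j := Nat.cast_nonneg j
        linarith) one_pos
  exact this.ofReal

lemma expI_eq (ξ t : ℝ) : (2 * Real.pi * Complex.I * ξ * t : ℂ) =
    Complex.I * ((2 * Real.pi * ξ * t : ℝ) : ℂ) := by push_cast; ring

lemma near_integrable (ξ : ℝ) : Integrable (fun t : ℝ => wt 0 t *
    (Complex.exp (2 * Real.pi * Complex.I * ξ * t) - 1)) (volume.restrict (Set.Ioc 0 1)) := by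
  have h : IntegrableOn (fun t : ℝ => t ^ (-(1 / 2) : ℝ)) (Set.Ioc 0 1) := by
    have := intervalIntegral.intervalIntegrable_rpow' (a := 0) (b := 1) (r := (-(1 / 2) : ℝ))
      (by norm_num)
    rwa [intervalIntegrable_iff_integrableOn_Ioc_of_le zero_le_one] at this
  refine (h.const_mul (2 * Real.pi * |ξ|)).mono' ?_ ?_
  · refine AEStronglyMeasurable.mul ?_ (by fun_prop)
    exact (Complex.measurable_ofReal.comp (by fun_prop : Measurable
      fun t : ℝ => t ^ (-(3 / 2 : ℝ) - (0 : ℕ)))).aestronglyMeasurable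
  · refine (ae_restrict_iff' measurableSet_Ioc).2 (Eventually.of_forall fun t ht => ?_)
    have ht0 : 0 < t := ht.1
    rw [norm_mul, expI_eq]
    have h1 := Real.norm_exp_I_mul_ofReal_sub_one_le (x := 2 * Real.pi * ξ * t)
    have h2 : ‖wt 0 t‖ = t ^ (-(3 / 2 : ℝ)) := by
      rw [wt, Complex.norm_real, Real.norm_of_nonneg (Real.rpow_nonneg ht0.le _)]; simp
    rw [h2]
    have h3 : t ^ (-(1 / 2) : ℝ) = t ^ (-(3 / 2) : ℝ) * t := by
      rw [← Real.rpow_add_one ht0.ne']; norm_num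
    rw [h3]
    have h4 : ‖2 * Real.pi * ξ * t‖ = 2 * Real.pi * |ξ| * t := by
      rw [Real.norm_eq_abs, abs_mul, abs_mul, abs_of_pos ht0, abs_of_pos Real.two_pi_pos]
    rw [h4] at h1
    have := mul_le_mul_of_nonneg_left h1 (Real.rpow_nonneg ht0.le (-(3 / 2)))
    linarith

/-- near part -/
def nearI (ξ : ℝ) : ℂ := ∫ t in Set.Ioc (0 : ℝ) 1, wt 0 t *
    (Complex.exp (2 * Real.pi * Complex.I * ξ * t) - 1)

lemma near_contDiff (n : ℕ) : ContDiff ℝ n nearI := by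
  have h : IntegrableOn (fun t : ℝ => t ^ (-(1 / 2) : ℝ)) (Set.Ioc 0 1) := by
    have := intervalIntegral.intervalIntegrable_rpow' (a := 0) (b := 1) (r := (-(1 / 2) : ℝ))
      (by norm_num)
    rwa [intervalIntegrable_iff_integrableOn_Ioc_of_le zero_le_one] at this
  have hC : Integrable (fun t : ℝ => ((t ^ (-(1 / 2) : ℝ) : ℝ) : ℂ))
    (volume.restrict (Set.Ioc 0 1)) := h.ofReal
  have hosc : ∀ n : ℕ, ContDiff ℝ n (osc (volume.restrict (Set.Ioc 0 1)) (fun t : ℝ => t)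
      (fun t : ℝ => ((t ^ (-(1 / 2) : ℝ) : ℝ) : ℂ))) := by
    intro n
    refine osc_contDiff _ _ measurable_id n _ fun j _ => ?_
    refine hC.bdd_mul (c := 1) (by fun_prop) ?_
    refine (ae_restrict_iff' measurableSet_Ioc).2 (Eventually.of_forall fun t ht => ?_)
    rw [norm_pow, Complex.norm_real, id_eq, Real.norm_of_nonneg ht.1.le]
    exact pow_le_one₀ ht.1.le ht.2
  have key : ∀ ξ, HasDerivAt nearI (2 * Real.pi * Complex.I *
      osc (volume.restrict (Set.Ioc 0 1)) (fun t : ℝ => t)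
      (fun t : ℝ => ((t ^ (-(1 / 2) : ℝ) : ℝ) : ℂ)) ξ) ξ := by
    intro ξ
    unfold nearI osc
    rw [← integral_const_mul]
    refine (hasDerivAt_integral_of_dominated_loc_of_deriv_le
      (μ := volume.restrict (Set.Ioc (0 : ℝ) 1)) (s := Set.univ) (x₀ := ξ)
      (F := fun (ξ : ℝ) (t : ℝ) => wt 0 t *
        (Complex.exp (2 * Real.pi * Complex.I * ξ * t) - 1))
      (F' := fun (ξ : ℝ) (t : ℝ) => 2 * Real.pi * Complex.I *
        (Complex.exp (2 * Real.pi * Complex.I * ξ * t) * ((t ^ (-(1 / 2) : ℝ) : ℝ) : ℂ)))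
      (bound := fun t => 2 * Real.pi * t ^ (-(1 / 2) : ℝ)) Filter.univ_mem ?_ ?_ ?_ ?_ ?_ ?_).2
    · exact Eventually.of_forall fun t => (near_integrable t).aestronglyMeasurable
    · exact near_integrable ξ
    · exact ((osc_integrable _ (fun t : ℝ => t) measurable_id _ hC ξ).const_mul
        _).aestronglyMeasurable
    · refine (ae_restrict_iff' measurableSet_Ioc).2 (Eventually.of_forall fun t ht s _ => ?_)
      rw [norm_mul, norm_mul (Complex.exp _), norm_osc_exp, one_mul, Complex.norm_real,
        Real.norm_of_nonneg (Real.rpow_nonneg ht.1.le _)]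
      simp [abs_of_pos Real.pi_pos]
    · exact h.const_mul _
    · refine (ae_restrict_iff' measurableSet_Ioc).2 (Eventually.of_forall fun t ht s _ => ?_)
      have h1 : HasDerivAt (fun s : ℝ => (2 * Real.pi * Complex.I * s * t : ℂ))
          (2 * Real.pi * Complex.I * t) s := by
        have h2 : HasDerivAt (fun s : ℝ => (s : ℂ)) 1 s := Complex.ofRealCLM.hasDerivAt
        have := ((h2.const_mul (2 * Real.pi * Complex.I : ℂ)).mul_const (t : ℂ))
        simpa using this
      have h5 := ((h1.cexp).sub_const 1).const_mul (wt 0 t)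
      have h3 : (((t ^ (-(1 / 2) : ℝ) : ℝ) : ℂ)) = wt 0 t * t := by
        rw [wt, ← Complex.ofReal_mul, ← Real.rpow_add_one ht.1.ne']; norm_num
      have e : 2 * Real.pi * Complex.I *
        (Complex.exp (2 * Real.pi * Complex.I * s * t) * ((t ^ (-(1 / 2) : ℝ) : ℝ) : ℂ)) =
        wt 0 t * (Complex.exp (2 * Real.pi * Complex.I * s * t) *
          (2 * Real.pi * Complex.I * t)) := by rw [h3]; ring
      rw [e]; exact h5
  refine ContDiff.of_le (n := ((n + 1 : ℕ) : WithTop ℕ∞)) ?_ (by exact_mod_cast Nat.le_succ n)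
  have : ((n + 1 : ℕ) : WithTop ℕ∞) = (n : WithTop ℕ∞) + 1 := by push_cast; rfl
  rw [this, contDiff_succ_iff_deriv]
  refine ⟨fun t => (key t).differentiableAt, by simp, ?_⟩
  rw [show deriv nearI = _ from funext fun t => (key t).deriv]
  exact contDiff_const.mul (hosc n)

/-- full integral -/
def fullI (ξ : ℝ) : ℂ := ∫ t in Set.Ioi (0 : ℝ), wt 0 t *
    (Complex.exp (2 * Real.pi * Complex.I * ξ * t) - 1)

lemma fullI_scale (l ε : ℝ) (hl : 0 < l) : fullI (l * ε) = ((Real.sqrt l : ℝ) : ℂ) * fullI ε := by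
  unfold fullI
  have h := integral_comp_mul_left_Ioi (fun t : ℝ => wt 0 t *
    (Complex.exp (2 * Real.pi * Complex.I * ε * t) - 1)) 0 hl
  rw [mul_zero] at h
  have h2 : ∫ t in Set.Ioi (0 : ℝ), wt 0 t *
    (Complex.exp (2 * Real.pi * Complex.I * (l * ε : ℝ) * t) - 1) =
    ∫ t in Set.Ioi (0 : ℝ), ((l ^ (3 / 2 : ℝ) : ℝ) : ℂ) * (wt 0 (l * t) *
    (Complex.exp (2 * Real.pi * Complex.I * ε * (l * t : ℝ)) - 1)) := by
    refine setIntegral_congr_fun measurableSet_Ioi fun t ht => ?_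
    have ht0 : (0 : ℝ) < t := ht
    have h3 : wt 0 t = ((l ^ (3 / 2 : ℝ) : ℝ) : ℂ) * wt 0 (l * t) := by
      simp only [wt]
      rw [← Complex.ofReal_mul, Real.mul_rpow hl.le ht0.le, ← mul_assoc, ← Real.rpow_add hl]
      simp
    rw [h3, mul_assoc]
    congr 4
    push_cast; ring
  rw [h2, integral_const_mul, h, Complex.real_smul, ← mul_assoc, ← Complex.ofReal_mul]
  congr 2
  rw [Real.sqrt_eq_rpow, ← Real.rpow_neg_one, ← Real.rpow_add hl]; norm_num

lemma fullI_eq : ∃ a b : ℂ, ∀ ξ, fullI ξ = sg a b ξ := by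
  refine ⟨(fullI 1 + fullI (-1)) / 2, (fullI 1 - fullI (-1)) / 2, fun ξ => ?_⟩
  rcases lt_trichotomy ξ 0 with h | h | h
  · have := fullI_scale (-ξ) (-1) (by linarith)
    rw [mul_neg_one, neg_neg] at this
    rw [this, sg, Real.sign_of_neg h, abs_of_neg h]; push_cast; ring
  · subst h; rw [sg_zero]; simp [fullI]
  · have := fullI_scale ξ 1 h
    rw [mul_one] at this
    rw [this, sg, Real.sign_of_pos h, abs_of_pos h]; push_cast; ring

/-- tail integrals -/
def tailT (j : ℕ) : ℝ → ℂ := osc (volume.restrict (Set.Ioi 1)) (fun t : ℝ => t) (wt j)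

lemma tail_zero (ξ : ℝ) : tailT 0 ξ = (∫ t in Set.Ioi (1 : ℝ), wt 0 t) - nearI ξ + fullI ξ := by
  have hosc := osc_integrable _ (fun t : ℝ => t) measurable_id _ (wt_integrable 0) ξ
  have hfar : Integrable (fun t : ℝ => wt 0 t *
    (Complex.exp (2 * Real.pi * Complex.I * ξ * t) - 1)) (volume.restrict (Set.Ioi 1)) := by
    refine (hosc.sub (wt_integrable 0)).congr (Eventually.of_forall fun t => ?_)
    simp only [Pi.sub_apply]; ring
  have h1 : fullI ξ = nearI ξ + ∫ t in Set.Ioi (1 : ℝ), wt 0 t *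
    (Complex.exp (2 * Real.pi * Complex.I * ξ * t) - 1) := by
    unfold fullI nearI
    rw [← Set.Ioc_union_Ioi_eq_Ioi (zero_le_one (α := ℝ))]
    exact setIntegral_union (Set.Ioc_disjoint_Ioi le_rfl) measurableSet_Ioi (near_integrable ξ) hfar
  have h2 : tailT 0 ξ = (∫ t in Set.Ioi (1 : ℝ), wt 0 t) + ∫ t in Set.Ioi (1 : ℝ), wt 0 t *
    (Complex.exp (2 * Real.pi * Complex.I * ξ * t) - 1) := by
    rw [← integral_add (wt_integrable 0) hfar]
    unfold tailT osc
    congr 1; ext t; ring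
  rw [h2, h1]; ring

lemma tail_succ (j : ℕ) (ξ : ℝ) : tailT (j + 1) ξ =
    (1 / (3 / 2 + j)) * Complex.exp (2 * Real.pi * Complex.I * ξ) +
      (2 * Real.pi * Complex.I / (3 / 2 + j)) * ((ξ : ℂ) * tailT j ξ) := by
  set α : ℝ := 3 / 2 + j with hα
  have hj : (0 : ℝ) ≤ j := Nat.cast_nonneg j
  have hα0 : 0 < α := by positivity
  have hαC : (α : ℂ) ≠ 0 := by exact_mod_cast hα0.ne'
  have hαe : (3 / 2 + j : ℂ) = α := by rw [hα]; push_cast; ring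
  rw [hαe]
  have hi0 := osc_integrable _ (fun t : ℝ => t) measurable_id _ (wt_integrable j) ξ
  have hi1 := osc_integrable _ (fun t : ℝ => t) measurable_id _ (wt_integrable (j + 1)) ξ
  let P : ℝ → ℂ := fun t => Complex.exp (2 * Real.pi * Complex.I * ξ * t) * (-(1 / α) * wt j t)
  let P' : ℝ → ℂ := fun t => Complex.exp (2 * Real.pi * Complex.I * ξ * t) * wt (j + 1) t -
    (2 * Real.pi * Complex.I / α * ξ) * (Complex.exp (2 * Real.pi * Complex.I * ξ * t) * wt j t)
  have hP : ∀ t ∈ Set.Ici (1 : ℝ), HasDerivAt P (P' t) t := by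
    intro t ht
    have ht0 : 0 < t := lt_of_lt_of_le one_pos ht
    have h1 : HasDerivAt (fun s : ℝ => (2 * Real.pi * Complex.I * ξ * s : ℂ))
          (2 * Real.pi * Complex.I * ξ) t := by
      have h2 : HasDerivAt (fun s : ℝ => (s : ℂ)) 1 t := Complex.ofRealCLM.hasDerivAt
      have := h2.const_mul (2 * Real.pi * Complex.I * ξ : ℂ)
      simpa using this
    have h3 : HasDerivAt (wt j) (-α * wt (j + 1) t) t := by
      have := (Real.hasDerivAt_rpow_const (x := t) (p := -(3 / 2 : ℝ) - j)
        (Or.inl ht0.ne')).ofReal_comp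
      have e : (-α * wt (j + 1) t : ℂ) =
        (((-(3 / 2 : ℝ) - j) * t ^ (-(3 / 2 : ℝ) - j - 1) : ℝ) : ℂ) := by
        simp only [wt, hα]
        push_cast
        rw [show (-(3 / 2 : ℝ) - j - 1) = (-(3 / 2 : ℝ) - (j + 1)) by ring]
        ring
      rw [e]; exact this
    have h4 := h1.cexp.mul (h3.const_mul (-(1 / α : ℂ)))
    have e : P' t = Complex.exp (2 * Real.pi * Complex.I * ξ * t) * (2 * Real.pi * Complex.I * ξ) *
      (-(1 / α) * wt j t) + Complex.exp (2 * Real.pi * Complex.I * ξ * t) *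
      (-(1 / α : ℂ) * (-α * wt (j + 1) t)) := by
      simp only [P']; field_simp; ring
    rw [e]; exact h4
  have hlim : Tendsto P atTop (nhds 0) := by
    have h5 : Tendsto (fun t : ℝ => (1 / α) * t ^ (-α)) atTop (nhds 0) := by
      simpa using (tendsto_rpow_neg_atTop hα0).const_mul (1 / α)
    refine squeeze_zero_norm' ?_ h5
    filter_upwards [eventually_gt_atTop 0] with t ht
    simp only [P]
    rw [norm_mul, norm_osc_exp, one_mul, norm_mul, wt, Complex.norm_real,
      Real.norm_of_nonneg (Real.rpow_nonneg ht.le _)]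
    rw [norm_neg, norm_div, Complex.norm_real, Real.norm_of_nonneg hα0.le, norm_one, hα]
    rw [show -(3 / 2 : ℝ) - j = -(3 / 2 + j) by ring]
  have hint : IntegrableOn P' (Set.Ioi 1) := hi1.sub (hi0.const_mul _)
  have := integral_Ioi_of_hasDerivAt_of_tendsto' hP hint hlim
  have h6 : ∫ t in Set.Ioi (1 : ℝ), P' t = tailT (j + 1) ξ -
      (2 * Real.pi * Complex.I / α * ξ) * tailT j ξ := by
    simp only [P']
    rw [integral_sub hi1 (hi0.const_mul _), integral_const_mul]; rfl
  rw [h6] at this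
  simp only [P, wt, Real.one_rpow] at this
  simp only [Complex.ofReal_one, mul_one] at this
  linear_combination this

lemma tail_form (j : ℕ) : ∃ (A : ℝ → ℂ) (b c : ℂ), (∀ n : ℕ, ContDiff ℝ n A) ∧
    ∀ ξ : ℝ, tailT j ξ = A ξ + (ξ : ℂ) ^ j * sg b c ξ := by
  induction j with
  | zero =>
    obtain ⟨b, c, h⟩ := fullI_eq
    refine ⟨fun ξ => (∫ t in Set.Ioi (1 : ℝ), wt 0 t) - nearI ξ, b, c,
      fun n => contDiff_const.sub (near_contDiff n), fun ξ => ?_⟩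
    rw [tail_zero, h, pow_zero, one_mul]
  | succ j ih =>
    obtain ⟨A, b, c, hA, h⟩ := ih
    refine ⟨fun ξ => (1 / (3 / 2 + j)) * Complex.exp (2 * Real.pi * Complex.I * ξ) +
      (2 * Real.pi * Complex.I / (3 / 2 + j)) * ((ξ : ℂ) * A ξ),
      (2 * Real.pi * Complex.I / (3 / 2 + j)) * b, (2 * Real.pi * Complex.I / (3 / 2 + j)) * c,
      fun n => ?_, fun ξ => ?_⟩
    · refine (contDiff_const.mul (contDiff_const.mul Complex.ofRealCLM.contDiff).cexp).add
        (contDiff_const.mul (Complex.ofRealCLM.contDiff.mul (hA n)))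
    · rw [tail_succ, h, ← sg_smul, pow_succ]; ring

lemma sg_split (b c : ℂ) (x : ℝ) : sg b c x = b * sg 1 0 x + c * sg 0 1 x := by
  simp only [sg]; ring

lemma wt_mul (m k : ℕ) {t : ℝ} (ht : 0 < t) : wt m t * ((t⁻¹ : ℝ) : ℂ) ^ k = wt (m + k) t := by
  simp only [wt]
  rw [← Complex.ofReal_pow, ← Complex.ofReal_mul, inv_pow, ← Real.rpow_natCast t k,
    ← Real.rpow_neg ht.le, ← Real.rpow_add ht]
  congr 2
  push_cast; ring

lemma wt_measurable (m : ℕ) : Measurable (wt m) :=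
  Complex.measurable_ofReal.comp (by fun_prop)

lemma sing_form (m : ℕ) (H : ℝ → ℂ) (hH : ∀ n : ℕ, ContDiff ℝ n H) :
    ∃ C₀ C₁ C₂ : ℝ → ℂ, (∀ n : ℕ, ContDiff ℝ n C₀) ∧ (∀ n : ℕ, ContDiff ℝ n C₁) ∧
      (∀ n : ℕ, ContDiff ℝ n C₂) ∧ ∀ ξ : ℝ,
      osc (volume.restrict (Set.Ioi 1)) (fun t : ℝ => t) (fun t => wt m t * H t⁻¹) ξ =
        C₀ ξ + (ξ : ℂ) ^ m * (C₁ ξ * sg 1 0 ξ + C₂ ξ * sg 0 1 ξ) := by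
  choose A b c hA hT using tail_form
  let h : ℕ → ℂ := fun k => ((k.factorial : ℝ)⁻¹ : ℝ) • iteratedDerivWithin k H (Set.Icc 0 1) 0
  have taylor : ∀ n : ℕ, ∃ C : ℝ, ∀ s ∈ Set.Icc (0 : ℝ) 1,
      ‖H s - ∑ k ∈ Finset.range (n + 1), h k * (s : ℂ) ^ k‖ ≤ C * s ^ (n + 1) := by
    intro n
    obtain ⟨C, hC⟩ := exists_taylor_mean_remainder_bound (f := H) (a := 0) (b := 1) (n := n)
      zero_le_one (by have := (hH (n + 1)).contDiffOn (s := Set.Icc 0 1); exact_mod_cast this)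
    refine ⟨C, fun s hs => ?_⟩
    have := hC s hs
    rw [taylor_within_apply, sub_zero] at this
    have e : ∑ k ∈ Finset.range (n + 1), h k * (s : ℂ) ^ k = ∑ k ∈ Finset.range (n + 1),
        ((k.factorial : ℝ)⁻¹ * s ^ k) • iteratedDerivWithin k H (Set.Icc 0 1) 0 := by
      refine Finset.sum_congr rfl fun k _ => ?_
      simp only [h, Complex.real_smul]
      push_cast; ring
    rw [e]; simpa using this
  obtain ⟨C₁, hC1, hD1⟩ := borel_lemma (fun k => h k * b (m + k))
  obtain ⟨C₂, hC2, hD2⟩ := borel_lemma (fun k => h k * c (m + k))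
  refine ⟨fun ξ => osc (volume.restrict (Set.Ioi 1)) (fun t : ℝ => t) (fun t => wt m t * H t⁻¹) ξ -
    (ξ : ℂ) ^ m * (C₁ ξ * sg 1 0 ξ + C₂ ξ * sg 0 1 ξ), C₁, C₂, fun n => ?_, hC1, hC2,
    fun ξ => by ring⟩
  obtain ⟨D₁, hD1, hD1'⟩ := hD1 (n + 1)
  obtain ⟨D₂, hD2, hD2'⟩ := hD2 (n + 1)
  obtain ⟨C, hC⟩ := taylor n
  let r : ℝ → ℂ := fun t => wt m t *
    (H t⁻¹ - ∑ k ∈ Finset.range (n + 1), h k * ((t⁻¹ : ℝ) : ℂ) ^ k)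
  have hHm : Measurable H := (hH 0).continuous.measurable
  have hrm : Measurable r := by
    refine (wt_measurable m).mul ((hHm.comp measurable_inv).sub ?_)
    fun_prop
  have hr : ∀ j ≤ n, Integrable (fun t : ℝ => (t : ℂ) ^ j * r t) (volume.restrict (Set.Ioi 1)) := by
    intro j hj
    refine ((wt_integrable 0).norm.const_mul C).mono' (by fun_prop) ?_
    refine (ae_restrict_iff' measurableSet_Ioi).2 (Eventually.of_forall fun t ht => ?_)
    have ht1 : (1 : ℝ) < t := ht
    have ht0 : 0 < t := by linarith
    have h1 := hC t⁻¹ ⟨by positivity, inv_le_one_of_one_le₀ ht1.le⟩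
    have hCn : 0 ≤ C := by
      have := (norm_nonneg _).trans h1
      exact nonneg_of_mul_nonneg_left this (by positivity)
    rw [norm_mul, norm_mul, norm_pow, Complex.norm_real, Real.norm_of_nonneg ht0.le]
    have h2 : ‖wt m t‖ = ‖wt 0 t‖ * t⁻¹ ^ m := by
      have := wt_mul 0 m ht0
      rw [zero_add] at this
      rw [← this, norm_mul, norm_pow, Complex.norm_real, Real.norm_of_nonneg (by positivity)]
    rw [h2]
    calc t ^ j * (‖wt 0 t‖ * t⁻¹ ^ m * ‖H t⁻¹ - ∑ k ∈ Finset.range (n + 1),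
            h k * ((t⁻¹ : ℝ) : ℂ) ^ k‖)
        ≤ t ^ j * (‖wt 0 t‖ * 1 * (C * t⁻¹ ^ (n + 1))) := by
          gcongr
          exact pow_le_one₀ (by positivity) (inv_le_one_of_one_le₀ ht1.le)
      _ = C * ‖wt 0 t‖ * (t ^ j * t⁻¹ ^ (n + 1)) := by ring
      _ ≤ C * ‖wt 0 t‖ * 1 := by
          gcongr
          rw [inv_pow, ← div_eq_mul_inv, div_le_one (by positivity)]
          exact pow_le_pow_right₀ ht1.le (by omega)
      _ = _ := by ring
  have hrem : ContDiff ℝ n (osc (volume.restrict (Set.Ioi 1)) (fun t : ℝ => t) r) :=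
    osc_contDiff _ _ measurable_id n r hr
  have hosc : ∀ ξ, osc (volume.restrict (Set.Ioi 1)) (fun t : ℝ => t) (fun t => wt m t * H t⁻¹) ξ =
      (∑ k ∈ Finset.range (n + 1), h k * tailT (m + k) ξ) +
      osc (volume.restrict (Set.Ioi 1)) (fun t : ℝ => t) r ξ := by
    intro ξ
    have hr0 := hr 0 (Nat.zero_le _)
    simp only [pow_zero, one_mul] at hr0
    have i1 := osc_integrable _ (fun t : ℝ => t) measurable_id _ hr0 ξ
    have i2 : ∀ k, Integrable (fun t : ℝ => h k * (Complex.exp (2 * Real.pi * Complex.I * ξ * t) *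
      wt (m + k) t)) (volume.restrict (Set.Ioi 1)) := fun k =>
      (osc_integrable _ (fun t : ℝ => t) measurable_id _ (wt_integrable (m + k)) ξ).const_mul _
    simp only [tailT, osc, ← integral_const_mul]
    rw [← integral_finsetSum _ fun k _ => i2 k, ← integral_add (integrable_finsetSum _
      fun k _ => i2 k) i1]
    refine setIntegral_congr_fun measurableSet_Ioi fun t ht => ?_
    have ht0 : (0 : ℝ) < t := zero_lt_one.trans ht
    simp only [r, ← wt_mul m _ ht0]
    rw [mul_sub, mul_sub, Finset.mul_sum, Finset.mul_sum]
    have : ∀ k ∈ Finset.range (n + 1), h k * (Complex.exp (2 * Real.pi * Complex.I * ξ * t) *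
        (wt m t * ((t⁻¹ : ℝ) : ℂ) ^ k)) = Complex.exp (2 * Real.pi * Complex.I * ξ * t) *
        (wt m t * (h k * ((t⁻¹ : ℝ) : ℂ) ^ k)) := fun k _ => by ring
    rw [Finset.sum_congr rfl this]
    ring
  have hfin : (fun ξ : ℝ => osc (volume.restrict (Set.Ioi 1)) (fun t : ℝ => t)
      (fun t => wt m t * H t⁻¹) ξ - (ξ : ℂ) ^ m * (C₁ ξ * sg 1 0 ξ + C₂ ξ * sg 0 1 ξ)) =
      fun ξ : ℝ => (∑ k ∈ Finset.range (n + 1), h k * A (m + k) ξ) +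
        osc (volume.restrict (Set.Ioi 1)) (fun t : ℝ => t) r ξ -
        (ξ : ℂ) ^ m * (D₁ ξ * ((ξ : ℂ) ^ (n + 1) * sg 1 0 ξ) +
          D₂ ξ * ((ξ : ℂ) ^ (n + 1) * sg 0 1 ξ)) := by
    ext ξ
    rw [hosc, hD1', hD2']
    have : ∀ k ∈ Finset.range (n + 1), h k * tailT (m + k) ξ = h k * A (m + k) ξ +
        ((ξ : ℂ) ^ m * sg 1 0 ξ * (h k * b (m + k) * (ξ : ℂ) ^ k) +
         (ξ : ℂ) ^ m * sg 0 1 ξ * (h k * c (m + k) * (ξ : ℂ) ^ k)) := fun k _ => by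
      rw [hT, sg_split, pow_add]; ring
    rw [Finset.sum_congr rfl this, Finset.sum_add_distrib, Finset.sum_add_distrib,
      ← Finset.mul_sum, ← Finset.mul_sum]
    ring
  rw [hfin]
  have hsg : ∀ a b : ℂ, ContDiff ℝ n (fun x : ℝ => (x : ℂ) ^ (n + 1) * sg a b x) := fun a b =>
    (sg_contDiff a b (n + 1)).of_le (by exact_mod_cast Nat.le_succ n)
  refine ((ContDiff.sum fun k _ => contDiff_const.mul (hA _ n)).add hrem).sub
    ((Complex.ofRealCLM.contDiff.pow m).mul (((hD1 n).mul (hsg _ _)).add ((hD2 n).mul (hsg _ _))))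


open FourierTransform in
lemma gauss_ft {ι : Type*} [Fintype ι] (b : ι → ℂ) (hb : ∀ i, 0 < (b i).re)
    (y : EuclideanSpace ℝ ι) :
    𝓕 (fun x : EuclideanSpace ℝ ι => Complex.exp (-∑ i, b i * (x i : ℂ) ^ 2)) y
      = (∏ i, ((Real.pi : ℂ) / b i) ^ (1 / 2 : ℂ)) *
        Complex.exp (-∑ i, ((Real.pi : ℂ) ^ 2 / b i) * (y i : ℂ) ^ 2) := by
  rw [Real.fourier_eq']
  rw [← (PiLp.volume_preserving_toLp ι).integral_comp
    (MeasurableEquiv.toLp 2 _).measurableEmbedding]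
  have := GaussianFourier.integral_cexp_neg_sum_mul_add hb
    (fun i => -2 * (Real.pi : ℂ) * Complex.I * (y i : ℂ))
  rw [← Finset.sum_neg_distrib, Complex.exp_sum, ← Finset.prod_mul_distrib]
  have h2 : ∀ i, Complex.exp (-((Real.pi : ℂ) ^ 2 / b i * (y i : ℂ) ^ 2)) =
      Complex.exp ((-2 * (Real.pi : ℂ) * Complex.I * (y i : ℂ)) ^ 2 / (4 * b i)) := by
    intro i
    have hbi : b i ≠ 0 := by
      intro h; have := hb i; simp [h] at this
    congr 1
    have hI := Complex.I_sq
    field_simp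
    linear_combination (-4 * (y i : ℂ) ^ 2) * hI
  simp_rw [h2]
  rw [← this]
  congr 1
  ext v
  rw [smul_eq_mul, ← Complex.exp_add]
  congr 1
  rw [add_comm]
  congr 1
  simp only [PiLp.inner_apply, RCLike.inner_apply, conj_trivial]
  push_cast
  rw [Finset.mul_sum, Finset.sum_mul]
  refine Finset.sum_congr rfl fun i _ => ?_
  ring

lemma gauss_int {ι : Type*} [Fintype ι] (b : ι → ℂ) (hb : ∀ i, 0 < (b i).re) :
    Integrable (fun x : EuclideanSpace ℝ ι => Complex.exp (-∑ i, b i * (x i : ℂ) ^ 2)) := by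
  have := GaussianFourier.integrable_cexp_neg_sum_mul_add hb (fun i => (0 : ℂ))
  rw [← (PiLp.volume_preserving_toLp ι).integrable_comp_emb
    (MeasurableEquiv.toLp 2 _).measurableEmbedding]
  refine this.congr (ae_of_all _ fun v => ?_)
  simp

open FourierTransform SchwartzMap in
lemma gauss_pair {ι : Type*} [Fintype ι] (b : ι → ℂ) (hb : ∀ i, 0 < (b i).re)
    (Φ : 𝓢(EuclideanSpace ℝ ι, ℂ)) :
    ∫ x : EuclideanSpace ℝ ι, Complex.exp (-∑ i, b i * (x i : ℂ) ^ 2) * Φ x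
      = (∏ i, ((Real.pi : ℂ) / b i) ^ (1 / 2 : ℂ)) *
        ∫ y : EuclideanSpace ℝ ι,
          Complex.exp (-∑ i, ((Real.pi : ℂ) ^ 2 / b i) * (y i : ℂ) ^ 2) * (𝓕⁻ Φ) y := by
  have h := VectorFourier.integral_bilin_fourierIntegral_eq_flip (.mul ℂ ℂ)
    (L := innerₗ (EuclideanSpace ℝ ι)) (μ := volume) (ν := volume)
    Real.continuous_fourierChar continuous_inner (gauss_int b hb) (𝓕⁻ Φ).integrable
  have h' : ∫ y : EuclideanSpace ℝ ι,
      𝓕 (fun x : EuclideanSpace ℝ ι => Complex.exp (-∑ i, b i * (x i : ℂ) ^ 2)) y * (𝓕⁻ Φ) y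
      = ∫ x : EuclideanSpace ℝ ι, Complex.exp (-∑ i, b i * (x i : ℂ) ^ 2) *
        𝓕 (𝓕⁻ Φ) x := by
    simp only [flip_innerₗ] at h
    exact h
  have h3 : 𝓕 (𝓕⁻ Φ) = Φ := FourierTransform.fourier_fourierInv_eq Φ
  rw [h3] at h'
  rw [← h', ← integral_const_mul]
  congr 1
  ext y
  rw [gauss_ft b hb]
  ring

/-- diagonal quadratic form -/
def qq {ι : Type*} [Fintype ι] (ε : ι → ℝ) (x : EuclideanSpace ℝ ι) : ℝ :=
  ∑ i, ε i * x i ^ 2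

lemma gauss_lim {ι : Type*} [Fintype ι] (β : ℝ → ι → ℂ) (β0 : ι → ℂ)
    (h : ∀ i, Tendsto (fun δ => β δ i) (nhdsWithin 0 (Set.Ioi 0)) (nhds (β0 i)))
    (hre : ∀ δ : ℝ, 0 < δ → ∀ i, 0 ≤ (β δ i).re)
    (Φ : SchwartzMap (EuclideanSpace ℝ ι) ℂ) :
    Tendsto (fun δ => ∫ x : EuclideanSpace ℝ ι,
        Complex.exp (-∑ i, β δ i * (x i : ℂ) ^ 2) * Φ x) (nhdsWithin 0 (Set.Ioi 0))
      (nhds (∫ x : EuclideanSpace ℝ ι,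
        Complex.exp (-∑ i, β0 i * (x i : ℂ) ^ 2) * Φ x)) := by
  refine tendsto_integral_filter_of_dominated_convergence (fun x => ‖Φ x‖) ?_ ?_ ?_ ?_
  · refine Eventually.of_forall fun δ => ?_
    refine Continuous.aestronglyMeasurable ?_
    have := Φ.continuous
    fun_prop
  · filter_upwards [self_mem_nhdsWithin] with δ hδ
    refine ae_of_all _ fun x => ?_
    rw [norm_mul, Complex.norm_exp]
    refine mul_le_of_le_one_left (norm_nonneg _) ?_
    rw [Real.exp_le_one_iff, Complex.neg_re, neg_nonpos, Complex.re_sum]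
    refine Finset.sum_nonneg fun i _ => ?_
    rw [← Complex.ofReal_pow, Complex.re_mul_ofReal]
    exact mul_nonneg (hre δ hδ i) (sq_nonneg _)
  · exact Φ.integrable.norm
  · refine ae_of_all _ fun x => ?_
    refine Tendsto.mul ?_ tendsto_const_nhds
    refine (Complex.continuous_exp.tendsto _).comp (Tendsto.neg ?_)
    exact tendsto_finsetSum _ fun i _ => (h i).mul tendsto_const_nhds

open FourierTransform SchwartzMap in
lemma fresnel {ι : Type*} [Fintype ι] (ε : ι → ℝ) (hε : ∀ i, ε i ^ 2 = 1)
    (Φ : 𝓢(EuclideanSpace ℝ ι, ℂ)) (τ : ℝ) (hτ : τ ≠ 0) :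
    osc volume (qq ε) Φ τ =
      (∏ i, ((Real.pi : ℂ) / (-2 * Real.pi * Complex.I * τ * ε i)) ^ (1 / 2 : ℂ)) *
        osc volume (qq ε) (fun y => (𝓕⁻ Φ) y) (-(τ⁻¹ / 4)) := by
  have hε0 : ∀ i, ε i ≠ 0 := fun i h => by have := hε i; simp [h] at this
  have hπ : (Real.pi : ℂ) ≠ 0 := by exact_mod_cast Real.pi_ne_zero
  set b : ℝ → ι → ℂ := fun δ i => δ + -2 * Real.pi * Complex.I * τ * ε i with hb
  set b0 : ι → ℂ := fun i => -2 * Real.pi * Complex.I * τ * ε i with hb0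
  have hb0ne : ∀ i, b0 i ≠ 0 := by
    intro i
    simp [hb0, hπ, hτ, hε0 i]
  have hbre : ∀ δ i, (b δ i).re = δ := by
    intro δ i
    simp [hb]
  have hbt : ∀ i, Tendsto (fun δ => b δ i) (nhdsWithin 0 (Set.Ioi 0)) (nhds (b0 i)) := by
    intro i
    have : Continuous (fun δ => b δ i) := by simp only [hb]; fun_prop
    have h := this.tendsto 0
    have h2 : b 0 i = b0 i := by simp [hb, hb0]
    rw [h2] at h
    exact h.mono_left nhdsWithin_le_nhds
  have L1 := gauss_lim b b0 hbt (fun δ hδ i => by rw [hbre]; exact hδ.le) Φ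
  have L2 := gauss_lim (fun δ i => (Real.pi : ℂ) ^ 2 / b δ i) (fun i => (Real.pi : ℂ) ^ 2 / b0 i)
    (fun i => tendsto_const_nhds.div (hbt i) (hb0ne i))
    (fun δ hδ i => by
      rw [← Complex.ofReal_pow, div_eq_mul_inv, Complex.re_ofReal_mul, Complex.inv_re, hbre]
      exact mul_nonneg (sq_nonneg _) (div_nonneg hδ.le (Complex.normSq_nonneg _))) (𝓕⁻ Φ)
  have L3 : Tendsto (fun δ => ∏ i, ((Real.pi : ℂ) / b δ i) ^ (1 / 2 : ℂ))
      (nhdsWithin 0 (Set.Ioi 0)) (nhds (∏ i, ((Real.pi : ℂ) / b0 i) ^ (1 / 2 : ℂ))) := by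
    refine tendsto_finsetProd _ fun i _ => ?_
    refine Tendsto.comp (ContinuousAt.tendsto (continuousAt_cpow_const ?_))
      (tendsto_const_nhds.div (hbt i) (hb0ne i))
    right
    have hne : (Real.pi : ℂ) / b0 i ≠ 0 := div_ne_zero hπ (hb0ne i)
    have hre : ((Real.pi : ℂ) / b0 i).re = 0 := by
      rw [div_eq_mul_inv, Complex.re_ofReal_mul, Complex.inv_re]
      simp [hb0]
    intro him
    exact hne (Complex.ext hre him)
  have L4 := L3.mul L2
  have L5 := L4.congr' (f₂ := fun δ => ∫ x : EuclideanSpace ℝ ι,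
      Complex.exp (-∑ i, b δ i * (x i : ℂ) ^ 2) * Φ x) (by
    filter_upwards [self_mem_nhdsWithin] with δ hδ
    rw [gauss_pair (b δ) (fun i => by rw [hbre]; exact hδ) Φ])
  have := tendsto_nhds_unique L1 L5
  have e1 : osc volume (qq ε) Φ τ = ∫ x : EuclideanSpace ℝ ι,
        Complex.exp (-∑ i, b0 i * (x i : ℂ) ^ 2) * Φ x := by
    unfold osc
    congr 1
    ext x
    congr 2
    simp only [qq, hb0]
    push_cast
    rw [Finset.mul_sum, ← Finset.sum_neg_distrib]
    exact Finset.sum_congr rfl fun i _ => by ring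
  have e2 : osc volume (qq ε) (fun y => (𝓕⁻ Φ) y) (-(τ⁻¹ / 4)) = ∫ x : EuclideanSpace ℝ ι,
        Complex.exp (-∑ i, ((Real.pi : ℂ) ^ 2 / b0 i) * (x i : ℂ) ^ 2) * (𝓕⁻ Φ) x := by
    unfold osc
    congr 1
    ext x
    congr 2
    simp only [qq, hb0]
    push_cast
    rw [Finset.mul_sum, ← Finset.sum_neg_distrib]
    refine Finset.sum_congr rfl fun i _ => ?_
    have h1 : (ε i : ℂ) ^ 2 = 1 := by exact_mod_cast hε i
    have h2 : (ε i : ℂ) ≠ 0 := by exact_mod_cast hε0 i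
    have h3 : (τ : ℂ) ≠ 0 := by exact_mod_cast hτ
    have hI := Complex.I_sq
    field_simp
    linear_combination (-4 * Complex.I ^ 2 * (x i : ℂ) ^ 2) * h1 - 4 * (x i : ℂ) ^ 2 * hI
  rw [e1, e2, this]

lemma qq_continuous {ι : Type*} [Fintype ι] (ε : ι → ℝ) : Continuous (qq ε) := by
  unfold qq; fun_prop

lemma qq_abs_le {ι : Type*} [Fintype ι] (ε : ι → ℝ) (hε : ∀ i, ε i ^ 2 = 1)
    (x : EuclideanSpace ℝ ι) : |qq ε x| ≤ ‖x‖ ^ 2 := by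
  rw [EuclideanSpace.norm_sq_eq, qq]
  refine (Finset.abs_sum_le_sum_abs _ _).trans (Finset.sum_le_sum fun i _ => ?_)
  have : |ε i| = 1 := by
    have := hε i
    rw [← sq_abs] at this
    exact (pow_eq_one_iff_of_nonneg (abs_nonneg _) two_ne_zero).1 this
  rw [abs_mul, this, one_mul, abs_pow, Real.norm_eq_abs]

lemma qq_pow_integrable {ι : Type*} [Fintype ι] (ε : ι → ℝ) (hε : ∀ i, ε i ^ 2 = 1)
    (Φ : SchwartzMap (EuclideanSpace ℝ ι) ℂ) (j : ℕ) :
    Integrable (fun x => (qq ε x : ℂ) ^ j * Φ x) volume := by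
  refine (Φ.integrable_pow_mul volume (2 * j)).mono' ?_ (ae_of_all _ fun x => ?_)
  · have := Φ.continuous
    have := qq_continuous ε
    exact Continuous.aestronglyMeasurable (by fun_prop)
  · rw [norm_mul, norm_pow, Complex.norm_real, Real.norm_eq_abs, pow_mul]
    gcongr
    exact qq_abs_le ε hε x

open FourierTransform SchwartzMap in
lemma fresnel_form {ι : Type*} [Fintype ι] (ε : ι → ℝ) (hε : ∀ i, ε i ^ 2 = 1)
    (Φ : 𝓢(EuclideanSpace ℝ ι, ℂ)) (σ : ℝ) (hσ : σ ≠ 0) :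
    ∃ H : ℝ → ℂ, (∀ n : ℕ, ContDiff ℝ n H) ∧ ∀ t : ℝ, 0 < t →
      osc volume (qq ε) Φ (σ * t) = ((t ^ (-((Fintype.card ι : ℝ) / 2)) : ℝ) : ℂ) * H t⁻¹ := by
  refine ⟨fun s => (∏ i, ((Real.pi : ℂ) / (-2 * Real.pi * Complex.I * σ * ε i)) ^ (1 / 2 : ℂ)) *
        osc volume (qq ε) (fun y => (𝓕⁻ Φ) y) (-((σ⁻¹ * s) / 4)), ?_, ?_⟩
  · intro n
    refine contDiff_const.mul ?_
    refine (osc_contDiff volume (qq ε) ?_ n _ fun j _ => qq_pow_integrable ε hε _ j).comp ?_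
    · exact (qq_continuous ε).measurable
    · fun_prop
  · intro t ht
    rw [fresnel ε hε Φ (σ * t) (mul_ne_zero hσ ht.ne')]
    rw [mul_inv, ← mul_assoc]
    congr 1
    have : ∀ i, ((Real.pi : ℂ) / (-2 * Real.pi * Complex.I * (σ * t : ℝ) * ε i)) ^ (1 / 2 : ℂ)
        = ((t ^ (-(1/2 : ℝ)) : ℝ) : ℂ) *
          ((Real.pi : ℂ) / (-2 * Real.pi * Complex.I * σ * ε i)) ^ (1 / 2 : ℂ) := by
      intro i
      have e : (Real.pi : ℂ) / (-2 * Real.pi * Complex.I * (σ * t : ℝ) * ε i)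
          = ((t⁻¹ : ℝ) : ℂ) * ((Real.pi : ℂ) / (-2 * Real.pi * Complex.I * σ * ε i)) := by
        push_cast
        simp only [div_eq_mul_inv, mul_inv]
        ring
      have hε0 : ε i ≠ 0 := fun h => by have := hε i; simp [h] at this
      have hz : (Real.pi : ℂ) / (-2 * Real.pi * Complex.I * σ * ε i) ≠ 0 := by
        simp [Real.pi_ne_zero, hσ, hε0]
      have hti : (0:ℝ) < t⁻¹ := inv_pos.2 ht
      rw [e, Complex.cpow_def_of_ne_zero (mul_ne_zero (by exact_mod_cast hti.ne') hz),
        Complex.cpow_def_of_ne_zero hz, Complex.log_ofReal_mul hti hz, Real.rpow_def_of_pos ht,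
        Complex.ofReal_exp, ← Complex.exp_add]
      congr 1
      rw [Real.log_inv]
      push_cast
      ring
    simp_rw [this]
    rw [Finset.prod_mul_distrib, Finset.prod_const]
    congr 1
    rw [← Complex.ofReal_pow, ← Real.rpow_natCast, ← Real.rpow_mul ht.le]
    congr 2
    rw [Finset.card_univ]
    ring

lemma wt_norm (j : ℕ) {t : ℝ} (ht : 0 < t) : ‖wt j t‖ = t ^ (-(3/2:ℝ) - j) := by
  unfold wt
  rw [Complex.norm_real, Real.norm_of_nonneg (Real.rpow_nonneg ht.le _)]

lemma wt_mul_pow (m j : ℕ) (hj : j ≤ m) {t : ℝ} (ht : 0 < t) :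
    (t : ℂ) ^ j * wt m t = wt (m - j) t := by
  have h := wt_mul (m - j) j ht
  rw [Nat.sub_add_cancel hj] at h
  rw [← h, mul_comm, mul_assoc, ← mul_pow]
  have : ((t⁻¹ : ℝ) : ℂ) * (t : ℂ) = 1 := by
    rw [← Complex.ofReal_mul, inv_mul_cancel₀ ht.ne', Complex.ofReal_one]
  rw [this, one_pow, mul_one]

lemma form_bound (M j : ℕ) (hj : j ≤ M) (G H : ℝ → ℂ) (hH : Continuous H)
    (hG : ∀ t : ℝ, 0 < t → G t = wt M t * H t⁻¹) :
    ∃ C : ℝ, 0 ≤ C ∧ ∀ t : ℝ, 1 ≤ t → ‖(t : ℂ) ^ j * G t‖ ≤ C * (1 + ‖t‖) ^ (-(3/2 : ℝ)) := by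
  obtain ⟨C, hC⟩ := (isCompact_Icc (a := (0:ℝ)) (b := 1)).exists_bound_of_continuousOn
    hH.continuousOn
  have hC0 : 0 ≤ C := (norm_nonneg _).trans (hC 0 (by simp))
  refine ⟨C * 2 ^ (3/2 : ℝ), by positivity, fun t ht => ?_⟩
  have ht0 : 0 < t := by linarith
  rw [hG t ht0, ← mul_assoc, wt_mul_pow M j hj ht0, norm_mul, wt_norm _ ht0]
  have h1 : ‖H t⁻¹‖ ≤ C := hC _ ⟨by positivity, inv_le_one_of_one_le₀ ht⟩
  have h2 : t ^ (-(3/2:ℝ) - (M - j : ℕ)) ≤ t ^ (-(3/2:ℝ)) := by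
    apply Real.rpow_le_rpow_of_exponent_le ht
    have : (0:ℝ) ≤ (M - j : ℕ) := Nat.cast_nonneg _
    linarith
  have h3 : t ^ (-(3/2:ℝ)) ≤ 2 ^ (3/2 : ℝ) * (1 + ‖t‖) ^ (-(3/2 : ℝ)) := by
    rw [Real.norm_of_nonneg ht0.le]
    have : (2 : ℝ) ^ (3/2 : ℝ) = (1/2 : ℝ) ^ (-(3/2:ℝ)) := by
      rw [Real.rpow_neg (by norm_num), ← Real.inv_rpow (by norm_num)]; norm_num
    rw [this, ← Real.mul_rpow (by norm_num) (by linarith)]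
    apply Real.rpow_le_rpow_of_nonpos (by linarith) (by linarith) (by norm_num)
  calc _ ≤ (2 ^ (3/2 : ℝ) * (1 + ‖t‖) ^ (-(3/2 : ℝ))) * C :=
        mul_le_mul (h2.trans h3) h1 (norm_nonneg _) (by positivity)
    _ = _ := by ring

lemma form_integrable (M j : ℕ) (hj : j ≤ M) (G Hp Hm : ℝ → ℂ) (hGc : Continuous G)
    (hHp : Continuous Hp) (hHm : Continuous Hm)
    (hp : ∀ t : ℝ, 0 < t → G t = wt M t * Hp t⁻¹)
    (hm : ∀ t : ℝ, 0 < t → G (-t) = wt M t * Hm t⁻¹) :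
    Integrable (fun t : ℝ => (t : ℂ) ^ j * G t) := by
  obtain ⟨C1, h10, h1⟩ := form_bound M j hj G Hp hHp hp
  obtain ⟨C2, h20, h2⟩ := form_bound M j hj (fun t => G (-t)) Hm hHm hm
  have hc : Continuous (fun t : ℝ => (t : ℂ) ^ j * G t) := by fun_prop
  obtain ⟨C, hC⟩ := (isCompact_Icc (a := (-1:ℝ)) (b := 1)).exists_bound_of_continuousOn
    hc.continuousOn
  have hC0 : 0 ≤ C := (norm_nonneg _).trans (hC 0 (by simp))
  have hI : Integrable (fun t : ℝ => (1 + ‖t‖) ^ (-(3/2 : ℝ))) volume :=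
    integrable_one_add_norm (by simp; norm_num)
  refine (hI.const_mul (C1 + C2 + C * 2 ^ (3/2 : ℝ))).mono' hc.aestronglyMeasurable
    (ae_of_all _ fun t => ?_)
  have hP : 0 ≤ (1 + ‖t‖) ^ (-(3/2 : ℝ)) := by positivity
  have hQ : 0 ≤ C * 2 ^ (3/2 : ℝ) * (1 + ‖t‖) ^ (-(3/2 : ℝ)) := by positivity
  have hP1 := mul_nonneg h10 hP
  have hP2 := mul_nonneg h20 hP
  rw [add_mul, add_mul]
  rcases le_or_gt 1 t with h | h
  · have := h1 t h
    linarith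
  · rcases le_or_gt t (-1) with h' | h'
    · have := h2 (-t) (by linarith)
      simp only [neg_neg, norm_neg] at this
      have e : ‖((-t : ℝ) : ℂ) ^ j * G t‖ = ‖(t : ℂ) ^ j * G t‖ := by
        rw [norm_mul, norm_mul, norm_pow, norm_pow]; simp
      rw [e] at this
      linarith
    · have := hC t ⟨h'.le, h.le⟩
      have h3 : 1 ≤ 2 ^ (3/2 : ℝ) * (1 + ‖t‖) ^ (-(3/2 : ℝ)) := by
        rw [Real.rpow_neg (by positivity), ← div_eq_mul_inv, one_le_div (by positivity)]
        apply Real.rpow_le_rpow (by positivity) _ (by norm_num)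
        have : ‖t‖ ≤ 1 := by rw [Real.norm_eq_abs, abs_le]; constructor <;> linarith
        linarith
      have := mul_le_mul_of_nonneg_left h3 hC0
      rw [← mul_assoc] at this
      linarith

lemma sg10_neg (x : ℝ) : sg 1 0 (-x) = sg 1 0 x := by simp [sg]
lemma sg01_neg (x : ℝ) : sg 0 1 (-x) = - sg 0 1 x := by simp [sg, Real.sign_neg]

lemma germ_form (m : ℕ) (F Hp Hm : ℝ → ℂ) (hF : Continuous F)
    (hHp : ∀ n : ℕ, ContDiff ℝ n Hp) (hHm : ∀ n : ℕ, ContDiff ℝ n Hm)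
    (hp : ∀ t : ℝ, 0 < t → F t = wt m t * Hp t⁻¹)
    (hm : ∀ t : ℝ, 0 < t → F (-t) = wt m t * Hm t⁻¹) :
    ∃ C₀ C₁ C₂ : ℝ → ℂ,
      (∀ n : ℕ, ContDiff ℝ n C₀) ∧ (∀ n : ℕ, ContDiff ℝ n C₁) ∧ (∀ n : ℕ, ContDiff ℝ n C₂) ∧
      ∀ ξ : ℝ, osc volume (fun t : ℝ => -t) F ξ =
        C₀ ξ + (ξ : ℂ) ^ m * (C₁ ξ * sg 1 0 ξ + C₂ ξ * sg 0 1 ξ) := by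
  obtain ⟨A0, A1, A2, hA0, hA1, hA2, hA⟩ := sing_form m Hp hHp
  obtain ⟨B0, B1, B2, hB0, hB1, hB2, hB⟩ := sing_form m Hm hHm
  have hint : Integrable F := by
    simpa using form_integrable m 0 (Nat.zero_le _) F Hp Hm hF (hHp 0).continuous
      (hHm 0).continuous hp hm
  set mid := osc (volume.restrict (Set.Ioc (-1) 1)) (fun t : ℝ => -t) F with hmid
  have hmidC : ∀ n : ℕ, ContDiff ℝ n mid := by
    intro n
    refine osc_contDiff _ _ (by fun_prop) n F fun j _ => ?_
    have hc : Continuous (fun x : ℝ => (((-x : ℝ)) : ℂ) ^ j * F x) := by fun_prop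
    exact (hc.continuousOn.integrableOn_Icc (a := -1) (b := 1)).mono_set Set.Ioc_subset_Icc_self
  refine ⟨fun ξ => mid ξ + A0 (-ξ) + B0 ξ, fun ξ => (-1) ^ m * A1 (-ξ) + B1 ξ,
    fun ξ => -(-1) ^ m * A2 (-ξ) + B2 ξ, ?_, ?_, ?_, ?_⟩
  · intro n
    exact ((hmidC n).add ((hA0 n).comp contDiff_neg)).add (hB0 n)
  · intro n
    exact (contDiff_const.mul ((hA1 n).comp contDiff_neg)).add (hB1 n)
  · intro n
    exact (contDiff_const.mul ((hA2 n).comp contDiff_neg)).add (hB2 n)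
  · intro ξ
    have hE := osc_integrable volume (fun t : ℝ => -t) (by fun_prop) F hint ξ
    have s1 : osc volume (fun t : ℝ => -t) F ξ =
        (∫ t in Set.Iic (-1), Complex.exp (2 * Real.pi * Complex.I * ξ * ((-t : ℝ) : ℂ)) * F t) +
        mid ξ +
        (∫ t in Set.Ioi 1, Complex.exp (2 * Real.pi * Complex.I * ξ * ((-t : ℝ) : ℂ)) * F t) := by
      rw [hmid]
      unfold osc
      have d1 : Disjoint (Set.Iic (-1:ℝ)) (Set.Ioc (-1) 1) :=
        Set.disjoint_left.2 fun x h1 h2 => absurd h2.1 (not_lt.2 h1)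
      have d2 : Disjoint (Set.Iic (1:ℝ)) (Set.Ioi 1) :=
        Set.disjoint_left.2 fun x h1 h2 => not_le_of_gt (Set.mem_Ioi.1 h2) h1
      have e1 := setIntegral_union d1 measurableSet_Ioc hE.integrableOn hE.integrableOn
      have e2 := setIntegral_union d2 measurableSet_Ioi hE.integrableOn hE.integrableOn
      rw [Set.Iic_union_Ioc_eq_Iic (by norm_num)] at e1
      rw [Set.Iic_union_Ioi, Measure.restrict_univ, e1] at e2
      exact e2
    have s2 : (∫ t in Set.Ioi 1, Complex.exp (2 * Real.pi * Complex.I * ξ * ((-t : ℝ) : ℂ)) * F t)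
        = osc (volume.restrict (Set.Ioi 1)) (fun t : ℝ => t) (fun t => wt m t * Hp t⁻¹) (-ξ) := by
      unfold osc
      refine setIntegral_congr_fun measurableSet_Ioi fun t ht => ?_
      have ht0 : (0:ℝ) < t := lt_trans one_pos ht
      simp only [hp t ht0]
      congr 2
      push_cast
      ring
    have s3 : (∫ t in Set.Iic (-1), Complex.exp (2 * Real.pi * Complex.I * ξ * ((-t : ℝ) : ℂ)) * F t)
        = osc (volume.restrict (Set.Ioi 1)) (fun t : ℝ => t) (fun t => wt m t * Hm t⁻¹) ξ := by
      rw [← integral_comp_neg_Ioi]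
      unfold osc
      refine setIntegral_congr_fun measurableSet_Ioi fun t ht => ?_
      have ht0 : (0:ℝ) < t := lt_trans one_pos ht
      simp only [hm t ht0, neg_neg]
    rw [s1, s2, s3, hA, hB, sg10_neg, sg01_neg]
    push_cast
    rw [neg_pow (ξ : ℂ) m]
    ring

lemma iter_form (m : ℕ) (F H : ℝ → ℂ) (hH : ∀ n : ℕ, ContDiff ℝ n H)
    (hF : ∀ t : ℝ, 0 < t → F t = wt m t * H t⁻¹) (N : ℕ) :
    ∃ K : ℝ → ℂ, (∀ n : ℕ, ContDiff ℝ n K) ∧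
      ∀ t : ℝ, 0 < t → iteratedDeriv N F t = wt (m + N) t * K t⁻¹ := by
  induction N with
  | zero => exact ⟨H, hH, fun t ht => by simpa using hF t ht⟩
  | succ N ih =>
    obtain ⟨K, hK, hKt⟩ := ih
    refine ⟨fun s => (-(3/2 : ℝ) - ((m + N : ℕ) : ℝ) : ℝ) * K s - (s : ℂ) * deriv K s, ?_, ?_⟩
    · intro n
      have h1 : ContDiff ℝ n (deriv K) := by
        have := hK (n + 1)
        exact ContDiff.deriv' (by exact_mod_cast this)
      have h2 : ContDiff ℝ n (fun s : ℝ => (s : ℂ)) := Complex.ofRealCLM.contDiff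
      exact (contDiff_const.mul (hK n)).sub (h2.mul h1)
    · intro t ht
      rw [iteratedDeriv_succ]
      have hev : iteratedDeriv N F =ᶠ[nhds t] fun t => wt (m + N) t * K t⁻¹ := by
        filter_upwards [lt_mem_nhds ht] with s hs
        exact hKt s hs
      rw [hev.deriv_eq]
      have hw : HasDerivAt (wt (m + N))
          (((-(3/2 : ℝ) - ((m + N : ℕ) : ℝ)) * t ^ (-(3/2 : ℝ) - ((m + N : ℕ) : ℝ) - 1) : ℝ) : ℂ) t := by
        unfold wt
        exact (Real.hasDerivAt_rpow_const (Or.inl ht.ne')).ofReal_comp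
      have hKd : HasDerivAt K (deriv K t⁻¹) t⁻¹ :=
        ((hK 1).differentiable (by norm_num)).differentiableAt.hasDerivAt
      have hi : HasDerivAt (fun t : ℝ => K t⁻¹) ((-(t ^ 2)⁻¹ : ℝ) • deriv K t⁻¹) t :=
        hKd.scomp t (hasDerivAt_inv ht.ne')
      rw [(hw.fun_mul hi).deriv]
      have e1 : wt (m + (N + 1)) t = wt (m + N) t * ((t⁻¹ : ℝ) : ℂ) := by
        have := wt_mul (m + N) 1 ht
        rw [pow_one] at this
        rw [this]; rfl
      have e2 : ((t ^ (-(3/2 : ℝ) - ((m + N : ℕ) : ℝ) - 1) : ℝ) : ℂ) =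
          wt (m + N) t * ((t⁻¹ : ℝ) : ℂ) := by
        rw [Real.rpow_sub_one ht.ne', div_eq_mul_inv]
        unfold wt
        push_cast
        rfl
      rw [Complex.ofReal_mul, e2, e1, Complex.real_smul]
      push_cast
      rw [← inv_pow]
      ring

lemma iter_form_neg (m : ℕ) (F H : ℝ → ℂ) (hH : ∀ n : ℕ, ContDiff ℝ n H)
    (hF : ∀ t : ℝ, 0 < t → F (-t) = wt m t * H t⁻¹) (N : ℕ) :
    ∃ K : ℝ → ℂ, (∀ n : ℕ, ContDiff ℝ n K) ∧
      ∀ t : ℝ, 0 < t → iteratedDeriv N F (-t) = wt (m + N) t * K t⁻¹ := by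
  obtain ⟨K, hK, hKt⟩ := iter_form m (fun t => F (-t)) H hH hF N
  refine ⟨fun s => (-1) ^ N * K s, fun n => contDiff_const.mul (hK n), fun t ht => ?_⟩
  have h := hKt t ht
  rw [iteratedDeriv_comp_neg] at h
  rw [mul_left_comm, ← h, Complex.real_smul]
  push_cast
  rw [← mul_assoc, ← mul_pow]
  simp

open FourierTransform in
lemma fourier_eq_osc (G : ℝ → ℂ) (ξ : ℝ) : 𝓕 G ξ = osc volume (fun t : ℝ => -t) G ξ := by
  rw [Real.fourier_eq']
  unfold osc
  congr 1
  ext t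
  rw [smul_eq_mul]
  congr 2
  simp
  ring

lemma iter_inv_pow (N i : ℕ) : ∃ c : ℂ, ∀ ξ : ℝ, ξ ≠ 0 →
    iteratedDeriv i (fun x : ℝ => ((x : ℂ) ^ N)⁻¹) ξ = c * ((ξ : ℂ) ^ (N + i))⁻¹ := by
  induction i with
  | zero => exact ⟨1, fun ξ _ => by simp⟩
  | succ i ih =>
    obtain ⟨c, hc⟩ := ih
    refine ⟨c * (-((N + i : ℕ) : ℂ)), fun ξ hξ => ?_⟩
    rw [iteratedDeriv_succ]
    have hev : iteratedDeriv i (fun x : ℝ => ((x : ℂ) ^ N)⁻¹) =ᶠ[nhds ξ]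
        fun x : ℝ => c * ((x : ℂ) ^ (N + i))⁻¹ := by
      filter_upwards [isOpen_ne.mem_nhds hξ] with s hs
      exact hc s hs
    rw [hev.deriv_eq]
    have hξ' : (ξ : ℂ) ≠ 0 := by exact_mod_cast hξ
    have h1 : HasDerivAt (fun x : ℝ => (x : ℂ)) 1 ξ := Complex.ofRealCLM.hasDerivAt
    have h2 := ((h1.fun_pow (N + i)).fun_inv (pow_ne_zero _ hξ')).const_mul c
    rw [h2.deriv]
    rcases Nat.eq_zero_or_pos (N + i) with h0 | h0
    · simp [h0]
    · obtain ⟨k, hk⟩ := Nat.exists_eq_succ_of_ne_zero h0.ne'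
      rw [← add_assoc, hk]
      simp only [Nat.succ_eq_add_one, Nat.add_sub_cancel]
      field_simp
      ring

lemma decay_of_div (f h : ℝ → ℂ) (M k P : ℕ) (hP : M + 1 ≤ P)
    (hC : ContDiff ℝ k h) (hb : ∀ j ≤ k, ∃ C, ∀ ξ, ‖iteratedDeriv j h ξ‖ ≤ C)
    (hf : ∀ ξ : ℝ, ξ ≠ 0 → f ξ = ((ξ : ℂ) ^ P)⁻¹ * h ξ) :
    Tendsto (fun ξ : ℝ => |ξ| ^ M * ‖iteratedDeriv k f ξ‖) (cocompact ℝ) (nhds 0) := by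
  choose c hc using fun i => iter_inv_pow P i
  have hb' : ∀ j, ∃ C, j ≤ k → ∀ ξ, ‖iteratedDeriv j h ξ‖ ≤ C := by
    intro j
    by_cases hj : j ≤ k
    · obtain ⟨C, hC⟩ := hb j hj
      exact ⟨C, fun _ => hC⟩
    · exact ⟨0, fun h => absurd h hj⟩
  choose B hB using hb'
  set D : ℝ := ∑ i ∈ Finset.range (k + 1), (k.choose i : ℝ) * ‖c i‖ * B (k - i) with hD
  have key : ∀ ξ : ℝ, 1 ≤ |ξ| → |ξ| ^ M * ‖iteratedDeriv k f ξ‖ ≤ D * |ξ|⁻¹ := by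
    intro ξ hξ
    have hξ0 : ξ ≠ 0 := by
      intro h0; rw [h0, abs_zero] at hξ; linarith
    have hξc : (ξ : ℂ) ≠ 0 := by exact_mod_cast hξ0
    have hev : f =ᶠ[nhds ξ] fun x => ((x : ℂ) ^ P)⁻¹ * h x := by
      filter_upwards [isOpen_ne.mem_nhds hξ0] with s hs
      exact hf s hs
    rw [hev.iteratedDeriv_eq]
    have hca : ContDiffAt ℝ k (fun x : ℝ => ((x : ℂ) ^ P)⁻¹) ξ := by
      have h2 : ContDiff ℝ k (fun s : ℝ => (s : ℂ)) := Complex.ofRealCLM.contDiff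
      exact (h2.pow P).contDiffAt.inv (pow_ne_zero _ hξc)
    rw [iteratedDeriv_fun_mul hca hC.contDiffAt]
    have hpos : 0 < |ξ| := by linarith
    calc |ξ| ^ M * ‖_‖ ≤ |ξ| ^ M * ∑ i ∈ Finset.range (k + 1),
          (k.choose i : ℝ) * (‖c i‖ * (|ξ| ^ (M + 1))⁻¹) * B (k - i) := by
          gcongr
          refine (norm_sum_le _ _).trans (Finset.sum_le_sum fun i hi => ?_)
          rw [norm_mul, norm_mul, Complex.norm_natCast]
          have hBi := hB (k - i) (Nat.sub_le _ _) ξ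
          gcongr
          rw [hc i ξ hξ0, norm_mul, norm_inv, norm_pow, Complex.norm_real, Real.norm_eq_abs]
          exact mul_le_mul_of_nonneg_left
            (inv_anti₀ (by positivity) (pow_le_pow_right₀ hξ (by omega))) (norm_nonneg _)
      _ = D * |ξ|⁻¹ := by
          rw [hD, Finset.mul_sum, Finset.sum_mul]
          refine Finset.sum_congr rfl fun i _ => ?_
          field_simp
          ring
  have hlim : Tendsto (fun ξ : ℝ => D * |ξ|⁻¹) (cocompact ℝ) (nhds 0) := by
    have h1 : Tendsto (fun ξ : ℝ => |ξ|) (cocompact ℝ) atTop := by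
      simpa using! tendsto_norm_cocompact_atTop (E := ℝ)
    simpa using (tendsto_inv_atTop_zero.comp h1).const_mul D
  have h1 : ∀ᶠ ξ : ℝ in cocompact ℝ, 1 ≤ |ξ| := by
    have h1 : Tendsto (fun ξ : ℝ => |ξ|) (cocompact ℝ) atTop := by
      simpa using! tendsto_norm_cocompact_atTop (E := ℝ)
    exact h1.eventually_ge_atTop 1
  refine squeeze_zero' (Eventually.of_forall fun ξ => by positivity) ?_ hlim
  filter_upwards [h1] with ξ hξ
  exact key ξ hξ

lemma decay_form (m : ℕ) (F Hp Hm : ℝ → ℂ) (hF : ∀ n : ℕ, ContDiff ℝ n F)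
    (hHp : ∀ n : ℕ, ContDiff ℝ n Hp) (hHm : ∀ n : ℕ, ContDiff ℝ n Hm)
    (hp : ∀ t : ℝ, 0 < t → F t = wt m t * Hp t⁻¹)
    (hm : ∀ t : ℝ, 0 < t → F (-t) = wt m t * Hm t⁻¹) (M k : ℕ) :
    Tendsto (fun ξ : ℝ => |ξ| ^ M * ‖iteratedDeriv k (osc volume (fun t : ℝ => -t) F) ξ‖)
      (cocompact ℝ) (nhds 0) := by
  have hint : ∀ N j : ℕ, j ≤ N → Integrable (fun t : ℝ => (t : ℂ) ^ j * iteratedDeriv N F t) := by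
    intro N j hj
    obtain ⟨Kp, hKp, hKpt⟩ := iter_form m F Hp hHp hp N
    obtain ⟨Km, hKm, hKmt⟩ := iter_form_neg m F Hm hHm hm N
    exact form_integrable (m + N) j (by omega) _ Kp Km
      ((hF N).continuous_iteratedDeriv N le_rfl) (hKp 0).continuous (hKm 0).continuous hKpt hKmt
  set N := M + 1 + k with hN
  have hft := Real.fourier_iteratedDeriv (N := N) (n := N) (f := F) (by exact_mod_cast hF N)
    (fun n _ => by simpa using hint n 0 (Nat.zero_le _)) (by simp)
  have hint' : ∀ j ≤ k, Integrable (fun t : ℝ => (((-t : ℝ)) : ℂ) ^ j * iteratedDeriv N F t) := by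
    intro j hj
    refine ((hint N j (by omega)).const_mul ((-1) ^ j)).congr (ae_of_all _ fun t => ?_)
    push_cast
    rw [neg_pow (t : ℂ) j, mul_assoc]
  set h : ℝ → ℂ := osc volume (fun t : ℝ => -t) (iteratedDeriv N F) with hh
  have hm1 : Measurable (fun t : ℝ => -t) := by fun_prop
  have hCk : ContDiff ℝ k h := osc_contDiff volume _ hm1 k _ hint'
  have hbk : ∀ j ≤ k, ∃ C, ∀ ξ, ‖iteratedDeriv j h ξ‖ ≤ C := fun j hj =>
    osc_iteratedDeriv_bdd volume _ hm1 j _ fun i hi => hint' i (hi.trans hj)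
  set a : ℂ := (2 * Real.pi * Complex.I) ^ N with ha
  have ha0 : a ≠ 0 := pow_ne_zero _ (by simp [Real.pi_ne_zero])
  refine decay_of_div _ (fun ξ => a⁻¹ * h ξ) M k N (by omega) (contDiff_const.mul hCk) ?_ ?_
  · intro j hj
    obtain ⟨C, hC⟩ := hbk j hj
    refine ⟨‖a⁻¹‖ * C, fun ξ => ?_⟩
    rw [iteratedDeriv_const_mul_field, norm_mul]
    exact mul_le_mul_of_nonneg_left (hC ξ) (norm_nonneg _)
  · intro ξ hξ
    have e := congrFun hft ξ
    rw [fourier_eq_osc, fourier_eq_osc, smul_eq_mul] at e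
    have hξ' : (ξ : ℂ) ^ N ≠ 0 := pow_ne_zero _ (by exact_mod_cast hξ)
    rw [hh, e, mul_pow, ← ha]
    field_simp

open FourierTransform SchwartzMap in
lemma push_schwartz {X : Type*} [MeasurableSpace X] (μ : Measure X) [SFinite μ] (q : X → ℝ)
    (hq : Measurable q) (φ : X → ℂ) (hφ : Integrable φ μ)
    (hF : Integrable (osc μ q φ)) (g : 𝓢(ℝ, ℂ)) :
    ∫ x, g (q x) * φ x ∂μ = ∫ ξ, g ξ * osc volume (fun t : ℝ => -t) (osc μ q φ) ξ := by
  have hinv : ∀ y : ℝ, g y = ∫ t : ℝ,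
      Complex.exp (2 * Real.pi * Complex.I * t * y) * (𝓕 g) t := by
    intro y
    have h : 𝓕⁻ (𝓕 g) = g := FourierTransform.fourierInv_fourier_eq g
    have h2 : g y = 𝓕⁻ ((𝓕 g : 𝓢(ℝ, ℂ)) : ℝ → ℂ) y := by
      conv_lhs => rw [← h]
      rw [SchwartzMap.fourierInv_coe]
    rw [h2, Real.fourierInv_eq']
    congr 1
    ext t
    rw [smul_eq_mul]
    congr 2
    simp
    ring
  have hself : ∫ t, (𝓕 g) t * osc μ q φ t
      = ∫ ξ, g ξ * osc volume (fun t : ℝ => -t) (osc μ q φ) ξ := by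
    have h := VectorFourier.integral_bilin_fourierIntegral_eq_flip (.mul ℂ ℂ)
      (L := innerₗ ℝ) (μ := volume) (ν := volume)
      Real.continuous_fourierChar continuous_inner g.integrable hF
    simp only [flip_innerₗ] at h
    simp_rw [← fourier_eq_osc]
    exact h
  rw [← hself]
  have h1 : ∀ x, g (q x) * φ x = ∫ t : ℝ,
      (Complex.exp (2 * Real.pi * Complex.I * t * q x) * (𝓕 g) t) * φ x := by
    intro x
    rw [hinv (q x), integral_mul_const]
  simp_rw [h1]
  rw [integral_integral_swap]
  · congr 1
    ext t
    unfold osc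
    rw [← integral_const_mul]
    congr 1
    ext x
    ring
  · have hp : Integrable (fun z : X × ℝ => φ z.1 * (𝓕 g) z.2) (μ.prod volume) :=
      hφ.mul_prod (𝓕 g).integrable
    refine (hp.bdd_mul (c := 1) (f := fun z : X × ℝ =>
      Complex.exp (2 * Real.pi * Complex.I * z.2 * q z.1)) ?_ ?_).congr ?_
    · have hqq : Measurable (fun z : X × ℝ => q z.1) := hq.comp measurable_fst
      exact Measurable.aestronglyMeasurable (by fun_prop)
    · refine ae_of_all _ fun z => ?_
      rw [norm_osc_exp]
    · refine ae_of_all _ fun z => ?_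
      simp only [Function.uncurry]
      ring

lemma push_cc {X : Type*} [MeasurableSpace X] (μ : Measure X) [SFinite μ] (q : X → ℝ)
    (hq : Measurable q) (φ : X → ℂ) (hφ : Integrable φ μ)
    (hF : Integrable (osc μ q φ)) (g : ℝ → ℂ) (hg : Continuous g) (hgs : HasCompactSupport g) :
    ∫ x, g (q x) * φ x ∂μ = ∫ ξ, g ξ * osc volume (fun t : ℝ => -t) (osc μ q φ) ξ := by
  set f := osc volume (fun t : ℝ => -t) (osc μ q φ) with hf
  have hfc : Continuous f := osc_continuous volume _ (by fun_prop) _ hF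
  set K := tsupport g
  have hK : IsCompact K := hgs
  have hfK : IntegrableOn f K := hfc.continuousOn.integrableOn_compact hK
  set C : ℝ := (∫ x, ‖φ x‖ ∂μ) + ∫ ξ in K, ‖f ξ‖ with hC
  have hC0 : 0 ≤ C := add_nonneg (integral_nonneg fun _ => norm_nonneg _)
    (integral_nonneg fun _ => norm_nonneg _)
  have hI1 : ∀ u : ℝ → ℂ, Continuous u → HasCompactSupport u →
      Integrable (fun x => u (q x) * φ x) μ := by
    intro u hu hus
    obtain ⟨c, hc⟩ := hu.bounded_above_of_compact_support hus
    exact hφ.bdd_mul (c := c) (hu.measurable.comp hq).aestronglyMeasurable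
      (ae_of_all _ fun x => hc _)
  have hI2 : ∀ u : ℝ → ℂ, Continuous u → HasCompactSupport u →
      Integrable (fun x => u x * f x) := by
    intro u hu hus
    exact (hu.mul hfc).integrable_of_hasCompactSupport hus.mul_right
  have key : ∀ ε : ℝ, 0 < ε →
      ‖(∫ x, g (q x) * φ x ∂μ) - ∫ ξ, g ξ * f ξ‖ ≤ ε * C := by
    intro ε hε
    obtain ⟨u, hu, hud, hus⟩ := hg.exists_contDiff_approx ⊤ (continuous_const (y := ε))
      (fun _ => hε)
    have husc : HasCompactSupport u := hgs.mono hus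
    have huc : Continuous u := hu.continuous
    have hP := push_schwartz μ q hq φ hφ hF (husc.toSchwartzMap (by exact_mod_cast hu))
    have hP' : ∫ x, u (q x) * φ x ∂μ = ∫ ξ, u ξ * f ξ := hP
    have e : (∫ x, g (q x) * φ x ∂μ) - ∫ ξ, g ξ * f ξ =
        (∫ x, (g (q x) - u (q x)) * φ x ∂μ) - ∫ ξ, (g ξ - u ξ) * f ξ := by
      simp_rw [sub_mul]
      rw [integral_sub (hI1 g hg hgs) (hI1 u huc husc), integral_sub (hI2 g hg hgs)
        (hI2 u huc husc), hP']
      ring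
    have hd : ∀ y, ‖g y - u y‖ ≤ ε := fun y => by
      rw [← dist_eq_norm, dist_comm]; exact (hud y).le
    rw [e, hC, mul_add]
    refine (norm_sub_le _ _).trans (add_le_add ?_ ?_)
    · rw [← integral_const_mul]
      refine norm_integral_le_of_norm_le (hφ.norm.const_mul ε) (ae_of_all _ fun x => ?_)
      rw [norm_mul]
      exact mul_le_mul_of_nonneg_right (hd _) (norm_nonneg _)
    · have hset : ∫ ξ, (g ξ - u ξ) * f ξ = ∫ ξ in K, (g ξ - u ξ) * f ξ := by
        symm
        apply setIntegral_eq_integral_of_forall_compl_eq_zero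
        intro x hx
        have h1 : g x = 0 := image_eq_zero_of_notMem_tsupport hx
        have h2 : u x = 0 := by
          by_contra h
          exact hus (Function.mem_support.2 h) h1
        rw [h1, h2]; simp
      rw [hset, ← integral_const_mul]
      refine norm_integral_le_of_norm_le (hfK.norm.const_mul ε) (ae_of_all _ fun x => ?_)
      rw [norm_mul]
      exact mul_le_mul_of_nonneg_right (hd _) (norm_nonneg _)
  rw [← sub_eq_zero, ← norm_le_zero_iff]
  refine le_of_forall_pos_le_add fun δ hδ => ?_
  have := key (δ / (C + 1)) (by positivity)
  refine this.trans ?_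
  rw [zero_add, div_mul_eq_mul_div, div_le_iff₀ (by positivity)]
  nlinarith

lemma push_unique (f f' : ℝ → ℂ) (hf : ContinuousOn f ({0}ᶜ : Set ℝ))
    (hf' : ContinuousOn f' ({0}ᶜ : Set ℝ))
    (h : ∀ g : ℝ → ℂ, Continuous g → HasCompactSupport g → (0 : ℝ) ∉ tsupport g →
      ∫ ξ : ℝ, g ξ * f' ξ = ∫ ξ : ℝ, g ξ * f ξ) :
    Set.EqOn f' f ({0}ᶜ : Set ℝ) := by
  have hU : IsOpen ({0}ᶜ : Set ℝ) := isOpen_compl_singleton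
  have hi : ∀ (v : ℝ → ℂ), ContinuousOn v ({0}ᶜ : Set ℝ) → ∀ g : ℝ → ℂ, Continuous g →
      HasCompactSupport g → (0 : ℝ) ∉ tsupport g → Integrable (fun ξ => g ξ * v ξ) := by
    intro v hv g hg hgs h0
    have hsub : tsupport g ⊆ ({0}ᶜ : Set ℝ) := fun x hx hx0 => h0 (by
      rw [Set.mem_singleton_iff] at hx0; rwa [hx0] at hx)
    have h1 : IntegrableOn (fun ξ => g ξ * v ξ) (tsupport g) :=
      (hg.continuousOn.mul (hv.mono hsub)).integrableOn_compact hgs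
    rw [integrableOn_iff_integrable_of_support_subset] at h1
    · exact h1
    · intro x hx
      apply subset_tsupport
      intro h0
      exact hx (by simp [h0])
  have hae := hU.ae_eq_zero_of_integral_contDiff_smul_eq_zero (f := fun x => f' x - f x)
    (μ := volume) ((hf'.sub hf).locallyIntegrableOn hU.measurableSet) (by
      intro g hg hgs hsub
      have hgc : Continuous (fun x => (g x : ℂ)) := Complex.continuous_ofReal.comp hg.continuous
      have hgcs : HasCompactSupport (fun x => (g x : ℂ)) :=
        hgs.comp_left (g := fun r : ℝ => (r : ℂ)) (by simp)
      have hts : tsupport (fun x => (g x : ℂ)) ⊆ tsupport g := by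
        apply closure_mono
        intro x hx h0
        exact hx (by simp [h0])
      have h0 : (0 : ℝ) ∉ tsupport (fun x => (g x : ℂ)) := fun h0 => hsub (hts h0) rfl
      have := h _ hgc hgcs h0
      simp_rw [Complex.real_smul, mul_sub]
      rw [integral_sub (hi f' hf' _ hgc hgcs h0) (hi f hf _ hgc hgcs h0), this, sub_self])
  have hae2 : f' =ᵐ[volume.restrict ({0}ᶜ : Set ℝ)] f := by
    rw [Filter.EventuallyEq, ae_restrict_iff' hU.measurableSet]
    filter_upwards [hae] with x hx hxU
    exact sub_eq_zero.1 (hx hxU)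
  exact Measure.eqOn_open_of_ae_eq hae2 hU hf' hf

lemma padR_lt {d : ℕ} (x : Fin d → ℝ) {n : ℕ} (h : n < d) : padR x n = x ⟨n, h⟩ := by
  simp [padR, h]

lemma padR_add {d : ℕ} (x y : Fin d → ℝ) (n : ℕ) : padR (x + y) n = padR x n + padR y n := by
  unfold padR; split_ifs <;> simp

lemma padR_smul {d : ℕ} (c : ℝ) (x : Fin d → ℝ) (n : ℕ) : padR (c • x) n = c * padR x n := by
  unfold padR; split_ifs <;> simp

/-- the change of variables -/
def diagL (d : ℕ) : (Fin d → ℝ) →ₗ[ℝ] (Fin d → ℝ) where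
  toFun x i := if (i : ℕ) = 0 then padR x 0 else if Odd (i : ℕ) then
    padR x i + padR x (i + 1) else padR x (i - 1) - padR x i
  map_add' x y := by
    ext i
    simp only [padR_add, Pi.add_apply]
    split_ifs <;> ring
  map_smul' c x := by
    ext i
    simp only [padR_smul, Pi.smul_apply, smul_eq_mul, RingHom.id_apply]
    split_ifs <;> ring

lemma diagL_zero (d : ℕ) (x : Fin d → ℝ) (h : 0 < d) : padR (diagL d x) 0 = padR x 0 := by
  rw [padR_lt _ h]; simp [diagL]

lemma diagL_odd (d : ℕ) (x : Fin d → ℝ) (i : ℕ) (h : 2 * i + 1 < d) :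
    padR (diagL d x) (2 * i + 1) = padR x (2 * i + 1) + padR x (2 * i + 2) := by
  rw [padR_lt _ h]
  have : Odd (2 * i + 1) := ⟨i, rfl⟩
  simp [diagL]

lemma diagL_even (d : ℕ) (x : Fin d → ℝ) (i : ℕ) (h : 2 * i + 2 < d) :
    padR (diagL d x) (2 * i + 2) = padR x (2 * i + 1) - padR x (2 * i + 2) := by
  rw [padR_lt _ h]
  have : ¬ Odd (2 * i + 2) := by rw [Nat.not_odd_iff_even]; exact ⟨i + 1, by ring⟩
  simp [diagL, this]

lemma diagL_inj (d : ℕ) (hdo : Odd d) : Function.Injective (diagL d) := by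
  rw [← LinearMap.ker_eq_bot, LinearMap.ker_eq_bot']
  intro x hx
  obtain ⟨m, hm⟩ := hdo
  have hz : ∀ n, padR (diagL d x) n = 0 := by
    intro n; rw [hx]; unfold padR; split_ifs <;> simp
  have hodd : ∀ i, 2 * i + 1 < d → padR x (2 * i + 1) = 0 ∧ padR x (2 * i + 2) = 0 := by
    intro i hi
    have h1 := diagL_odd d x i hi
    have h2 := diagL_even d x i (by omega)
    rw [hz] at h1 h2
    constructor <;> linarith
  ext ⟨n, hn⟩
  rw [← padR_lt x hn]
  simp only [Pi.zero_apply]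
  rcases Nat.even_or_odd' n with ⟨i, hi | hi⟩
  · rcases Nat.eq_zero_or_pos i with h0 | h0
    · have : n = 0 := by omega
      have h := diagL_zero d x (by omega)
      rw [hz] at h
      exact (congrArg (padR x) this).trans h.symm
    · have h := (hodd (i - 1) (by omega)).2
      have e : 2 * (i - 1) + 2 = n := by omega
      rwa [e] at h
  · have h := (hodd i (by omega)).1
    rwa [← hi] at h

/-- signs -/
def sgn_i (n : ℕ) : ℝ := if n = 0 ∨ Odd n then 1 else -1

lemma sum_range_two_mul (m : ℕ) (a : ℕ → ℝ) :
    ∑ i ∈ Finset.range (2 * m), a i = ∑ i ∈ Finset.range m, (a (2 * i) + a (2 * i + 1)) := by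
  induction m with
  | zero => simp
  | succ m ih =>
    rw [mul_add, mul_one, Finset.sum_range_succ, Finset.sum_range_succ, Finset.sum_range_succ, ih]
    ring

lemma splitQR_diagL (d : ℕ) (hdo : Odd d) (x : EuclideanSpace ℝ (Fin d)) :
    splitQR d (diagL d (fun i => x i)) = qq (fun i : Fin d => sgn_i i) x := by
  have hne : ¬ Even d := Nat.not_even_iff_odd.2 hdo
  obtain ⟨m, hm⟩ := hdo
  set y : Fin d → ℝ := fun i => x i with hy
  have hq : qq (fun i : Fin d => sgn_i i) x = ∑ n ∈ Finset.range d, sgn_i n * padR y n ^ 2 := by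
    rw [Finset.sum_range]
    unfold qq
    refine Finset.sum_congr rfl fun i _ => ?_
    rw [padR_lt y i.2]
  rw [hq, splitQR, if_neg hne]
  have hd2 : d / 2 = m := by omega
  rw [hd2]
  have hr : Finset.range d = Finset.range (2 * m + 1) := by rw [hm]
  rw [hr, Finset.sum_range_succ' _ (2 * m), sum_range_two_mul,
    diagL_zero d y (by omega), add_comm]
  congr 1
  · refine Finset.sum_congr rfl fun i hi => ?_
    have hi' : i < m := Finset.mem_range.1 hi
    rw [diagL_odd d y i (by omega), diagL_even d y i (by omega)]
    have h1 : sgn_i (2 * i + 1) = 1 := by simp [sgn_i]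
    have h2 : sgn_i (2 * i + 1 + 1) = -1 := by
      have : ¬ Odd (2 * i + 1 + 1) := by rw [Nat.not_odd_iff_even]; exact ⟨i + 1, by ring⟩
      simp [sgn_i, this]
    rw [h1, h2]
    ring
  · simp [sgn_i]

lemma sgn_i_sq (n : ℕ) : sgn_i n ^ 2 = 1 := by
  unfold sgn_i; split_ifs <;> norm_num

lemma diag_reduce (d : ℕ) (hdo : Odd d) (Φ : SchwartzMap (Fin d → ℝ) ℂ) :
    ∃ Ψ : SchwartzMap (EuclideanSpace ℝ (Fin d)) ℂ, ∀ g : ℝ → ℂ,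
      ∫ x : Fin d → ℝ, g (splitQR d x) * Φ x =
      ∫ x : EuclideanSpace ℝ (Fin d), g (qq (fun i : Fin d => sgn_i i) x) * Ψ x := by
  set L := LinearEquiv.ofInjectiveEndo (diagL d) (diagL_inj d hdo) with hL
  have hLa : ∀ y, L y = diagL d y := fun y => rfl
  set Lc : (Fin d → ℝ) ≃L[ℝ] (Fin d → ℝ) := L.toContinuousLinearEquiv with hLc
  have hLca : ∀ y, Lc y = diagL d y := fun y => rfl
  set T : EuclideanSpace ℝ (Fin d) ≃L[ℝ] (Fin d → ℝ) :=
    (EuclideanSpace.equiv (Fin d) ℝ).trans Lc with hT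
  have hTa : ∀ x, T x = diagL d (fun i => x i) := fun x => rfl
  have hdet : LinearMap.det (diagL d) ≠ 0 := by
    have := (LinearEquiv.isUnit_det' L).ne_zero
    exact this
  set c : ℝ := |LinearMap.det (diagL d)| with hc
  have hc0 : c ≠ 0 := abs_ne_zero.2 hdet
  refine ⟨(c : ℂ) • SchwartzMap.compCLMOfContinuousLinearEquiv ℂ T Φ, fun g => ?_⟩
  set h : (Fin d → ℝ) → ℂ := fun y => g (splitQR d y) * Φ y with hh
  have h1 : ∫ y, h (Lc y) = (c⁻¹ : ℝ) • ∫ y, h y := by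
    have hmap := Measure.map_linearMap_addHaar_eq_smul_addHaar
      (volume : Measure (Fin d → ℝ)) hdet
    have := Lc.toHomeomorph.measurableEmbedding.integral_map (μ := volume) h
    have e : Measure.map Lc.toHomeomorph (volume : Measure (Fin d → ℝ)) =
      Measure.map (diagL d) volume := rfl
    rw [e, hmap, integral_smul_measure] at this
    rw [abs_inv, ENNReal.toReal_ofReal (by positivity)] at this
    exact this.symm
  have h2 : ∫ x : EuclideanSpace ℝ (Fin d), h (T x) = ∫ y, h (Lc y) :=
    (PiLp.volume_preserving_ofLp (Fin d)).integral_comp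
      (MeasurableEquiv.toLp 2 (Fin d → ℝ)).symm.measurableEmbedding (fun y => h (Lc y))
  have h3 : ∫ y, h y = (c : ℂ) * ∫ x : EuclideanSpace ℝ (Fin d), h (T x) := by
    rw [h2, h1, Complex.real_smul, ← mul_assoc, ← Complex.ofReal_mul, mul_inv_cancel₀ hc0]
    simp
  rw [h3, ← integral_const_mul]
  congr 1
  ext x
  simp only [hh, hTa, splitQR_diagL d hdo]
  simp [hTa]
  ring

lemma sg_contDiffOn (a b : ℂ) (n : ℕ) : ContDiffOn ℝ n (sg a b) ({0}ᶜ : Set ℝ) := by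
  have h2 : ContDiff ℝ n (fun s : ℝ => (s : ℂ)) := Complex.ofRealCLM.contDiff
  have h := (sg_contDiff a b n).contDiffOn (s := ({0}ᶜ : Set ℝ))
  have h3 : ContDiffOn ℝ n (fun x : ℝ => ((x : ℂ) ^ n)⁻¹) ({0}ᶜ : Set ℝ) :=
    (h2.pow n).contDiffOn.inv fun x hx => pow_ne_zero _ (by exact_mod_cast hx)
  refine (h3.mul h).congr fun x hx => ?_
  have : (x : ℂ) ^ n ≠ 0 := pow_ne_zero _ (by exact_mod_cast hx)
  rw [← mul_assoc, inv_mul_cancel₀ this, one_mul]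

lemma pow_sg (m : ℕ) (ξ : ℝ) (hξ : ξ ≠ 0) (A B : ℂ) :
    (ξ : ℂ) ^ m * (A * sg 1 0 ξ + B * sg 0 1 ξ) =
      ((if Even m then A else B) + (if Even m then B else A) * ((Real.sign ξ : ℝ) : ℂ)) *
        ((|ξ| ^ ((m : ℝ) + 1 / 2) : ℝ) : ℂ) := by
  have hpos : 0 < |ξ| := abs_pos.2 hξ
  rw [Real.rpow_add hpos, Real.rpow_natCast, ← Real.sqrt_eq_rpow]
  have hs : (ξ : ℂ) = ((Real.sign ξ : ℝ) : ℂ) * ((|ξ| : ℝ) : ℂ) := by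
    rcases lt_or_gt_of_ne hξ with h | h
    · rw [Real.sign_of_neg h, abs_of_neg h]; push_cast; ring
    · rw [Real.sign_of_pos h, abs_of_pos h]; push_cast; ring
  have hs2 : ((Real.sign ξ : ℝ) : ℂ) ^ 2 = 1 := by
    rcases lt_or_gt_of_ne hξ with h | h
    · rw [Real.sign_of_neg h]; norm_num
    · rw [Real.sign_of_pos h]; norm_num
  have hp : (ξ : ℂ) ^ m = ((Real.sign ξ : ℝ) : ℂ) ^ m * ((|ξ| : ℝ) : ℂ) ^ m := by
    conv_lhs => rw [hs]
    rw [mul_pow]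
  rw [hp]
  unfold sg
  push_cast
  set σ := ((Real.sign ξ : ℝ) : ℂ)
  rcases Nat.even_or_odd' m with ⟨i, hi | hi⟩
  · have he : Even m := ⟨i, by omega⟩
    have : σ ^ m = 1 := by rw [hi, pow_mul, hs2, one_pow]
    rw [if_pos he, if_pos he, this]
    ring
  · have he : ¬ Even m := Nat.not_even_iff_odd.2 ⟨i, hi⟩
    have : σ ^ m = σ := by rw [hi, pow_succ, pow_mul, hs2, one_pow, one_mul]
    rw [if_neg he, if_neg he, this]
    linear_combination (B * ((|ξ| : ℝ) : ℂ) ^ m * ((Real.sqrt |ξ| : ℝ) : ℂ)) * hs2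

/-- germ of the pushforward of a Schwartz measure under the split quadratic
form on `ℝ^d`, `d` odd: smooth away from `0`, rapidly decaying with all derivatives at
infinity, and at `0` of the form `C₀(ξ) + (C₁(ξ) + C₂(ξ)·sgn(ξ))·|ξ|^{(d−2)/2}`. -/
theorem germ_pushforward_real_odd (d : ℕ) (hd : 3 ≤ d) (hdo : Odd d)
    (Φ : SchwartzMap (Fin d → ℝ) ℂ) :
    ∃ f : ℝ → ℂ,
      (∀ n : ℕ, ContDiffOn ℝ n f ({0}ᶜ : Set ℝ)) ∧
      (∀ g : ℝ → ℂ, Continuous g → HasCompactSupport g → (0 : ℝ) ∉ tsupport g →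
        ∫ x : Fin d → ℝ, g (splitQR d x) * Φ x = ∫ ξ : ℝ, g ξ * f ξ) ∧
      (∀ f' : ℝ → ℂ, (∀ n : ℕ, ContDiffOn ℝ n f' ({0}ᶜ : Set ℝ)) →
        (∀ g : ℝ → ℂ, Continuous g → HasCompactSupport g → (0 : ℝ) ∉ tsupport g →
          ∫ x : Fin d → ℝ, g (splitQR d x) * Φ x = ∫ ξ : ℝ, g ξ * f' ξ) →
        Set.EqOn f' f ({0}ᶜ : Set ℝ)) ∧
      (∀ N k : ℕ, Tendsto (fun ξ : ℝ => |ξ| ^ N * ‖iteratedDeriv k f ξ‖)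
        (cocompact ℝ) (nhds 0)) ∧
      (∃ C₀ C₁ C₂ : ℝ → ℂ,
        (∀ n : ℕ, ContDiff ℝ n C₀) ∧ (∀ n : ℕ, ContDiff ℝ n C₁) ∧
        (∀ n : ℕ, ContDiff ℝ n C₂) ∧
        ∀ ξ : ℝ, ξ ≠ 0 →
          f ξ = C₀ ξ + (C₁ ξ + C₂ ξ * ((Real.sign ξ : ℝ) : ℂ)) *
            ((|ξ| ^ (((d : ℝ) - 2) / 2) : ℝ) : ℂ)) := by
  obtain ⟨Ψ, hΨ⟩ := diag_reduce d hdo Φ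
  obtain ⟨m, hm⟩ : ∃ m : ℕ, d = 2 * m + 3 := by
    obtain ⟨k, hk⟩ := hdo
    exact ⟨k - 1, by omega⟩
  set ε : Fin d → ℝ := fun i => sgn_i i with hεdef
  have hε : ∀ i, ε i ^ 2 = 1 := fun i => sgn_i_sq i
  have hqm : Measurable (qq ε) := (qq_continuous ε).measurable
  set F := osc volume (qq ε) Ψ with hFdef
  have hF : ∀ n : ℕ, ContDiff ℝ n F := fun n =>
    osc_contDiff volume (qq ε) hqm n _ fun j _ => qq_pow_integrable ε hε Ψ j
  have hwt : ∀ t : ℝ, ((t ^ (-((Fintype.card (Fin d) : ℝ) / 2)) : ℝ) : ℂ) = wt m t := by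
    intro t
    unfold wt
    congr 2
    rw [Fintype.card_fin, hm]
    push_cast
    ring
  obtain ⟨Hp, hHp, hp⟩ := fresnel_form ε hε Ψ 1 one_ne_zero
  obtain ⟨Hm, hHm, hmm⟩ := fresnel_form ε hε Ψ (-1) (by norm_num)
  simp only [hwt, one_mul, neg_mul, ← hFdef] at hp hmm
  have hFi : Integrable F := by
    simpa using form_integrable m 0 (Nat.zero_le _) F Hp Hm (hF 0).continuous (hHp 0).continuous
      (hHm 0).continuous hp hmm
  obtain ⟨C0, C1, C2, hC0, hC1, hC2, hC⟩ := germ_form m F Hp Hm (hF 0).continuous hHp hHm hp hmm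
  have hpush : ∀ g : ℝ → ℂ, Continuous g → HasCompactSupport g → (0 : ℝ) ∉ tsupport g →
      ∫ x : Fin d → ℝ, g (splitQR d x) * Φ x =
        ∫ ξ : ℝ, g ξ * osc volume (fun t : ℝ => -t) F ξ := by
    intro g hg hgs _
    rw [hΨ g]
    exact push_cc volume (qq ε) hqm Ψ Ψ.integrable hFi g hg hgs
  have hsm : ∀ n : ℕ, ContDiffOn ℝ n (osc volume (fun t : ℝ => -t) F) ({0}ᶜ : Set ℝ) := by
    intro n
    have h2 : ContDiff ℝ n (fun s : ℝ => (s : ℂ)) := Complex.ofRealCLM.contDiff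
    have := (hC0 n).contDiffOn.add ((h2.pow m).contDiffOn.mul
      (((hC1 n).contDiffOn.mul (sg_contDiffOn 1 0 n)).add
        ((hC2 n).contDiffOn.mul (sg_contDiffOn 0 1 n))))
    exact this.congr fun ξ _ => hC ξ
  refine ⟨osc volume (fun t : ℝ => -t) F, hsm, hpush, ?_, ?_, ?_⟩
  · intro f' hf' hpush'
    refine push_unique _ _ (hsm 0).continuousOn (hf' 0).continuousOn fun g hg hgs h0 => ?_
    rw [← hpush' g hg hgs h0, hpush g hg hgs h0]
  · exact fun N k => decay_form m F Hp Hm hF hHp hHm hp hmm N k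
  · refine ⟨C0, fun ξ => if Even m then C1 ξ else C2 ξ, fun ξ => if Even m then C2 ξ else C1 ξ,
      hC0, ?_, ?_, ?_⟩
    · intro n
      split_ifs
      exacts [hC1 n, hC2 n]
    · intro n
      split_ifs
      exacts [hC2 n, hC1 n]
    · intro ξ hξ
      rw [hC ξ, pow_sg m ξ hξ]
      have : ((d : ℝ) - 2) / 2 = (m : ℝ) + 1 / 2 := by
        rw [hm]; push_cast; ring
      rw [this]
end
end

section
/- For every Φ ∈ 𝒮(ℝ²), the integral f(ξ) = ∫_{ℝ∖{0}} Φ(a, ξ/a) da/|a| converges absolutely for every ξ ≠ 0 and defines a smooth function on ℝ∖{0} which, together with all its derivatives, decays rapidly at infinity; moreover there exist smooth functions C₀, C₁ : ℝ → ℂ such that f(ξ) = C₀(ξ) + C₁(ξ)·log|ξ| for all ξ ≠ 0. -/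
open MeasureTheory Filter

noncomputable section

/-- The pushforward density of `Φ(x)dx` under `(x₁,x₂) ↦ x₁x₂`:
`f(ξ) = ∫_{ℝ∖{0}} Φ(a, ξ/a) da/|a|`. -/
def pushTwoR (Φ : SchwartzMap (ℝ × ℝ) ℂ) (ξ : ℝ) : ℂ :=
  ∫ a in ({0}ᶜ : Set ℝ), Φ (a, ξ / a) * ((|a|⁻¹ : ℝ) : ℂ)

open Set Topology

namespace Germ

local notation "𝓢₂" => SchwartzMap (ℝ × ℝ) ℂ

lemma htg1 : Function.HasTemperateGrowth (fun p : ℝ × ℝ => p.1) :=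
  (ContinuousLinearMap.fst ℝ ℝ ℝ).hasTemperateGrowth

lemma htg2 : Function.HasTemperateGrowth (fun p : ℝ × ℝ => p.2) :=
  (ContinuousLinearMap.snd ℝ ℝ ℝ).hasTemperateGrowth

def X (Φ : 𝓢₂) : 𝓢₂ := SchwartzMap.smulLeftCLM ℂ (fun p : ℝ × ℝ => p.1) Φ
def Y (Φ : 𝓢₂) : 𝓢₂ := SchwartzMap.smulLeftCLM ℂ (fun p : ℝ × ℝ => p.2) Φ
def dX (Φ : 𝓢₂) : 𝓢₂ := LineDeriv.lineDerivOp ((1, 0) : ℝ × ℝ) Φ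
def dY (Φ : 𝓢₂) : 𝓢₂ := LineDeriv.lineDerivOp ((0, 1) : ℝ × ℝ) Φ
def sw (Φ : 𝓢₂) : 𝓢₂ :=
  SchwartzMap.compCLMOfContinuousLinearEquiv ℝ (ContinuousLinearEquiv.prodComm ℝ ℝ ℝ) Φ

lemma X_apply (Φ : 𝓢₂) (x y : ℝ) : X Φ (x, y) = (x : ℂ) * Φ (x, y) := by
  simp [X, SchwartzMap.smulLeftCLM_apply_apply htg1]

lemma Y_apply (Φ : 𝓢₂) (x y : ℝ) : Y Φ (x, y) = (y : ℂ) * Φ (x, y) := by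
  simp [Y, SchwartzMap.smulLeftCLM_apply_apply htg2]

lemma sw_apply (Φ : 𝓢₂) (x y : ℝ) : sw Φ (x, y) = Φ (y, x) := by
  simp [sw]

lemma hasDerivAt_snd (Φ : 𝓢₂) (x y : ℝ) :
    HasDerivAt (fun t : ℝ => Φ (x, t)) (dY Φ (x, y)) y := by
  have h1 : HasFDerivAt Φ (fderiv ℝ Φ (x, y)) (x, y) := Φ.differentiableAt.hasFDerivAt
  have h2 : HasDerivAt (fun t : ℝ => (x, t)) ((0, 1) : ℝ × ℝ) y :=
    (hasDerivAt_const y x).prodMk (hasDerivAt_id y)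
  exact h1.comp_hasDerivAt y h2

lemma hasDerivAt_fst (Φ : 𝓢₂) (x y : ℝ) :
    HasDerivAt (fun t : ℝ => Φ (t, y)) (dX Φ (x, y)) x := by
  have h1 : HasFDerivAt Φ (fderiv ℝ Φ (x, y)) (x, y) := Φ.differentiableAt.hasFDerivAt
  have h2 : HasDerivAt (fun t : ℝ => (t, y)) ((1, 0) : ℝ × ℝ) x :=
    (hasDerivAt_id x).prodMk (hasDerivAt_const x y)
  exact h1.comp_hasDerivAt x h2

lemma dY_sw (Φ : 𝓢₂) : dY (sw Φ) = sw (dX Φ) := by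
  ext ⟨x, y⟩
  have h1 := hasDerivAt_snd (sw Φ) x y
  have h2 := hasDerivAt_fst Φ y x
  simp only [sw_apply] at h1 ⊢
  exact h1.unique h2

lemma dY_X (Φ : 𝓢₂) : dY (X Φ) = X (dY Φ) := by
  ext ⟨x, y⟩
  have h1 := hasDerivAt_snd (X Φ) x y
  have h2 := (hasDerivAt_snd Φ x y).const_mul (x : ℂ)
  simp only [X_apply] at h1 ⊢
  exact h1.unique h2

lemma dY_Y (Φ : 𝓢₂) : dY (Y Φ) = Φ + Y (dY Φ) := by
  ext ⟨x, y⟩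
  have h1 := hasDerivAt_snd (Y Φ) x y
  have h2 := (hasDerivAt_id y).ofReal_comp.mul (hasDerivAt_snd Φ x y)
  simp only [Y_apply] at h1
  rw [h1.unique h2]
  simp [Y_apply]

lemma bound (Φ : 𝓢₂) : ∃ C : ℝ, 0 ≤ C ∧ ∀ x y : ℝ, ‖Φ (x, y)‖ ≤ C * (1 + x ^ 2)⁻¹ := by
  refine ⟨SchwartzMap.seminorm ℝ 0 0 Φ + SchwartzMap.seminorm ℝ 2 0 Φ, by positivity, fun x y => ?_⟩
  have h1 := SchwartzMap.norm_le_seminorm ℝ Φ (x, y)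
  have h2 := SchwartzMap.norm_pow_mul_le_seminorm ℝ Φ 2 (x, y)
  have h3 : |x| ≤ ‖(x, y)‖ := norm_fst_le (x, y)
  have h4 : x ^ 2 ≤ ‖(x, y)‖ ^ 2 := by rw [← sq_abs]; gcongr
  rw [← div_eq_mul_inv, le_div_iff₀ (by positivity)]
  nlinarith [norm_nonneg (Φ (x, y)), mul_le_mul_of_nonneg_right h4 (norm_nonneg (Φ (x, y)))]

lemma integ : Integrable (fun x : ℝ => (1 + x ^ 2)⁻¹) := integrable_inv_one_add_sq

lemma push_eq (Φ : 𝓢₂) (ξ : ℝ) :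
    pushTwoR Φ ξ = ∫ a : ℝ, Φ (a, ξ / a) * ((|a|⁻¹ : ℝ) : ℂ) := by
  rw [pushTwoR, restrict_compl_singleton]

lemma meas (Φ : 𝓢₂) (ξ : ℝ) :
    Measurable (fun a : ℝ => Φ (a, ξ / a) * ((|a|⁻¹ : ℝ) : ℂ)) := by
  have h := Φ.continuous.measurable
  have h2 : Measurable (fun a : ℝ => (a, ξ / a)) := by fun_prop
  have h3 := h.comp h2
  have h4 : Measurable (fun a : ℝ => ((|a|⁻¹ : ℝ) : ℂ)) := by
    apply Complex.measurable_ofReal.comp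
    exact (continuous_abs.measurable).inv
  exact h3.mul h4

/-- pointwise bound for the integrand of `f_{XΨ}` -/
lemma boundX (Ψ : 𝓢₂) : ∃ C : ℝ, 0 ≤ C ∧ ∀ a y : ℝ,
    ‖X Ψ (a, y) * ((|a|⁻¹ : ℝ) : ℂ)‖ ≤ C * (1 + a ^ 2)⁻¹ := by
  obtain ⟨C, hC, h⟩ := bound Ψ
  refine ⟨C, hC, fun a y => ?_⟩
  rw [X_apply, norm_mul, norm_mul, Complex.norm_real, Complex.norm_real]
  simp only [norm_inv, Real.norm_eq_abs, abs_abs]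
  rcases eq_or_ne a 0 with rfl | ha
  · simp [hC]
  · have : |a| ≠ 0 := abs_ne_zero.2 ha
    calc _ = ‖Ψ (a, y)‖ := by field_simp
      _ ≤ _ := h a y

lemma integrableX (Ψ : 𝓢₂) (ξ : ℝ) :
    Integrable (fun a : ℝ => X Ψ (a, ξ / a) * ((|a|⁻¹ : ℝ) : ℂ)) := by
  obtain ⟨C, hC, h⟩ := boundX Ψ
  exact (integ.const_mul C).mono' (meas _ _).aestronglyMeasurable
    (Eventually.of_forall fun a => h a _)

lemma normX (Ψ : 𝓢₂) : ∃ C : ℝ, 0 ≤ C ∧ ∀ ξ : ℝ, ‖pushTwoR (X Ψ) ξ‖ ≤ C := by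
  obtain ⟨C, hC, h⟩ := boundX Ψ
  refine ⟨∫ a : ℝ, C * (1 + a ^ 2)⁻¹, integral_nonneg fun a => by positivity, fun ξ => ?_⟩
  rw [push_eq]
  exact norm_integral_le_of_norm_le (integ.const_mul C) (Eventually.of_forall fun a => h a _)

lemma XY_apply (Φ : 𝓢₂) {ξ : ℝ} (hξ : ξ ≠ 0) (a : ℝ) :
    X (Y Φ) (a, ξ / a) * ((|a|⁻¹ : ℝ) : ℂ) = ξ * (Φ (a, ξ / a) * ((|a|⁻¹ : ℝ) : ℂ)) := by
  rw [X_apply, Y_apply]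
  rcases eq_or_ne a 0 with rfl | ha
  · simp
  · have : (a : ℂ) ≠ 0 := by exact_mod_cast ha
    push_cast
    field_simp

lemma integrable (Φ : 𝓢₂) {ξ : ℝ} (hξ : ξ ≠ 0) :
    Integrable (fun a : ℝ => Φ (a, ξ / a) * ((|a|⁻¹ : ℝ) : ℂ)) := by
  have h := (integrableX (Y Φ) ξ).const_mul ((ξ : ℂ)⁻¹)
  have hξ' : (ξ : ℂ) ≠ 0 := by exact_mod_cast hξ
  refine h.congr (Eventually.of_forall fun a => ?_)
  simp only [XY_apply Φ hξ a]
  field_simp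

lemma push_XY (Φ : 𝓢₂) {ξ : ℝ} (hξ : ξ ≠ 0) : pushTwoR (X (Y Φ)) ξ = ξ * pushTwoR Φ ξ := by
  rw [push_eq, push_eq, ← integral_const_mul]
  exact integral_congr_ae (Eventually.of_forall fun a => XY_apply Φ hξ a)

lemma push_add (Φ Ψ : 𝓢₂) {ξ : ℝ} (hξ : ξ ≠ 0) :
    pushTwoR (Φ + Ψ) ξ = pushTwoR Φ ξ + pushTwoR Ψ ξ := by
  rw [push_eq, push_eq, push_eq, ← integral_add (integrable Φ hξ) (integrable Ψ hξ)]
  congr 1; ext a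
  simp [add_mul]

lemma push_smul (c : ℂ) (Φ : 𝓢₂) (ξ : ℝ) :
    pushTwoR (c • Φ) ξ = c * pushTwoR Φ ξ := by
  rw [push_eq, push_eq, ← integral_const_mul]
  congr 1; ext a
  simp [mul_assoc]

/-- derivative of `f_{XΨ}` -/
lemma derivX (Ψ : 𝓢₂) {ξ : ℝ} (hξ : ξ ≠ 0) :
    HasDerivAt (pushTwoR (X Ψ)) (pushTwoR (dY Ψ) ξ) ξ := by
  obtain ⟨C, hC, h⟩ := bound (Y (dY Ψ))
  have hr : 0 < |ξ| / 2 := by positivity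
  have key := hasDerivAt_integral_of_dominated_loc_of_deriv_le (μ := volume)
    (F := fun (x a : ℝ) => X Ψ (a, x / a) * ((|a|⁻¹ : ℝ) : ℂ))
    (F' := fun (x a : ℝ) => dY Ψ (a, x / a) * ((|a|⁻¹ : ℝ) : ℂ))
    (bound := fun a => (2 / |ξ|) * (C * (1 + a ^ 2)⁻¹))
    (x₀ := ξ) (Metric.ball_mem_nhds ξ hr)
    (Eventually.of_forall fun x => (meas _ _).aestronglyMeasurable)
    (integrableX Ψ ξ) (meas _ _).aestronglyMeasurable
    (Eventually.of_forall fun a x hx => ?_)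
    ((integ.const_mul C).const_mul _) ?_
  · have e : pushTwoR (X Ψ) = fun x => ∫ a : ℝ, X Ψ (a, x / a) * ((|a|⁻¹ : ℝ) : ℂ) := by
      ext x; rw [push_eq]
    rw [e, push_eq]
    exact key.2
  · rw [Metric.mem_ball, Real.dist_eq] at hx
    have hx2 : |ξ| / 2 ≤ |x| := by
      have := abs_sub_abs_le_abs_sub ξ x
      rw [abs_sub_comm] at this
      linarith
    rcases eq_or_ne a 0 with rfl | ha
    · simp; positivity
    have hb := h a (x / a)
    rw [Y_apply, norm_mul, Complex.norm_real, Real.norm_eq_abs, abs_div] at hb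
    have ha' : 0 < |a| := abs_pos.2 ha
    rw [norm_mul, Complex.norm_real, norm_inv, Real.norm_eq_abs, abs_abs]
    have hx3 : 0 < |x| := by linarith
    calc ‖dY Ψ (a, x / a)‖ * |a|⁻¹ = (1 / |x|) * (|x| / |a| * ‖dY Ψ (a, x / a)‖) := by
            field_simp
      _ ≤ (2 / |ξ|) * (C * (1 + a ^ 2)⁻¹) := by
            gcongr ?_ * ?_
            rw [div_le_div_iff₀ hx3 (abs_pos.2 hξ)]
            linarith
  · have : ∀ᵐ a : ℝ, a ≠ 0 := by simp [ae_iff]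
    filter_upwards [this] with a ha x hx
    have h1 := hasDerivAt_snd Ψ a (x / a)
    have h2 : HasDerivAt (fun t : ℝ => t / a) (1 / a) x := (hasDerivAt_id x).div_const a
    have h3 := (h1.scomp x h2)
    have h4 := (h3.const_mul (a : ℂ)).mul_const ((|a|⁻¹ : ℝ) : ℂ)
    simp only [X_apply]
    refine HasDerivAt.congr_deriv h4 ?_
    have : (a : ℂ) ≠ 0 := by exact_mod_cast ha
    rw [Complex.real_smul]
    push_cast
    field_simp

lemma push_sw (Φ : 𝓢₂) {ξ : ℝ} (hξ : ξ ≠ 0) : pushTwoR (sw Φ) ξ = pushTwoR Φ ξ := by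
  have himg : (fun b : ℝ => ξ / b) '' ({0}ᶜ : Set ℝ) = {0}ᶜ := by
    ext a
    simp only [mem_image, mem_compl_iff, mem_singleton_iff]
    constructor
    · rintro ⟨b, hb, rfl⟩
      exact div_ne_zero hξ hb
    · intro ha
      exact ⟨ξ / a, div_ne_zero hξ ha, by field_simp⟩
  have h := integral_image_eq_integral_abs_deriv_smul (s := ({0}ᶜ : Set ℝ))
    (f := fun b => ξ / b) (f' := fun b => - ξ / b ^ 2) (measurableSet_singleton 0).compl
    (fun b hb => by
      have hb' : b ≠ 0 := hb
      have := ((hasDerivAt_inv hb').const_mul ξ).hasDerivWithinAt (s := ({0}ᶜ : Set ℝ))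
      simp only [div_eq_mul_inv]
      exact HasDerivWithinAt.congr_deriv this (by ring))
    (fun b hb c hc hbc => by
      have hb' : b ≠ 0 := hb
      have hc' : c ≠ 0 := hc
      simp only at hbc
      field_simp at hbc
      exact hbc.symm)
    (fun a => Φ (a, ξ / a) * ((|a|⁻¹ : ℝ) : ℂ))
  rw [himg] at h
  rw [pushTwoR, pushTwoR, h]
  refine setIntegral_congr_fun (measurableSet_singleton 0).compl fun b hb => ?_
  have hb' : b ≠ 0 := hb
  have e : ξ / (ξ / b) = b := by field_simp
  have h1 : |ξ| ≠ 0 := abs_ne_zero.2 hξ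
  have h2 : |b| ≠ 0 := abs_ne_zero.2 hb'
  have e2 : |-ξ / b ^ 2| * |ξ / b|⁻¹ = |b|⁻¹ := by
    rw [abs_div, abs_div, abs_neg, abs_pow]; field_simp
  simp only [sw_apply, e]
  rw [← e2, Complex.real_smul]
  push_cast
  ring

/-- `P = x ∂ₓ`. -/
def P (Φ : 𝓢₂) : 𝓢₂ := X (dX Φ)

lemma derivQ (Φ : 𝓢₂) {ξ : ℝ} (hξ : ξ ≠ 0) :
    HasDerivAt (pushTwoR Φ) ((ξ : ℂ)⁻¹ * pushTwoR (Y (dY Φ)) ξ) ξ := by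
  have hξ' : (ξ : ℂ) ≠ 0 := by exact_mod_cast hξ
  have h1 := derivX (Y Φ) hξ
  rw [dY_Y, push_add _ _ hξ] at h1
  have h2 : HasDerivAt (fun x : ℝ => ((x⁻¹ : ℝ) : ℂ)) ((-(ξ ^ 2)⁻¹ : ℝ) : ℂ) ξ :=
    (hasDerivAt_inv hξ).ofReal_comp
  have h3 := h2.mul h1
  have h4 : (fun x : ℝ => ((x⁻¹ : ℝ) : ℂ) * pushTwoR (X (Y Φ)) x) =ᶠ[𝓝 ξ] pushTwoR Φ := by
    filter_upwards [isOpen_ne.mem_nhds hξ] with x hx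
    have hx' : (x : ℂ) ≠ 0 := by exact_mod_cast hx
    rw [push_XY Φ hx]
    push_cast
    field_simp
  refine (h4.hasDerivAt_iff.1 h3).congr_deriv ?_
  rw [push_XY Φ hξ]
  push_cast
  field_simp
  ring

lemma deriv_push (Φ : 𝓢₂) {ξ : ℝ} (hξ : ξ ≠ 0) :
    HasDerivAt (pushTwoR Φ) ((ξ : ℂ)⁻¹ * pushTwoR (P Φ) ξ) ξ := by
  have h1 := derivQ (sw Φ) hξ
  have h4 : pushTwoR (sw Φ) =ᶠ[𝓝 ξ] pushTwoR Φ := by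
    filter_upwards [isOpen_ne.mem_nhds hξ] with x hx
    exact push_sw Φ hx
  refine (h4.hasDerivAt_iff.1 h1).congr_deriv ?_
  have : Y (dY (sw Φ)) = sw (P Φ) := by
    ext ⟨x, y⟩
    rw [dY_sw, Y_apply, sw_apply, sw_apply, P, X_apply]
  rw [this, push_sw _ hξ]

lemma contDiffOn_push (n : ℕ) : ∀ Φ : 𝓢₂, ContDiffOn ℝ n (pushTwoR Φ) ({0}ᶜ : Set ℝ) := by
  have hcd : ∀ m : ℕ, ContDiffOn ℝ m (fun x : ℝ => (x : ℂ)⁻¹) ({0}ᶜ : Set ℝ) := by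
    intro m x hx
    have hx' : (x : ℂ) ≠ 0 := by exact_mod_cast hx
    exact (ContDiffAt.inv (Complex.ofRealCLM.contDiff.contDiffAt) hx').contDiffWithinAt
  induction n with
  | zero =>
    intro Φ
    refine contDiffOn_zero.2 fun x hx => ?_
    exact (deriv_push Φ hx).continuousAt.continuousWithinAt
  | succ n ih =>
    intro Φ
    push_cast
    rw [contDiffOn_succ_iff_deriv_of_isOpen isOpen_compl_singleton]
    refine ⟨fun x hx => (deriv_push Φ hx).differentiableAt.differentiableWithinAt, by simp, ?_⟩
    exact ((hcd n).mul (ih (P Φ))).congr fun x hx => (deriv_push Φ hx).deriv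

lemma push_norm_pow (Φ : 𝓢₂) (N : ℕ) : ∃ C : ℝ, 0 ≤ C ∧ ∀ ξ : ℝ, ξ ≠ 0 →
    |ξ| ^ (N + 1) * ‖pushTwoR Φ ξ‖ ≤ C := by
  induction N generalizing Φ with
  | zero =>
    obtain ⟨C, hC, h⟩ := normX (Y Φ)
    refine ⟨C, hC, fun ξ hξ => ?_⟩
    have := h ξ
    rw [push_XY Φ hξ, norm_mul, Complex.norm_real] at this
    simpa using this
  | succ N ih =>
    obtain ⟨C, hC, h⟩ := ih (X (Y Φ))
    refine ⟨C, hC, fun ξ hξ => ?_⟩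
    have := h ξ hξ
    rw [push_XY Φ hξ, norm_mul, Complex.norm_real, Real.norm_eq_abs] at this
    calc _ = _ := by ring
      _ ≤ C := this

lemma iter_push (k : ℕ) : ∀ Φ : 𝓢₂, ∃ Ψ : 𝓢₂, ∀ ξ : ℝ, ξ ≠ 0 →
    iteratedDeriv k (pushTwoR Φ) ξ = ((ξ : ℂ)⁻¹) ^ k * pushTwoR Ψ ξ := by
  intro Φ
  induction k with
  | zero => exact ⟨Φ, fun ξ _ => by simp⟩
  | succ k ih =>
    obtain ⟨Ψ, h⟩ := ih
    refine ⟨P Ψ + (-(k : ℂ)) • Ψ, fun ξ hξ => ?_⟩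
    have hξ' : (ξ : ℂ) ≠ 0 := by exact_mod_cast hξ
    rw [iteratedDeriv_succ]
    have h4 : iteratedDeriv k (pushTwoR Φ) =ᶠ[𝓝 ξ]
        (fun x : ℝ => ((x : ℂ)⁻¹) ^ k * pushTwoR Ψ x) := by
      filter_upwards [isOpen_ne.mem_nhds hξ] with x hx
      exact h x hx
    rw [h4.deriv_eq]
    have h2 : HasDerivAt (fun x : ℝ => (x : ℂ)⁻¹) (-((ξ : ℂ) ^ 2)⁻¹) ξ := by
      have := (hasDerivAt_inv hξ').comp_ofReal
      exact this
    have h3 := (h2.pow k).mul (deriv_push Ψ hξ)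
    rw [show (fun x : ℝ => ((x : ℂ)⁻¹) ^ k * pushTwoR Ψ x) =
      (fun x : ℝ => (x : ℂ)⁻¹) ^ k * pushTwoR Ψ from rfl, h3.deriv, push_add _ _ hξ, push_smul]
    rcases k with _ | k
    · simp
    · simp
      field_simp
      ring

lemma decay (Φ : 𝓢₂) (N k : ℕ) :
    Tendsto (fun ξ : ℝ => |ξ| ^ N * ‖iteratedDeriv k (pushTwoR Φ) ξ‖) (cocompact ℝ) (𝓝 0) := by
  obtain ⟨Ψ, h⟩ := iter_push k Φ
  obtain ⟨C, hC, hb⟩ := push_norm_pow Ψ N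
  have hlim : Tendsto (fun ξ : ℝ => C * ‖ξ‖⁻¹) (cocompact ℝ) (𝓝 0) := by
    simpa using (tendsto_inv_atTop_zero.comp (tendsto_norm_cocompact_atTop (E := ℝ))).const_mul C
  refine squeeze_zero' (Eventually.of_forall fun ξ => by positivity) ?_ hlim
  have h1 : ∀ᶠ ξ : ℝ in cocompact ℝ, 1 ≤ ‖ξ‖ :=
    (tendsto_norm_cocompact_atTop (E := ℝ)).eventually_ge_atTop 1
  filter_upwards [h1] with ξ hξ
  rw [Real.norm_eq_abs] at *
  have h0 : ξ ≠ 0 := by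
    rintro rfl; simp at hξ; linarith
  rw [h ξ h0, norm_mul, norm_pow, norm_inv, Complex.norm_real, Real.norm_eq_abs]
  have h2 : |ξ|⁻¹ ^ k ≤ 1 := pow_le_one₀ (by positivity) (inv_le_one_of_one_le₀ hξ)
  have h3 := hb ξ h0
  have hpos : 0 < |ξ| := by linarith
  calc |ξ| ^ N * (|ξ|⁻¹ ^ k * ‖pushTwoR Ψ ξ‖) ≤ |ξ| ^ N * (1 * ‖pushTwoR Ψ ξ‖) := by gcongr
    _ = (|ξ| ^ (N + 1) * ‖pushTwoR Ψ ξ‖) * |ξ|⁻¹ := by field_simp; ring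
    _ ≤ C * |ξ|⁻¹ := by gcongr


lemma ae_ne : ∀ᵐ a : ℝ, a ≠ 0 := by simp [ae_iff]

lemma tendsto_line (Φ : 𝓢₂) (l : Filter ℝ) (hl : Tendsto (fun x : ℝ => x ^ 2) l atTop) :
    Tendsto (fun a : ℝ => Φ (a, 0)) l (𝓝 0) := by
  obtain ⟨C, hC, h⟩ := bound Φ
  refine squeeze_zero_norm (fun a => h a 0) ?_
  have : Tendsto (fun x : ℝ => 1 + x ^ 2) l atTop := tendsto_atTop_add_const_left _ _ hl
  simpa using (tendsto_inv_atTop_zero.comp this).const_mul C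

lemma integrable_line (Φ : 𝓢₂) : Integrable (fun a : ℝ => Φ (a, 0)) := by
  obtain ⟨C, hC, h⟩ := bound Φ
  have hc : Continuous (fun a : ℝ => Φ (a, 0)) := Φ.continuous.comp (by fun_prop)
  exact (integ.const_mul C).mono' hc.aestronglyMeasurable (Eventually.of_forall fun a => h a 0)

lemma integral_sign (Φ : 𝓢₂) :
    ∫ a : ℝ, X (dX Φ) (a, 0) * ((|a|⁻¹ : ℝ) : ℂ) = -2 * Φ (0, 0) := by
  have hint : Integrable (fun a : ℝ => X (dX Φ) (a, 0) * ((|a|⁻¹ : ℝ) : ℂ)) := by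
    simpa using integrableX (dX Φ) 0
  rw [← intervalIntegral.integral_Iic_add_Ioi (b := 0) hint.integrableOn hint.integrableOn]
  have h1 : ∫ a in Ioi (0 : ℝ), X (dX Φ) (a, 0) * ((|a|⁻¹ : ℝ) : ℂ)
      = ∫ a in Ioi (0 : ℝ), dX Φ (a, 0) := by
    refine setIntegral_congr_fun measurableSet_Ioi fun a ha => ?_
    have ha' : 0 < a := ha
    have : (a : ℂ) ≠ 0 := by exact_mod_cast ha'.ne'
    simp only [X_apply, abs_of_pos ha']
    push_cast
    field_simp
  have h2 : ∫ a in Iic (0 : ℝ), X (dX Φ) (a, 0) * ((|a|⁻¹ : ℝ) : ℂ)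
      = ∫ a in Iic (0 : ℝ), - dX Φ (a, 0) := by
    refine setIntegral_congr_ae measurableSet_Iic ?_
    filter_upwards [ae_ne] with a ha0 ha
    have ha' : a < 0 := lt_of_le_of_ne ha ha0
    have : (a : ℂ) ≠ 0 := by exact_mod_cast ha0
    simp only [X_apply, abs_of_neg ha']
    push_cast
    field_simp
  have h3 := integral_Ioi_of_hasDerivAt_of_tendsto' (a := 0)
    (fun x _ => hasDerivAt_fst Φ x 0) (integrable_line (dX Φ)).integrableOn
    (tendsto_line Φ atTop (tendsto_pow_atTop two_ne_zero))
  have h4 := integral_Iic_of_hasDerivAt_of_tendsto' (a := 0)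
    (fun x _ => hasDerivAt_fst Φ x 0) (integrable_line (dX Φ)).integrableOn
    (tendsto_line Φ atBot (by
      have := (tendsto_pow_atTop (α := ℝ) two_ne_zero).comp tendsto_neg_atBot_atTop
      refine this.congr fun x => ?_
      simp))
  rw [h1, h2, integral_neg, h3, h4]
  ring

lemma lim_P (Φ : 𝓢₂) : Tendsto (pushTwoR (P Φ)) (𝓝 0) (𝓝 (-2 * Φ (0, 0))) := by
  rw [← integral_sign]
  obtain ⟨C, hC, h⟩ := boundX (dX Φ)
  have e : pushTwoR (P Φ) = fun x => ∫ a : ℝ, X (dX Φ) (a, x / a) * ((|a|⁻¹ : ℝ) : ℂ) := by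
    ext x; rw [push_eq]; rfl
  rw [e]
  refine tendsto_integral_filter_of_dominated_convergence (fun a => C * (1 + a ^ 2)⁻¹)
    (Eventually.of_forall fun x => (meas _ _).aestronglyMeasurable)
    (Eventually.of_forall fun x => Eventually.of_forall fun a => h a _) (integ.const_mul C)
    (Eventually.of_forall fun a => ?_)
  have hc : Continuous (fun x : ℝ => X (dX Φ) (a, x / a) * ((|a|⁻¹ : ℝ) : ℂ)) :=
    ((X (dX Φ)).continuous.comp (by fun_prop)).mul continuous_const
  simpa using hc.tendsto 0

lemma antisym (Φ : 𝓢₂) :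
    Tendsto (fun ξ => pushTwoR Φ ξ - pushTwoR Φ (-ξ)) (𝓝[≠] 0) (𝓝 0) := by
  have key : ∀ ξ : ℝ, ξ ≠ 0 → pushTwoR Φ ξ - pushTwoR Φ (-ξ) =
      ∫ a : ℝ, (Φ (a, ξ / a) - Φ (-a, ξ / a)) * ((|a|⁻¹ : ℝ) : ℂ) := by
    intro ξ hξ
    rw [push_eq, push_eq, ← integral_neg_eq_self (fun a : ℝ => Φ (a, -ξ / a) * ((|a|⁻¹ : ℝ) : ℂ)),
      ← integral_sub (integrable Φ hξ)
        ((integrable Φ (neg_ne_zero.2 hξ)).comp_neg)]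
    congr 1; ext a
    simp only [neg_div_neg_eq, abs_neg]
    ring
  have hz : ∫ a : ℝ, (Φ (a, 0) - Φ (-a, 0)) * ((|a|⁻¹ : ℝ) : ℂ) = 0 := by
    have h1 := integral_neg_eq_self (fun a : ℝ => (Φ (a, 0) - Φ (-a, 0)) * ((|a|⁻¹ : ℝ) : ℂ)) volume
    have h2 : (fun a : ℝ => (Φ (-a, 0) - Φ (- -a, 0)) * ((|-a|⁻¹ : ℝ) : ℂ)) =
      fun a : ℝ => -((Φ (a, 0) - Φ (-a, 0)) * ((|a|⁻¹ : ℝ) : ℂ)) := by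
      ext a; simp only [neg_neg, abs_neg]; ring
    rw [h2, integral_neg] at h1
    exact self_eq_neg.1 h1.symm
  obtain ⟨C, hC, h⟩ := bound Φ
  obtain ⟨D, hD, h'⟩ := bound (dX Φ)
  have hbd : ∀ a y : ℝ, ‖(Φ (a, y) - Φ (-a, y)) * ((|a|⁻¹ : ℝ) : ℂ)‖ ≤
      (4 * D + 2 * C) * (1 + a ^ 2)⁻¹ := by
    intro a y
    rcases eq_or_ne a 0 with rfl | ha
    · simp; positivity
    have ha' : 0 < |a| := abs_pos.2 ha
    rw [norm_mul, Complex.norm_real, norm_inv, Real.norm_eq_abs, abs_abs]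
    rcases le_total |a| 1 with h1 | h1
    · have h2 : ‖Φ (a, y) - Φ (-a, y)‖ ≤ D * ‖a - -a‖ := by
        refine convex_univ.norm_image_sub_le_of_norm_hasDerivWithin_le
          (f := fun t : ℝ => Φ (t, y)) (f' := fun t => dX Φ (t, y))
          (fun x _ => (hasDerivAt_fst Φ x y).hasDerivWithinAt) (fun x _ => ?_) (mem_univ _) (mem_univ _)
        refine (h' x y).trans ?_
        have : (1 + x ^ 2)⁻¹ ≤ 1 := inv_le_one_of_one_le₀ (by nlinarith [sq_nonneg x])
        nlinarith
      have h3 : ‖a - -a‖ = 2 * |a| := by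
        rw [sub_neg_eq_add, ← two_mul, norm_mul]; simp
      rw [h3] at h2
      have h4 : a ^ 2 ≤ 1 := by rw [← sq_abs]; nlinarith
      have h5 : (1 / 2 : ℝ) ≤ (1 + a ^ 2)⁻¹ := by
        rw [one_div]; apply inv_anti₀ (by positivity); linarith
      calc ‖Φ (a, y) - Φ (-a, y)‖ * |a|⁻¹ ≤ (D * (2 * |a|)) * |a|⁻¹ := by gcongr
        _ = 4 * D * (1 / 2) := by field_simp; ring
        _ ≤ (4 * D + 2 * C) * (1 + a ^ 2)⁻¹ := by gcongr; linarith
    · have h2 : ‖Φ (a, y) - Φ (-a, y)‖ ≤ 2 * C * (1 + a ^ 2)⁻¹ := by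
        have e1 := h a y
        have e2 := h (-a) y
        rw [neg_sq] at e2
        linarith [norm_sub_le (Φ (a, y)) (Φ (-a, y))]
      calc ‖Φ (a, y) - Φ (-a, y)‖ * |a|⁻¹ ≤ (2 * C * (1 + a ^ 2)⁻¹) * 1 := by
            gcongr
            exact inv_le_one_of_one_le₀ h1
        _ = (0 + 2 * C) * (1 + a ^ 2)⁻¹ := by ring
        _ ≤ (4 * D + 2 * C) * (1 + a ^ 2)⁻¹ := by gcongr; positivity
  have hc : ∀ x : ℝ, Measurable (fun a : ℝ => (Φ (a, x / a) - Φ (-a, x / a)) * ((|a|⁻¹ : ℝ) : ℂ)) := by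
    intro x
    have h4 : Measurable (fun a : ℝ => ((|a|⁻¹ : ℝ) : ℂ)) :=
      Complex.measurable_ofReal.comp (continuous_abs.measurable).inv
    refine Measurable.mul (Measurable.sub ?_ ?_) h4
    · exact Φ.continuous.measurable.comp (by fun_prop : Measurable fun a : ℝ => (a, x / a))
    · exact Φ.continuous.measurable.comp (by fun_prop : Measurable fun a : ℝ => (-a, x / a))
  have hl : Tendsto (fun ξ : ℝ => ∫ a : ℝ, (Φ (a, ξ / a) - Φ (-a, ξ / a)) * ((|a|⁻¹ : ℝ) : ℂ))
      (𝓝 0) (𝓝 0) := by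
    rw [← hz]
    refine tendsto_integral_filter_of_dominated_convergence
      (fun a => (4 * D + 2 * C) * (1 + a ^ 2)⁻¹)
      (Eventually.of_forall fun x => (hc x).aestronglyMeasurable)
      (Eventually.of_forall fun x => Eventually.of_forall fun a => hbd a _) (integ.const_mul _)
      (Eventually.of_forall fun a => ?_)
    have hc : Continuous (fun x : ℝ => (Φ (a, x / a) - Φ (-a, x / a)) * ((|a|⁻¹ : ℝ) : ℂ)) :=
      ((Φ.continuous.comp (by fun_prop)).sub (Φ.continuous.comp (by fun_prop))).mul continuous_const
    simpa using hc.tendsto 0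
  refine (hl.mono_left nhdsWithin_le_nhds).congr' ?_
  filter_upwards [self_mem_nhdsWithin] with ξ hξ
  exact (key ξ hξ).symm

lemma hasDerivAt_mul_exp (σ s : ℝ) : HasDerivAt (fun s => σ * Real.exp s) (σ * Real.exp s) s :=
  (Real.hasDerivAt_exp s).const_mul σ

lemma log_growth (Φ : 𝓢₂) {σ : ℝ} (hσ : σ ≠ 0) : ∃ A B : ℝ, 0 ≤ A ∧ 0 ≤ B ∧ ∀ s : ℝ,
    ‖pushTwoR Φ (σ * Real.exp s)‖ ≤ A + B * |s| := by
  obtain ⟨B, hB, hb⟩ := normX (dX Φ)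
  refine ⟨‖pushTwoR Φ σ‖, B, norm_nonneg _, hB, fun s => ?_⟩
  have hd : ∀ s : ℝ, HasDerivAt (fun s => pushTwoR Φ (σ * Real.exp s))
      (pushTwoR (P Φ) (σ * Real.exp s)) s := by
    intro s
    have hne : σ * Real.exp s ≠ 0 := mul_ne_zero hσ (Real.exp_ne_zero s)
    have h1 := (deriv_push Φ hne).scomp s (hasDerivAt_mul_exp σ s)
    refine h1.congr_deriv ?_
    have : ((σ * Real.exp s : ℝ) : ℂ) ≠ 0 := by exact_mod_cast hne
    rw [Complex.real_smul]
    field_simp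
  have h2 := convex_univ.norm_image_sub_le_of_norm_hasDerivWithin_le
    (fun x _ => (hd x).hasDerivWithinAt) (fun x _ => hb _) (mem_univ 0) (mem_univ s)
  simp only [Real.exp_zero, mul_one, sub_zero, Real.norm_eq_abs] at h2
  have := norm_le_norm_add_norm_sub' (pushTwoR Φ (σ * Real.exp s)) (pushTwoR Φ σ)
  linarith

lemma exp_lim (F F' : ℝ → ℂ) (K : ℝ) (hd : ∀ s ≤ 0, HasDerivAt F (F' s) s)
    (hb : ∀ s ≤ 0, ‖F' s‖ ≤ K * Real.exp (1 / 2 * s)) :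
    ∃ L, Tendsto F atBot (𝓝 L) ∧ ∀ s ≤ 0, ‖F s - L‖ ≤ (2 * K) * Real.exp (1 / 2 * s) := by
  have hexp : ∀ c : ℝ, IntegrableOn (fun s : ℝ => K * Real.exp (1 / 2 * s)) (Iic c) := fun c =>
    (integrableOn_exp_mul_Iic (by norm_num) c).const_mul K
  have hm : AEStronglyMeasurable F' (volume.restrict (Iic 0)) := by
    refine (aestronglyMeasurable_deriv F _).congr ?_
    refine (ae_restrict_iff' measurableSet_Iic).2 (Eventually.of_forall fun s hs => ?_)
    exact (hd s hs).deriv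
  have hi : IntegrableOn F' (Iic 0) := by
    refine (hexp 0).mono' hm ?_
    exact (ae_restrict_iff' measurableSet_Iic).2 (Eventually.of_forall fun s hs => hb s hs)
  have hL := tendsto_limUnder_of_hasDerivAt_of_integrableOn_Iic (a := 0) (fun x hx => hd x hx) hi
  refine ⟨_, hL, fun s hs => ?_⟩
  have hi' := hi.mono_set (Iic_subset_Iic.2 hs)
  rw [← integral_Iic_of_hasDerivAt_of_tendsto' (a := s) (fun x hx => hd x (le_trans hx hs)) hi' hL]
  calc _ ≤ ∫ t in Iic s, K * Real.exp (1 / 2 * t) := by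
        refine norm_integral_le_of_norm_le (hexp s) ?_
        exact (ae_restrict_iff' measurableSet_Iic).2
          (Eventually.of_forall fun t ht => hb t (le_trans ht hs))
    _ = _ := by
        rw [integral_const_mul, integral_exp_mul_Iic (by norm_num)]; ring


lemma iter_pow (a : ℂ) (j k : ℕ) : iteratedDeriv k (fun t : ℝ => a * (t : ℂ) ^ j) =
    fun t : ℝ => a * ((j.descFactorial k : ℂ) * (t : ℂ) ^ (j - k)) := by
  induction k with
  | zero => simp
  | succ k ih =>
    rw [iteratedDeriv_succ, ih]
    funext t
    have h1 : HasDerivAt (fun t : ℝ => (t : ℂ)) 1 t := Complex.ofRealCLM.hasDerivAt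
    have := (((h1.pow (j - k)).const_mul (j.descFactorial k : ℂ)).const_mul a).deriv
    refine Eq.trans this ?_
    rw [Nat.descFactorial_succ]
    push_cast
    rw [show j - (k + 1) = j - k - 1 by omega]
    ring

lemma iter_pow_zero (a : ℂ) (j k : ℕ) : iteratedDeriv k (fun t : ℝ => a * (t : ℂ) ^ j) 0 =
    if k = j then a * (j.factorial : ℂ) else 0 := by
  rw [iter_pow]
  rcases lt_trichotomy k j with h | h | h
  · have : j - k ≠ 0 := by omega
    simp [this, h.ne]
  · subst h; simp [Nat.descFactorial_self]
  · simp [h.ne', Nat.descFactorial_of_lt h]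

lemma borel (c : ℕ → ℂ) : ∃ C : ℝ → ℂ, ContDiff ℝ (⊤ : ℕ∞) C ∧ ∀ k, iteratedDeriv k C 0 = c k := by
  let χ : ContDiffBump (0 : ℝ) := ⟨1, 2, by norm_num, by norm_num⟩
  let h : ℕ → ℝ → ℂ := fun j t => ((χ t : ℝ) : ℂ) * ((c j / (j.factorial : ℂ)) * (t : ℂ) ^ j)
  have hs : ∀ j, ContDiff ℝ (⊤ : ℕ∞) (h j) := fun j =>
    (Complex.ofRealCLM.contDiff.comp χ.contDiff).mul
      (contDiff_const.mul (Complex.ofRealCLM.contDiff.pow j))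
  have hc : ∀ j, HasCompactSupport (h j) := fun j => by
    refine HasCompactSupport.mul_right ?_
    exact χ.hasCompactSupport.comp_left (g := fun x : ℝ => (x : ℂ)) (by simp)
  have hB : ∀ j k, ∃ B : ℝ, 0 ≤ B ∧ ∀ x, ‖iteratedFDeriv ℝ k (h j) x‖ ≤ B := fun j k => by
    obtain ⟨B, hB⟩ := ((hc j).iteratedFDeriv (𝕜 := ℝ) k).exists_bound_of_continuous
      ((hs j).continuous_iteratedFDeriv (m := k) (by exact_mod_cast le_top))
    exact ⟨B, (norm_nonneg _).trans (hB 0), hB⟩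
  choose B hB0 hB using hB
  let M : ℕ → ℝ := fun j => 1 + 2 ^ j * ∑ k ∈ Finset.range j, B j k
  have hM1 : ∀ j, 1 ≤ M j := fun j => by
    have : 0 ≤ ∑ k ∈ Finset.range j, B j k := Finset.sum_nonneg fun k _ => hB0 j k
    have : 0 ≤ 2 ^ j * ∑ k ∈ Finset.range j, B j k := by positivity
    simp only [M]; linarith
  have hM : ∀ j k, k < j → 2 ^ j * B j k ≤ M j := fun j k hk => by
    have : B j k ≤ ∑ k ∈ Finset.range j, B j k :=
      Finset.single_le_sum (fun k _ => hB0 j k) (Finset.mem_range.2 hk)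
    have : 2 ^ j * B j k ≤ 2 ^ j * ∑ k ∈ Finset.range j, B j k := by gcongr
    simp only [M]; linarith
  let f : ℕ → ℝ → ℂ := fun j x => ((M j)⁻¹ ^ j) • h j (M j * x)
  have hf : ∀ j, ContDiff ℝ (⊤ : ℕ∞) (f j) := fun j =>
    ((hs j).comp (contDiff_const.mul contDiff_id)).const_smul _
  have hfd : ∀ j k x, iteratedDeriv k (f j) x =
      ((M j)⁻¹ ^ j * M j ^ k) • iteratedDeriv k (h j) (M j * x) := fun j k x => by
    have hs' : ContDiff ℝ k (fun x => h j (M j * x)) :=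
      ((hs j).comp (contDiff_const.mul contDiff_id)).of_le (by exact_mod_cast le_top)
    have e1 : iteratedDeriv k (f j) x =
      ((M j)⁻¹ ^ j) • iteratedDeriv k (fun x => h j (M j * x)) x :=
      iteratedDeriv_const_smul hs'.contDiffAt ((M j)⁻¹ ^ j)
    have e2 := congrFun (iteratedDeriv_comp_const_smul
      ((hs j).of_le (by exact_mod_cast le_top) : ContDiff ℝ k (h j)) (M j)) x
    rw [e1, mul_smul]
    congr 1
  let v : ℕ → ℕ → ℝ := fun k j => if k < j then (1 / 2) ^ j else (M j)⁻¹ ^ j * M j ^ k * B j k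
  have hv : ∀ k : ℕ, (k : ℕ∞) ≤ (⊤ : ℕ∞) → Summable (v k) := fun k _ => by
    have h2 : Summable (fun j : ℕ => (1 / 2 : ℝ) ^ j) := summable_geometric_two
    refine h2.congr_cofinite ?_
    rw [Nat.cofinite_eq_atTop]
    filter_upwards [eventually_gt_atTop k] with j hj
    simp [v, hj]
  have hb : ∀ (k j : ℕ) (x : ℝ), (k : ℕ∞) ≤ (⊤ : ℕ∞) → ‖iteratedFDeriv ℝ k (f j) x‖ ≤ v k j := by
    intro k j x _
    have hMp : 0 < M j := by linarith [hM1 j]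
    have h1 : ‖iteratedFDeriv ℝ k (f j) x‖ ≤ (M j)⁻¹ ^ j * M j ^ k * B j k := by
      rw [norm_iteratedFDeriv_eq_norm_iteratedDeriv, hfd, norm_smul,
        ← norm_iteratedFDeriv_eq_norm_iteratedDeriv, Real.norm_of_nonneg (by positivity)]
      gcongr
      exact hB _ _ _
    by_cases hk : k < j
    · simp only [v, hk, if_true]
      refine h1.trans ?_
      have h3 : (M j)⁻¹ ^ j * M j ^ k ≤ (M j)⁻¹ := by
        obtain ⟨d, rfl⟩ : ∃ d, j = k + 1 + d := ⟨j - (k + 1), by omega⟩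
        rw [pow_add, pow_add, pow_one]
        have : (M (k + 1 + d))⁻¹ ^ k * M (k + 1 + d) ^ k = 1 := by
          rw [← mul_pow, inv_mul_cancel₀ hMp.ne', one_pow]
        have h4 : (M (k + 1 + d))⁻¹ ^ d ≤ 1 :=
          pow_le_one₀ (by positivity) (inv_le_one_of_one_le₀ (hM1 _))
        calc _ = ((M (k + 1 + d))⁻¹ ^ k * M (k + 1 + d) ^ k) * (M (k + 1 + d))⁻¹ *
              (M (k + 1 + d))⁻¹ ^ d := by ring
          _ ≤ 1 * (M (k + 1 + d))⁻¹ * 1 := by rw [this]; gcongr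
          _ = _ := by ring
      calc _ ≤ (M j)⁻¹ * B j k := by gcongr; exact hB0 _ _
        _ = (M j)⁻¹ * (2 ^ j * B j k) * (1 / 2) ^ j := by
          rw [one_div, inv_pow]; field_simp
        _ ≤ (M j)⁻¹ * M j * (1 / 2) ^ j := by gcongr; exact hM j k hk
        _ = _ := by rw [inv_mul_cancel₀ hMp.ne', one_mul]
    · simpa only [v, hk, if_false] using h1
  refine ⟨fun x => ∑' j, f j x, contDiff_tsum hf hv hb, fun k => ?_⟩
  have h0 : ∀ j, iteratedDeriv k (f j) 0 = if j = k then c k else 0 := fun j => by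
    have hMp : 0 < M j := by linarith [hM1 j]
    rw [hfd, mul_zero]
    have he : h j =ᶠ[𝓝 0] fun t : ℝ => (c j / (j.factorial : ℂ)) * (t : ℂ) ^ j := by
      filter_upwards [χ.eventuallyEq_one] with t ht
      simp [h, ht]
    rw [he.iteratedDeriv_eq, iter_pow_zero]
    by_cases hk : k = j
    · subst hk
      have : (k.factorial : ℂ) ≠ 0 := by exact_mod_cast k.factorial_ne_zero
      simp only [if_true]
      rw [div_mul_cancel₀ _ this, ← mul_pow, inv_mul_cancel₀ hMp.ne', one_pow, one_smul]
    · simp [hk, Ne.symm hk]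
  rw [iteratedDeriv_eq_iteratedFDeriv, iteratedFDeriv_tsum_apply hf hv hb le_top]
  have hsum : Summable fun j => iteratedFDeriv ℝ k (f j) 0 :=
    Summable.of_norm_bounded (hv k le_top) (fun j => hb k j 0 le_top)
  rw [ContinuousMultilinearMap.tsum_eval hsum]
  have : ∀ j, (iteratedFDeriv ℝ k (f j) 0) (fun _ => 1) = if j = k then c k else 0 := h0
  simp_rw [this]
  exact tsum_ite_eq k _

lemma iter_mul_id (h : ℝ → ℂ) (hh : ContDiff ℝ (⊤ : ℕ∞) h) (k : ℕ) :
    iteratedDeriv (k + 1) (fun x : ℝ => (x : ℂ) * h x) =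
      fun x : ℝ => (x : ℂ) * iteratedDeriv (k + 1) h x + ((k : ℂ) + 1) * iteratedDeriv k h x := by
  have h1 : ∀ t : ℝ, HasDerivAt (fun t : ℝ => (t : ℂ)) 1 t :=
    fun t => Complex.ofRealCLM.hasDerivAt
  have hd : ∀ k t, HasDerivAt (iteratedDeriv k h) (iteratedDeriv (k + 1) h t) t := fun k t => by
    rw [iteratedDeriv_succ]
    exact (hh.differentiable_iteratedDeriv k (by exact_mod_cast ENat.natCast_lt_top k) t).hasDerivAt
  induction k with
  | zero =>
    funext t
    have hd0 := hd 0 t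
    rw [iteratedDeriv_zero] at hd0
    rw [iteratedDeriv_one, iteratedDeriv_zero]
    refine ((h1 t).mul hd0).deriv.trans ?_
    simp; ring
  | succ k ih =>
    rw [iteratedDeriv_succ, ih]
    funext t
    refine (((h1 t).mul (hd (k + 1) t)).add ((hd k t).const_mul ((k : ℂ) + 1))).deriv.trans ?_
    push_cast; ring

def avg (k : ℕ) (g : ℝ → ℂ) (ξ : ℝ) : ℂ := ∫ t in (0:ℝ)..1, (t : ℂ) ^ k * g (t * ξ)

lemma avg_deriv (k : ℕ) (g : ℝ → ℂ) (hg : ContDiff ℝ 1 g) (ξ : ℝ) :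
    HasDerivAt (avg k g) (avg (k + 1) (deriv g) ξ) ξ := by
  have hg' : Continuous (deriv g) := hg.continuous_deriv le_rfl
  have hgc := hg.continuous
  obtain ⟨K, hK⟩ := (isCompact_closedBall (0:ℝ) (|ξ| + 1)).exists_bound_of_continuousOn
    hg'.continuousOn
  refine (intervalIntegral.hasDerivAt_integral_of_dominated_loc_of_deriv_le (𝕜 := ℝ)
    (F := fun ξ t => (t : ℂ) ^ k * g (t * ξ)) (s := Metric.ball ξ 1)
    (F' := fun ξ t => (t : ℂ) ^ (k + 1) * deriv g (t * ξ)) (bound := fun _ => K)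
    (Metric.ball_mem_nhds ξ one_pos) ?_ ?_ ?_ ?_ ?_ ?_).2
  · exact Eventually.of_forall fun x => (by fun_prop : Continuous fun t : ℝ =>
      (t : ℂ) ^ k * g (t * x)).aestronglyMeasurable
  · exact (by fun_prop : Continuous fun t : ℝ => (t : ℂ) ^ k * g (t * ξ)).intervalIntegrable _ _
  · exact (by fun_prop : Continuous fun t : ℝ =>
      (t : ℂ) ^ (k + 1) * deriv g (t * ξ)).aestronglyMeasurable
  · refine Eventually.of_forall fun t ht x hx => ?_
    rw [uIoc_of_le zero_le_one] at ht
    rw [Metric.mem_ball, Real.dist_eq] at hx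
    have h1 : ‖deriv g (t * x)‖ ≤ K := by
      refine hK _ ?_
      rw [mem_closedBall_zero_iff, norm_mul, Real.norm_eq_abs, Real.norm_eq_abs,
        abs_of_pos ht.1]
      have : |x| ≤ |ξ| + 1 := by
        have := abs_sub_abs_le_abs_sub x ξ
        linarith
      calc t * |x| ≤ 1 * |x| := by gcongr; exact ht.2
        _ ≤ _ := by linarith
    rw [norm_mul, norm_pow, Complex.norm_real, Real.norm_of_nonneg ht.1.le]
    calc _ ≤ 1 * ‖deriv g (t * x)‖ := by gcongr; exact pow_le_one₀ ht.1.le ht.2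
      _ ≤ K := by linarith
  · exact intervalIntegrable_const
  · refine Eventually.of_forall fun t _ x _ => ?_
    have h2 : HasDerivAt g (deriv g (t * x)) (t * x) :=
      (hg.differentiable (by norm_num) _).hasDerivAt
    have h3 : HasDerivAt (fun x : ℝ => t * x) (t * 1) x := (hasDerivAt_id x).const_mul t
    have h4 := (h2.scomp x h3).const_mul ((t : ℂ) ^ k)
    have h5 : (t : ℂ) ^ (k + 1) * deriv g (t * x) = (t : ℂ) ^ k * ((t * 1) • deriv g (t * x)) := by
      rw [mul_one, Complex.real_smul]; ring
    rw [h5]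
    exact h4

lemma avg_smooth (n : ℕ) : ∀ (k : ℕ) (g : ℝ → ℂ), ContDiff ℝ n g → ContDiff ℝ n (avg k g) := by
  induction n with
  | zero =>
    intro k g hg
    have hg := hg.continuous
    refine contDiff_zero.2 ?_
    exact intervalIntegral.continuous_parametric_intervalIntegral_of_continuous' (by fun_prop) _ _
  | succ n ih =>
    intro k g hg
    have h1 : ContDiff ℝ 1 g := hg.of_le (by exact_mod_cast Nat.le_add_left 1 n)
    have hd := avg_deriv k g h1
    have hg' : ContDiff ℝ ((n : WithTop ℕ∞) + 1) g := by exact_mod_cast hg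
    have : ContDiff ℝ ((n : WithTop ℕ∞) + 1) (avg k g) := by
      rw [contDiff_succ_iff_deriv]
      refine ⟨fun x => (hd x).differentiableAt, by simp, ?_⟩
      rw [show deriv (avg k g) = avg (k + 1) (deriv g) from funext fun x => (hd x).deriv]
      exact ih _ _ ((contDiff_succ_iff_deriv.1 hg').2.2)
    exact_mod_cast this

lemma eq_mul_avg (g w : ℝ → ℂ) (hg : Continuous g) (hw : ∀ x, HasDerivAt w (g x) x)
    (h0 : w 0 = 0) (ξ : ℝ) : w ξ = (ξ : ℂ) * avg 0 g ξ := by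
  have h1 : ∫ t in (0:ℝ)..ξ, g t = w ξ - w 0 :=
    intervalIntegral.integral_eq_sub_of_hasDerivAt (fun x _ => hw x) (hg.intervalIntegrable _ _)
  have h2 := intervalIntegral.smul_integral_comp_mul_right (a := 0) (b := 1) g ξ
  rw [zero_mul, one_mul, h1, h0, sub_zero] at h2
  rw [← h2, Complex.real_smul]
  simp only [avg, pow_zero, one_mul]


def lg (x : ℝ) : ℂ := ((Real.log x : ℝ) : ℂ)

lemma lg_deriv {x : ℝ} (hx : x ≠ 0) : HasDerivAt lg ((x : ℂ)⁻¹) x := by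
  have := (Real.hasDerivAt_log hx).ofReal_comp
  rwa [Complex.ofReal_inv] at this

lemma lg_exp {σ : ℝ} (hσ : σ = 1 ∨ σ = -1) (s : ℝ) : lg (σ * Real.exp s) = (s : ℂ) := by
  rcases hσ with rfl | rfl <;> simp [lg]

lemma mul_lg : Tendsto (fun x : ℝ => (x : ℂ) * lg x) (𝓝 0) (𝓝 0) := by
  have h := (Complex.continuous_ofReal.comp Real.continuous_mul_log).tendsto 0
  simpa [lg, Function.comp_def] using h

def uu (Φ : 𝓢₂) (C : ℝ → ℂ) (x : ℝ) : ℂ := pushTwoR Φ x - C x * lg x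
def ww (Φ : 𝓢₂) (C : ℝ → ℂ) (x : ℝ) : ℂ :=
  pushTwoR (P Φ) x - (x : ℂ) * deriv C x * lg x - C x
def EE (C : ℝ → ℂ) (x : ℝ) : ℂ := deriv C x + (x : ℂ) * deriv (deriv C) x
def gg (Φ : 𝓢₂) (C : ℝ → ℂ) (x : ℝ) : ℂ :=
  pushTwoR (dY (dX Φ)) x - EE C x * lg x - 2 * deriv C x

lemma smooth_deriv {C : ℝ → ℂ} (hC : ContDiff ℝ (⊤ : ℕ∞) C) : ContDiff ℝ (⊤ : ℕ∞) (deriv C) :=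
  (contDiff_infty_iff_deriv.1 hC).2

lemma smooth_EE {C : ℝ → ℂ} (hC : ContDiff ℝ (⊤ : ℕ∞) C) : ContDiff ℝ (⊤ : ℕ∞) (EE C) :=
  (smooth_deriv hC).add (Complex.ofRealCLM.contDiff.mul (smooth_deriv (smooth_deriv hC)))

lemma smooth_has {C : ℝ → ℂ} (hC : ContDiff ℝ (⊤ : ℕ∞) C) (x : ℝ) :
    HasDerivAt C (deriv C x) x :=
  ((contDiff_infty_iff_deriv.1 hC).1 x).hasDerivAt

lemma of_real_deriv (x : ℝ) : HasDerivAt (fun t : ℝ => (t : ℂ)) 1 x :=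
  Complex.ofRealCLM.hasDerivAt

lemma uu_deriv (Φ : 𝓢₂) {C : ℝ → ℂ} (hC : ContDiff ℝ (⊤ : ℕ∞) C) {x : ℝ} (hx : x ≠ 0) :
    HasDerivAt (uu Φ C) ((x : ℂ)⁻¹ * ww Φ C x) x := by
  have hx' : (x : ℂ) ≠ 0 := by exact_mod_cast hx
  have h := (deriv_push Φ hx).sub ((smooth_has hC x).mul (lg_deriv hx))
  have e : (x : ℂ)⁻¹ * ww Φ C x = (x : ℂ)⁻¹ * pushTwoR (P Φ) x
      - (deriv C x * lg x + C x * (x : ℂ)⁻¹) := by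
    unfold ww; field_simp; ring
  rw [e]; exact h

lemma ww_deriv (Φ : 𝓢₂) {C : ℝ → ℂ} (hC : ContDiff ℝ (⊤ : ℕ∞) C) {x : ℝ} (hx : x ≠ 0) :
    HasDerivAt (ww Φ C) (gg Φ C x) x := by
  have hx' : (x : ℂ) ≠ 0 := by exact_mod_cast hx
  have h := ((derivX (dX Φ) hx).sub (((of_real_deriv x).mul
    (smooth_has (smooth_deriv hC) x)).mul (lg_deriv hx))).sub (smooth_has hC x)
  have e : gg Φ C x = pushTwoR (dY (dX Φ)) x - ((1 * deriv C x + x * deriv (deriv C) x) * lg x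
      + (x * deriv C x) * (x : ℂ)⁻¹) - deriv C x := by
    unfold gg EE; field_simp; ring
  rw [e]; exact h

lemma ww_lim (Φ : 𝓢₂) {C : ℝ → ℂ} (hC : ContDiff ℝ (⊤ : ℕ∞) C) (h0 : C 0 = -2 * Φ (0, 0)) :
    Tendsto (ww Φ C) (𝓝 0) (𝓝 0) := by
  have h1 := ((smooth_deriv hC).continuous.tendsto 0).mul mul_lg
  have h := ((lim_P Φ).sub h1).sub (hC.continuous.tendsto 0)
  rw [h0, mul_zero, sub_zero, sub_self] at h
  refine h.congr fun x => ?_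
  unfold ww; ring

lemma half_line (Φ : 𝓢₂) {C : ℝ → ℂ} (hC : ContDiff ℝ (⊤ : ℕ∞) C) (h0 : C 0 = -2 * Φ (0, 0))
    {σ : ℝ} (hσ : σ = 1 ∨ σ = -1) :
    ∃ L, Tendsto (fun s : ℝ => uu Φ C (σ * Real.exp s)) atBot (𝓝 L) := by
  have hσ0 : σ ≠ 0 := by rcases hσ with rfl | rfl <;> norm_num
  have hσ1 : |σ| = 1 := by rcases hσ with rfl | rfl <;> norm_num
  have hne : ∀ s : ℝ, σ * Real.exp s ≠ 0 := fun s => mul_ne_zero hσ0 (Real.exp_pos s).ne'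
  obtain ⟨A, B, hA, hB, hAB⟩ := log_growth (dY (dX Φ)) hσ0
  obtain ⟨K1, hK1⟩ := (isCompact_closedBall (0:ℝ) 1).exists_bound_of_continuousOn
    (smooth_EE hC).continuous.continuousOn
  obtain ⟨K2, hK2⟩ := (isCompact_closedBall (0:ℝ) 1).exists_bound_of_continuousOn
    (smooth_deriv hC).continuous.continuousOn
  have hK1p : 0 ≤ K1 := (norm_nonneg _).trans (hK1 0 (by simp))
  have hK2p : 0 ≤ K2 := (norm_nonneg _).trans (hK2 0 (by simp))
  have hball : ∀ s ≤ (0:ℝ), σ * Real.exp s ∈ Metric.closedBall (0:ℝ) 1 := fun s hs => by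
    rw [mem_closedBall_zero_iff, norm_mul, Real.norm_eq_abs, hσ1, one_mul,
      Real.norm_of_nonneg (Real.exp_pos s).le]
    exact Real.exp_le_one_iff.2 hs
  have hg : ∀ s ≤ (0:ℝ), ‖gg Φ C (σ * Real.exp s)‖ ≤ (A + 2 * K2) + (B + K1) * |s| := by
    intro s hs
    unfold gg
    rw [lg_exp hσ]
    calc _ ≤ ‖pushTwoR (dY (dX Φ)) (σ * Real.exp s)‖ + ‖EE C (σ * Real.exp s) * (s : ℂ)‖
          + ‖2 * deriv C (σ * Real.exp s)‖ :=
          (norm_sub_le _ _).trans (by gcongr; exact norm_sub_le _ _)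
      _ ≤ (A + B * |s|) + K1 * |s| + 2 * K2 := by
        rw [norm_mul, norm_mul, Complex.norm_real, Real.norm_eq_abs]
        gcongr
        · exact hAB s
        · exact hK1 _ (hball s hs)
        · simp
        · exact hK2 _ (hball s hs)
      _ = _ := by ring
  set K := (A + 2 * K2) + 2 * (B + K1) with hK
  have hVd : ∀ s : ℝ, HasDerivAt (fun s : ℝ => ww Φ C (σ * Real.exp s))
      ((σ * Real.exp s) • gg Φ C (σ * Real.exp s)) s := fun s => by
    have h := (ww_deriv Φ hC (hne s)).scomp s (hasDerivAt_mul_exp σ s)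
    exact h
  have hVb : ∀ s ≤ (0:ℝ), ‖(σ * Real.exp s) • gg Φ C (σ * Real.exp s)‖
      ≤ K * Real.exp (1 / 2 * s) := by
    intro s hs
    rw [norm_smul, norm_mul, Real.norm_eq_abs, hσ1, one_mul,
      Real.norm_of_nonneg (Real.exp_pos s).le]
    set e := Real.exp (1 / 2 * s) with he
    have he0 : 0 < e := Real.exp_pos _
    have he1 : e ≤ 1 := Real.exp_le_one_iff.2 (by linarith)
    have hee : Real.exp s = e * e := by rw [he, ← Real.exp_add]; congr 1; ring
    have hes : e * |s| ≤ 2 := by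
      rw [abs_of_nonpos hs]
      have h1 := Real.add_one_le_exp (-(1 / 2 * s))
      rw [Real.exp_neg, ← he] at h1
      have h2 : e * (-(1 / 2 * s) + 1) ≤ 1 := by
        calc _ ≤ e * e⁻¹ := by gcongr
          _ = 1 := mul_inv_cancel₀ he0.ne'
      nlinarith
    calc _ ≤ e * e * ((A + 2 * K2) + (B + K1) * |s|) := by
          rw [← hee]; gcongr; exact hg s hs
      _ = (e * (A + 2 * K2) + (B + K1) * (e * |s|)) * e := by ring
      _ ≤ (1 * (A + 2 * K2) + (B + K1) * 2) * e := by gcongr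
      _ = K * e := by rw [hK]; ring
  obtain ⟨L0, hL0, hL0b⟩ := exp_lim _ _ K (fun s _ => hVd s) hVb
  have hto : Tendsto (fun s : ℝ => σ * Real.exp s) atBot (𝓝 0) := by
    simpa using Real.tendsto_exp_atBot.const_mul σ
  have hz : L0 = 0 := tendsto_nhds_unique hL0 ((ww_lim Φ hC h0).comp hto)
  subst hz
  obtain ⟨L, hL, -⟩ := exp_lim (fun s : ℝ => uu Φ C (σ * Real.exp s))
    (fun s : ℝ => ww Φ C (σ * Real.exp s)) (2 * K) (fun s _ => by
      have h := (uu_deriv Φ hC (hne s)).scomp s (hasDerivAt_mul_exp σ s)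
      have hn : ((σ * Real.exp s : ℝ) : ℂ) ≠ 0 := by exact_mod_cast hne s
      have e : ww Φ C (σ * Real.exp s) = (σ * Real.exp s) •
          ((((σ * Real.exp s : ℝ) : ℂ))⁻¹ * ww Φ C (σ * Real.exp s)) := by
        rw [Complex.real_smul, mul_inv_cancel_left₀ hn]
      rw [e]; exact h) (fun s hs => by simpa using hL0b s hs)
  exact ⟨L, hL⟩

lemma base (Φ : 𝓢₂) {C : ℝ → ℂ} (hC : ContDiff ℝ (⊤ : ℕ∞) C) (h0 : C 0 = -2 * Φ (0, 0)) :
    ∃ R : ℝ → ℂ, Continuous R ∧ ∀ x ≠ 0, R x = uu Φ C x := by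
  obtain ⟨L, hL⟩ := half_line Φ hC h0 (Or.inl rfl)
  obtain ⟨L', hL'⟩ := half_line Φ hC h0 (Or.inr rfl)
  have h1 : Tendsto (uu Φ C) (𝓝[>] 0) (𝓝 L) := by
    refine (hL.comp Real.tendsto_log_nhdsGT_zero).congr' ?_
    filter_upwards [self_mem_nhdsWithin] with x hx
    simp only [Function.comp, Real.exp_log hx, one_mul]
  have h2 : Tendsto (fun x => uu Φ C (-x)) (𝓝[>] 0) (𝓝 L') := by
    refine (hL'.comp Real.tendsto_log_nhdsGT_zero).congr' ?_
    filter_upwards [self_mem_nhdsWithin] with x hx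
    simp only [Function.comp, Real.exp_log hx, neg_one_mul]
  have h3 : Tendsto (fun x => (C x - C (-x)) * lg x) (𝓝 0) (𝓝 0) := by
    have hd : HasDerivAt (fun x => C x - C (-x)) (deriv C 0 + deriv C 0) 0 := by
      have a := smooth_has hC 0
      have b : HasDerivAt (fun x => C (-x)) (-deriv C 0) 0 := by
        have h1 : HasDerivAt C (deriv C 0) (-(0:ℝ)) := by rw [neg_zero]; exact smooth_has hC 0
        have h2 := h1.scomp (0:ℝ) (hasDerivAt_neg (0:ℝ))
        rw [neg_one_smul] at h2
        exact h2
      have h := a.sub b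
      rw [sub_neg_eq_add] at h
      exact h
    have hO := hd.isBigO_sub
    simp only [neg_zero, sub_self, sub_zero] at hO
    have hO2 : (fun x : ℝ => (C x - C (-x)) * lg x) =O[𝓝 0] fun x : ℝ => (x : ℂ) * lg x := by
      refine Asymptotics.IsBigO.mul ?_ (Asymptotics.isBigO_refl _ _)
      refine hO.trans (Asymptotics.IsBigO.of_bound 1 (Eventually.of_forall fun x => ?_))
      simp
    exact hO2.trans_tendsto mul_lg
  have h4 : L - L' = 0 := by
    have hle : 𝓝[>] (0:ℝ) ≤ 𝓝[≠] 0 := nhdsWithin_mono _ fun x hx => ne_of_gt hx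
    have h5 := ((antisym Φ).mono_left hle).sub (h3.mono_left nhdsWithin_le_nhds)
    rw [sub_zero] at h5
    refine tendsto_nhds_unique (h1.sub h2) (h5.congr fun x => ?_)
    simp only [uu, lg, Real.log_neg_eq_log]; ring
  obtain rfl : L = L' := sub_eq_zero.1 h4
  have h6 : Tendsto (uu Φ C) (𝓝[<] 0) (𝓝 L) := by
    have hn : Tendsto (fun x : ℝ => -x) (𝓝[<] 0) (𝓝[>] 0) := by
      simpa using tendsto_neg_nhdsLT (a := (0:ℝ))
    simpa [Function.comp_def] using h2.comp hn
  have h7 : Tendsto (uu Φ C) (𝓝[≠] 0) (𝓝 L) := by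
    rw [← nhdsLT_sup_nhdsGT]; exact h6.sup h1
  refine ⟨Function.update (uu Φ C) 0 L, ?_, fun x hx => by simp [hx]⟩
  rw [continuous_iff_continuousAt]
  intro x
  by_cases hx : x = 0
  · subst hx
    exact continuousAt_update_same.2 h7
  · rw [continuousAt_update_of_ne hx]
    exact (uu_deriv Φ hC hx).continuousAt

/-- coefficient condition -/
def Coef (Φ : 𝓢₂) (C : ℝ → ℂ) : Prop :=
  ∀ k : ℕ, (k.factorial : ℂ) * iteratedDeriv k C 0 = -2 * ((fun Ψ : 𝓢₂ => dY (dX Ψ))^[k] Φ) (0, 0)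

lemma Coef.shift {Φ : 𝓢₂} {C : ℝ → ℂ} (hC : ContDiff ℝ (⊤ : ℕ∞) C) (h : Coef Φ C) :
    Coef (dY (dX Φ)) (EE C) := by
  intro k
  have h1 := h (k + 1)
  rw [Function.iterate_succ_apply] at h1
  rw [← h1]
  have e : EE C = deriv (fun x : ℝ => (x : ℂ) * deriv C x) := by
    funext x
    refine Eq.symm (((of_real_deriv x).mul (smooth_has (smooth_deriv hC) x)).deriv.trans ?_)
    simp [EE]
  rw [e, ← iteratedDeriv_succ', iter_mul_id _ (smooth_deriv hC), ← iteratedDeriv_succ',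
    ← iteratedDeriv_succ', Nat.factorial_succ]
  push_cast
  ring

lemma main (n : ℕ) : ∀ (Φ : 𝓢₂) (C : ℝ → ℂ), ContDiff ℝ (⊤ : ℕ∞) C → Coef Φ C →
    ∃ R : ℝ → ℂ, ContDiff ℝ n R ∧ ∀ x ≠ 0, R x = uu Φ C x := by
  have hb : ∀ (Φ : 𝓢₂) (C : ℝ → ℂ), Coef Φ C → C 0 = -2 * Φ (0, 0) := fun Φ C h => by
    simpa using h 0
  induction n with
  | zero =>
    intro Φ C hC h
    obtain ⟨R, hR, hR'⟩ := base Φ hC (hb _ _ h)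
    exact ⟨R, contDiff_zero.2 hR, hR'⟩
  | succ n ih =>
    intro Φ C hC h
    obtain ⟨R, hR, hR'⟩ := base Φ hC (hb _ _ h)
    obtain ⟨S, hS, hS'⟩ := ih _ _ (smooth_EE hC) (h.shift hC)
    let g : ℝ → ℂ := fun x => S x - 2 * deriv C x
    have hg : ContDiff ℝ n g :=
      hS.sub (contDiff_const.mul ((smooth_deriv hC).of_le (by exact_mod_cast le_top)))
    have hgg : ∀ x ≠ 0, gg Φ C x = g x := fun x hx => by
      simp only [g, hS' x hx, gg, uu]
    have hw0 : Tendsto (ww Φ C) (𝓝[≠] 0) (𝓝 0) :=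
      (ww_lim Φ hC (hb _ _ h)).mono_left nhdsWithin_le_nhds
    let w := Function.update (ww Φ C) 0 0
    have hwne : ∀ x ≠ 0, HasDerivAt w (g x) x := fun x hx => by
      have := ww_deriv Φ hC hx
      rw [hgg x hx] at this
      refine this.congr_of_eventuallyEq ?_
      filter_upwards [isOpen_ne.mem_nhds hx] with y hy
      simp [w, show y ≠ 0 from hy]
    have hw : ∀ x, HasDerivAt w (g x) x :=
      fun x => hasDerivAt_of_hasDerivAt_of_ne' (x := 0) hwne
        (continuousAt_update_same.2 hw0) hg.continuous.continuousAt x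
    have hwa := eq_mul_avg g w hg.continuous hw (by simp [w])
    have hav := avg_smooth n 0 g hg
    have hRne : ∀ x ≠ 0, HasDerivAt R (avg 0 g x) x := fun x hx => by
      have h1 := uu_deriv Φ hC hx
      have h2 : ww Φ C x = w x := by simp [w, hx]
      have hx' : (x : ℂ) ≠ 0 := by exact_mod_cast hx
      rw [h2, hwa, inv_mul_cancel_left₀ hx'] at h1
      refine h1.congr_of_eventuallyEq ?_
      filter_upwards [isOpen_ne.mem_nhds hx] with y hy
      exact hR' y hy
    have hRd : ∀ x, HasDerivAt R (avg 0 g x) x :=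
      fun x => hasDerivAt_of_hasDerivAt_of_ne' (x := 0) hRne
        hR.continuousAt hav.continuous.continuousAt x
    refine ⟨R, ?_, hR'⟩
    have : ContDiff ℝ ((n : WithTop ℕ∞) + 1) R := by
      rw [contDiff_succ_iff_deriv]
      refine ⟨fun x => (hRd x).differentiableAt, by simp, ?_⟩
      rwa [show deriv R = avg 0 g from funext fun x => (hRd x).deriv]
    exact_mod_cast this

lemma final (Φ : 𝓢₂) : ∃ C₀ C₁ : ℝ → ℂ,
      (∀ n : ℕ, ContDiff ℝ n C₀) ∧ (∀ n : ℕ, ContDiff ℝ n C₁) ∧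
      ∀ ξ : ℝ, ξ ≠ 0 →
        pushTwoR Φ ξ = C₀ ξ + C₁ ξ * ((Real.log |ξ| : ℝ) : ℂ) := by
  obtain ⟨C, hC, hc⟩ := borel fun k =>
    (-2 * ((fun Ψ : 𝓢₂ => dY (dX Ψ))^[k] Φ) (0, 0)) / (k.factorial : ℂ)
  have hco : Coef Φ C := fun k => by
    have : (k.factorial : ℂ) ≠ 0 := by exact_mod_cast k.factorial_ne_zero
    rw [hc k, mul_div_cancel₀ _ this]
  choose R hR hR' using fun n => main n Φ C hC hco
  have hRR : ∀ n, R n = R 0 := fun n => by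
    have hd : Dense ({0}ᶜ : Set ℝ) := dense_compl_singleton 0
    refine Continuous.ext_on hd (hR n).continuous (hR 0).continuous fun x hx => ?_
    rw [hR' n x hx, hR' 0 x hx]
  refine ⟨R 0, C, fun n => hRR n ▸ hR n, fun n => hC.of_le (by exact_mod_cast le_top), ?_⟩
  intro ξ hξ
  rw [hR' 0 ξ hξ, Real.log_abs, uu, lg]
  ring


end Germ

/-- the case `d = 2` of the germ computation over `ℝ` (basic case `A₁`):
`f(ξ) = ∫ Φ(a, ξ/a) da/|a|` converges for `ξ ≠ 0`, is smooth away from `0`, rapidly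
decaying with all derivatives at infinity, and equals `C₀(ξ) + C₁(ξ)·log|ξ|` with
`C₀, C₁` smooth. -/
theorem germ_pushforward_real_two (Φ : SchwartzMap (ℝ × ℝ) ℂ) :
    (∀ ξ : ℝ, ξ ≠ 0 → IntegrableOn
        (fun a : ℝ => Φ (a, ξ / a) * ((|a|⁻¹ : ℝ) : ℂ)) ({0}ᶜ : Set ℝ)) ∧
    (∀ n : ℕ, ContDiffOn ℝ n (pushTwoR Φ) ({0}ᶜ : Set ℝ)) ∧
    (∀ N k : ℕ, Tendsto (fun ξ : ℝ => |ξ| ^ N * ‖iteratedDeriv k (pushTwoR Φ) ξ‖)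
      (cocompact ℝ) (nhds 0)) ∧
    (∃ C₀ C₁ : ℝ → ℂ,
      (∀ n : ℕ, ContDiff ℝ n C₀) ∧ (∀ n : ℕ, ContDiff ℝ n C₁) ∧
      ∀ ξ : ℝ, ξ ≠ 0 →
        pushTwoR Φ ξ = C₀ ξ + C₁ ξ * ((Real.log |ξ| : ℝ) : ℂ)) := by
  exact ⟨fun ξ hξ => (Germ.integrable Φ hξ).integrableOn, fun n => Germ.contDiffOn_push n Φ,
    fun N k => Germ.decay Φ N k, Germ.final Φ⟩
end
end
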